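/- Let φ ∈ C^∞(ℝ^n_y × ℝ^n_ξ) be real-valued with |det ∂_y∂_ξ φ(y,ξ)| ≥ C₀ > 0 for all (y,ξ), and with every entry h of ∂_y∂_ξ φ satisfying |∂_y^α h| ≤ C_α and |∂_ξ^β h| ≤ C_β for all |α|, |β| ≤ 2n+1. Let a ∈ C^∞(ℝ^n_x × ℝ^n_ξ) satisfy ∂_x^α ∂_ξ^β a ∈ L^∞(ℝ^n_x × ℝ^n_ξ) for all multi-indices with |α|, |β| ≤ ⌊n/2⌋+1, and assume a(x,ξ) = 0 whenever ξ lies outside some compact set K. Then the operator Tu(x) = ∫∫ e^{i(x·ξ + φ(y,ξ))} a(x,ξ) u(y) dy dξ, defined for Schwartz u, satisfies ‖Tu‖_{L²(ℝ^n)} ≤ C ‖u‖_{L²(ℝ^n)}, where C depends only on n, C₀, the phase constants, and sup_{|α|,|β| ≤ ⌊n/2⌋+1} ‖∂_x^α ∂_ξ^β a‖_{L^∞}, and is independent of K. -/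

import Mathlib

open MeasureTheory Complex SchwartzMap
open scoped BigOperators ENNReal Real RealInnerProductSpace

noncomputable section

/-- The derivative of `g` along the direction `v`. -/
def dLine {W F : Type*} [NormedAddCommGroup W] [NormedSpace ℝ W]
    [NormedAddCommGroup F] [NormedSpace ℝ F] (v : W) (g : W → F) : W → F :=
  fun z => fderiv ℝ g z v

/-- The iterated partial derivative `∂^α` along the coordinate directions `dirs`,
with multiplicities given by the multi-index `α`. -/
def mderiv {n : ℕ} {W F : Type*} [NormedAddCommGroup W] [NormedSpace ℝ W]
    [NormedAddCommGroup F] [NormedSpace ℝ F]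
    (dirs : Fin n → W) (α : Fin n → ℕ) (g : W → F) : W → F :=
  ((List.ofFn fun i => (dLine (dirs i) (F := F))^[α i]).foldr (· ∘ ·) id) g

/-- The length `|α|` of a multi-index. -/
def mdeg {n : ℕ} (α : Fin n → ℕ) : ℕ := ∑ i, α i

/-- The first-factor coordinate directions in `ℝ^n × ℝ^n`. -/
def dX {n : ℕ} (i : Fin n) : EuclideanSpace ℝ (Fin n) × EuclideanSpace ℝ (Fin n) :=
  (EuclideanSpace.single i 1, 0)

/-- The second-factor coordinate directions in `ℝ^n × ℝ^n`. -/
def dY {n : ℕ} (j : Fin n) : EuclideanSpace ℝ (Fin n) × EuclideanSpace ℝ (Fin n) :=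
  (0, EuclideanSpace.single j 1)

/-- The entry `∂²φ/∂u_i∂v_j` of the mixed Hessian of a function of two `ℝ^n` variables. -/
def mixedHessXY {n : ℕ}
    (φ : EuclideanSpace ℝ (Fin n) × EuclideanSpace ℝ (Fin n) → ℝ) (i j : Fin n) :
    EuclideanSpace ℝ (Fin n) × EuclideanSpace ℝ (Fin n) → ℝ :=
  dLine (dX i) (dLine (dY j) φ)



open scoped ContDiff

section calculus
variable {W F : Type*} [NormedAddCommGroup W] [NormedSpace ℝ W]
    [NormedAddCommGroup F] [NormedSpace ℝ F]

lemma dLine_contDiffOn {U : Set W} (hU : IsOpen U) (v : W) {g : W → F}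
    (hg : ContDiffOn ℝ ∞ g U) : ContDiffOn ℝ ∞ (dLine v g) U := by
  have := hg.fderiv_of_isOpen (m := ∞) hU (by simp)
  exact this.clm_apply contDiffOn_const

lemma dLine_iter_contDiffOn {U : Set W} (hU : IsOpen U) (v : W) (m : ℕ) {g : W → F}
    (hg : ContDiffOn ℝ ∞ g U) : ContDiffOn ℝ ∞ ((dLine v)^[m] g) U := by
  induction m generalizing g with
  | zero => exact hg
  | succ k ih => exact ih (dLine_contDiffOn hU v hg)

lemma dLine_contDiff (v : W) {g : W → F}
    (hg : ContDiff ℝ ∞ g) : ContDiff ℝ ∞ (dLine v g) := by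
  rw [← contDiffOn_univ] at *
  exact dLine_contDiffOn isOpen_univ v hg

lemma dLine_iter_contDiff (v : W) (m : ℕ) {g : W → F}
    (hg : ContDiff ℝ ∞ g) : ContDiff ℝ ∞ ((dLine v)^[m] g) := by
  rw [← contDiffOn_univ] at *
  exact dLine_iter_contDiffOn isOpen_univ v m hg

lemma dLine_congr {U : Set W} (hU : IsOpen U) (v : W) {f g : W → F} (h : Set.EqOn f g U) :
    Set.EqOn (dLine v f) (dLine v g) U := by
  intro x hx
  have : f =ᶠ[nhds x] g := Filter.eventuallyEq_of_mem (hU.mem_nhds hx) h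
  simp only [dLine, this.fderiv_eq]

lemma dLine_iter_congr {U : Set W} (hU : IsOpen U) (v : W) (m : ℕ) {f g : W → F}
    (h : Set.EqOn f g U) : Set.EqOn ((dLine v)^[m] f) ((dLine v)^[m] g) U := by
  induction m generalizing f g with
  | zero => exact h
  | succ k ih => exact ih (dLine_congr hU v h)

lemma cdo_diffAt {U : Set W} (hU : IsOpen U) {f : W → F} (hf : ContDiffOn ℝ ∞ f U) {x : W}
    (hx : x ∈ U) : DifferentiableAt ℝ f x :=
  (hf.contDiffAt (hU.mem_nhds hx)).differentiableAt (by simp)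

lemma dLine_iter_add {U : Set W} (hU : IsOpen U) (v : W) (m : ℕ) {f g : W → F}
    (hf : ContDiffOn ℝ ∞ f U) (hg : ContDiffOn ℝ ∞ g U) {x : W} (hx : x ∈ U) :
    (dLine v)^[m] (fun x => f x + g x) x = (dLine v)^[m] f x + (dLine v)^[m] g x := by
  induction m generalizing f g with
  | zero => rfl
  | succ k ih =>
    simp only [Function.iterate_succ_apply]
    rw [← ih (dLine_contDiffOn hU v hf) (dLine_contDiffOn hU v hg)]
    refine dLine_iter_congr hU v k ?_ hx
    intro y hy
    simp only [dLine]
    rw [fderiv_fun_add (cdo_diffAt hU hf hy) (cdo_diffAt hU hg hy)]; rfl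

lemma dLine_iter_sub (v : W) (m : ℕ) {f g : W → F}
    (hf : ContDiff ℝ ∞ f) (hg : ContDiff ℝ ∞ g) (x : W) :
    (dLine v)^[m] (fun x => f x - g x) x = (dLine v)^[m] f x - (dLine v)^[m] g x := by
  induction m generalizing f g with
  | zero => rfl
  | succ k ih =>
    simp only [Function.iterate_succ_apply]
    rw [← ih (dLine_contDiff v hf) (dLine_contDiff v hg)]
    refine congrFun (congrArg ((dLine _)^[k]) (funext fun y => ?_)) _
    simp only [dLine]
    rw [fderiv_fun_sub (hf.differentiable (by simp) y) (hg.differentiable (by simp) y)]; rfl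

lemma dLine_mul {U : Set W} (hU : IsOpen U) (v : W) {f g : W → ℂ}
    (hf : ContDiffOn ℝ ∞ f U) (hg : ContDiffOn ℝ ∞ g U) {x : W} (hx : x ∈ U) :
    dLine v (fun x => f x * g x) x = f x * dLine v g x + dLine v f x * g x := by
  simp only [dLine]
  rw [fderiv_fun_mul (cdo_diffAt hU hf hx) (cdo_diffAt hU hg hx)]
  simp [mul_comm]

lemma dLine_const_smul (v : W) (m : ℕ) (c : ℝ) {g : W → F} (hg : ContDiff ℝ ∞ g) (x : W) :
    (dLine v)^[m] (fun x => c • g x) x = c • (dLine v)^[m] g x := by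
  induction m generalizing g with
  | zero => rfl
  | succ k ih =>
    simp only [Function.iterate_succ_apply]
    rw [← ih (dLine_contDiff v hg)]
    refine congrFun (congrArg ((dLine _)^[k]) (funext fun y => ?_)) _
    simp only [dLine]
    rw [fderiv_fun_const_smul (hg.differentiable (by simp) y)]; rfl

lemma dLine_ofReal (v : W) (m : ℕ) {g : W → ℝ} (hg : ContDiff ℝ ∞ g) (x : W) :
    (dLine v)^[m] (fun x => (g x : ℂ)) x = (((dLine v)^[m] g x : ℝ) : ℂ) := by
  induction m generalizing g with
  | zero => rfl
  | succ k ih =>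
    simp only [Function.iterate_succ_apply]
    rw [← ih (dLine_contDiff v hg)]
    refine congrFun (congrArg ((dLine _)^[k]) (funext fun y => ?_)) _
    have h := (Complex.ofRealCLM.hasFDerivAt.comp y
      (hg.differentiable (by simp) y).hasFDerivAt).fderiv
    simp only [dLine]
    exact congrArg (fun L => L v) h

lemma leibniz {U : Set W} (hU : IsOpen U) (v : W) (m : ℕ) {f g : W → ℂ}
    (hf : ContDiffOn ℝ ∞ f U) (hg : ContDiffOn ℝ ∞ g U) {x : W} (hx : x ∈ U) :
    (dLine v)^[m] (fun x => f x * g x) x = ∑ ij ∈ Finset.HasAntidiagonal.antidiagonal m,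
      (m.choose ij.1 : ℂ) * ((dLine v)^[ij.1] f x * (dLine v)^[ij.2] g x) := by
  induction m generalizing f g with
  | zero => simp
  | succ k ih =>
    rw [Finset.sum_antidiagonal_choose_succ_mul
      (fun i j => (dLine v)^[i] f x * (dLine v)^[j] g x)]
    rw [Function.iterate_succ_apply]
    have h1 : Set.EqOn (dLine v (fun x => f x * g x))
      (fun x => f x * dLine v g x + dLine v f x * g x) U :=
      fun y hy => dLine_mul hU v hf hg hy
    rw [dLine_iter_congr hU v k h1 hx]
    have hf' := dLine_contDiffOn hU v hf
    have hg' := dLine_contDiffOn hU v hg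
    rw [dLine_iter_add hU v k (f := fun x => f x * dLine v g x) (g := fun x => dLine v f x * g x)
      (hf.mul hg') (hf'.mul hg) hx, ih hf hg', ih hf' hg]
    congr 1
    refine Finset.sum_congr rfl fun ij hij => ?_
    rw [Finset.HasAntidiagonal.mem_antidiagonal] at hij
    rw [← Nat.choose_symm_of_eq_add (n := k) (a := ij.1) (b := ij.2) hij.symm]
    rfl

/-- weighted bounds on iterated derivatives along `v` -/
def BW (v : W) (U : Set W) (w : W → ℝ) (N : ℕ) (M : ℝ) (f : W → ℂ) : Prop :=
  ContDiffOn ℝ ∞ f U ∧ ∀ m ≤ N, ∀ x ∈ U, ‖(dLine v)^[m] f x‖ ≤ M * w x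

lemma BW.mul {v : W} {U : Set W} (hU : IsOpen U) {w₁ w₂ : W → ℝ} {N : ℕ} {M₁ M₂ : ℝ}
    {f g : W → ℂ} (hf : BW v U w₁ N M₁ f) (hg : BW v U w₂ N M₂ g) :
    BW v U (fun x => w₁ x * w₂ x) N (2 ^ N * (M₁ * M₂)) (fun x => f x * g x) := by
  refine ⟨hf.1.mul hg.1, fun m hm x hx => ?_⟩
  rw [leibniz hU v m hf.1 hg.1 hx]
  have h1 : 0 ≤ M₁ * w₁ x := (norm_nonneg _).trans (hf.2 0 (by simp) x hx)
  have h2 : 0 ≤ M₂ * w₂ x := (norm_nonneg _).trans (hg.2 0 (by simp) x hx)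
  calc _ ≤ ∑ ij ∈ Finset.HasAntidiagonal.antidiagonal m, (m.choose ij.1 : ℝ) * ((M₁ * w₁ x) * (M₂ * w₂ x)) := by
        refine (norm_sum_le _ _).trans (Finset.sum_le_sum fun ij hij => ?_)
        rw [Finset.HasAntidiagonal.mem_antidiagonal] at hij
        rw [norm_mul, norm_mul, Complex.norm_natCast]
        gcongr
        · exact hf.2 _ (by omega) x hx
        · exact hg.2 _ (by omega) x hx
    _ = 2 ^ m * ((M₁ * w₁ x) * (M₂ * w₂ x)) := by
        rw [← Finset.sum_mul]
        congr 1
        rw [Finset.Nat.sum_antidiagonal_eq_sum_range_succ_mk]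
        exact_mod_cast Nat.sum_range_choose m
    _ ≤ 2 ^ N * ((M₁ * w₁ x) * (M₂ * w₂ x)) := by
        gcongr
        norm_num
    _ = _ := by ring

lemma BW.congr {v : W} {U : Set W} (hU : IsOpen U) {w w' : W → ℝ} {N : ℕ} {M : ℝ}
    {f g : W → ℂ} (hf : BW v U w N M f) (hw : Set.EqOn w w' U) (h : Set.EqOn f g U) :
    BW v U w' N M g := by
  refine ⟨hf.1.congr h.symm, fun m hm x hx => ?_⟩
  rw [← dLine_iter_congr hU v m h hx, ← hw hx]
  exact hf.2 m hm x hx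

lemma BW.mono {v : W} {U : Set W} {w : W → ℝ} {N N' : ℕ} {M M' : ℝ}
    {f : W → ℂ} (hf : BW v U w N M f) (hN : N' ≤ N) (hM : M ≤ M') (hw : ∀ x ∈ U, 0 ≤ w x) :
    BW v U w N' M' f :=
  ⟨hf.1, fun m hm x hx => (hf.2 m (hm.trans hN) x hx).trans
    (mul_le_mul_of_nonneg_right hM (hw x hx))⟩

lemma BW.dLine {v : W} {U : Set W} (hU : IsOpen U) {w : W → ℝ} {N : ℕ} {M : ℝ}
    {f : W → ℂ} (hf : BW v U w (N + 1) M f) : BW v U w N M (dLine v f) :=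
  ⟨dLine_contDiffOn hU v hf.1, fun m hm x hx => hf.2 (m + 1) (by omega) x hx⟩

lemma BW.inv (N : ℕ) (M : ℝ) : ∃ M' : ℝ, 0 ≤ M' ∧ ∀ (v : W) (U : Set W) (w : W → ℝ) (f : W → ℂ),
    IsOpen U → (∀ x ∈ U, 0 < w x) → BW v U w N M f → (∀ x ∈ U, w x ≤ ‖f x‖) →
    BW v U (fun x => (w x)⁻¹) N M' (fun x => (f x)⁻¹) := by
  induction N with
  | zero =>
    refine ⟨1, zero_le_one, fun v U w f hU hw hf h => ?_⟩
    have hne : ∀ x ∈ U, f x ≠ 0 := fun x hx h0 => by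
      have := h x hx; have := hw x hx; simp [h0] at *; linarith
    refine ⟨hf.1.inv hne, fun m hm x hx => ?_⟩
    obtain rfl : m = 0 := by omega
    simp only [Function.iterate_zero, id, norm_inv, one_mul]
    exact inv_anti₀ (hw x hx) (h x hx)
  | succ N ih =>
    obtain ⟨M', hM', H⟩ := ih
    refine ⟨max 1 (2 ^ N * (M * (2 ^ N * (M' * M')))), by positivity, fun v U w f hU hw hf h => ?_⟩
    have hne : ∀ x ∈ U, f x ≠ 0 := fun x hx h0 => by
      have := h x hx; have := hw x hx; simp [h0] at *; linarith
    have hN := H v U w f hU hw (hf.mono (by omega) le_rfl fun x hx => (hw x hx).le) h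
    refine ⟨hf.1.inv hne, fun m hm x hx => ?_⟩
    have hwi : 0 ≤ (w x)⁻¹ := (inv_pos.2 (hw x hx)).le
    cases m with
    | zero =>
      simp only [Function.iterate_zero, id, norm_inv]
      refine (inv_anti₀ (hw x hx) (h x hx)).trans ?_
      exact le_mul_of_one_le_left hwi (le_max_left _ _)
    | succ m =>
      have h1 := (hf.dLine hU).mul hU (hN.mul hU hN)
      have h2 : Set.EqOn (_root_.dLine v fun x => (f x)⁻¹)
          (fun x => (-1 : ℝ) • (_root_.dLine v f x * ((f x)⁻¹ * (f x)⁻¹))) U := by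
        intro y hy
        have hd := (cdo_diffAt hU hf.1 hy).hasFDerivAt
        have := (hasDerivAt_inv (hne y hy)).comp_hasFDerivAt_of_eq y hd rfl
        have h3 := this.fderiv
        simp only [_root_.dLine]
        have h4 := congrArg (fun L => L v) h3
        refine h4.trans ?_
        simp
        field_simp
      rw [Function.iterate_succ_apply, dLine_iter_congr hU v m h2 hx]
      have h5 : (_root_.dLine v)^[m]
          (fun x => (-1 : ℝ) • (_root_.dLine v f x * ((f x)⁻¹ * (f x)⁻¹))) x
          = (_root_.dLine v)^[m] (fun _ => (-1 : ℂ)) x * 0 +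
          (_root_.dLine v)^[m]
          (fun x => (-1 : ℂ) * (_root_.dLine v f x * ((f x)⁻¹ * (f x)⁻¹))) x := by
        simp
      have h6 : BW v U (fun _ => (1 : ℝ)) N 1 (fun _ => (-1 : ℂ)) := by
        refine ⟨contDiffOn_const, fun m _ x _ => ?_⟩
        cases m with
        | zero => simp
        | succ m =>
          have : ∀ m, (_root_.dLine v)^[m] (fun _ : W => (0 : ℂ)) = fun _ => 0 := by
            intro m
            induction m with
            | zero => rfl
            | succ k ih =>
              rw [Function.iterate_succ_apply]
              convert ih using 2
              ext y; simp [_root_.dLine]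
          have h7 : _root_.dLine v (fun _ : W => (-1 : ℂ)) = fun _ => 0 := by
            ext y; simp [_root_.dLine]
          rw [Function.iterate_succ_apply, h7, this]; simp
      have h8 : ∀ x ∈ U, (_root_.dLine v)^[m]
          (fun x => (-1 : ℂ) * (_root_.dLine v f x * ((f x)⁻¹ * (f x)⁻¹))) x
          = - (_root_.dLine v)^[m] (fun x => (_root_.dLine v f x * ((f x)⁻¹ * (f x)⁻¹))) x := by
        intro x hx
        rw [leibniz hU v m h6.1 h1.1 hx]
        rw [Finset.sum_eq_single (0, m)]
        · simp
        · rintro ⟨i, j⟩ hij hne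
          rw [Finset.HasAntidiagonal.mem_antidiagonal] at hij
          have hi : i ≠ 0 := by rintro rfl; simp at hij; simp [hij] at hne
          obtain ⟨i, rfl⟩ := Nat.exists_eq_succ_of_ne_zero hi
          have : ∀ m, (_root_.dLine v)^[m] (fun _ : W => (0 : ℂ)) = fun _ => 0 := by
            intro m
            induction m with
            | zero => rfl
            | succ k ih =>
              rw [Function.iterate_succ_apply]
              convert ih using 2
              ext y; simp [_root_.dLine]
          have h7 : _root_.dLine v (fun _ : W => (-1 : ℂ)) = fun _ => 0 := by
            ext y; simp [_root_.dLine]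
          simp only [Nat.succ_eq_add_one, Function.iterate_succ_apply, h7, this]; simp
        · simp
      rw [h5, mul_zero, zero_add, h8 x hx, norm_neg]
      refine (h1.2 m (by omega) x hx).trans ?_
      have : w x * ((w x)⁻¹ * (w x)⁻¹) = (w x)⁻¹ := by
        have := (hw x hx).ne'; field_simp
      simp only [this]
      exact mul_le_mul_of_nonneg_right (le_max_right _ _) hwi

lemma dLine_iter_comp_sub (v c : W) (m : ℕ) (f : W → F) (x : W) :
    (dLine v)^[m] (fun x => f (x - c)) x = (dLine v)^[m] f (x - c) := by
  induction m generalizing f with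
  | zero => rfl
  | succ k ih =>
    simp only [Function.iterate_succ_apply]
    rw [← ih]
    refine congrFun (congrArg ((dLine _)^[k]) (funext fun y => ?_)) _
    simp only [dLine]
    rw [fderiv_comp_sub]

lemma dLine_snd (v : W) (m : ℕ) {g : W × W → F} (hg : ContDiff ℝ ∞ g) (y ξ : W) :
    (dLine v)^[m] (fun ξ => g (y, ξ)) ξ = (dLine ((0, v) : W × W))^[m] g (y, ξ) := by
  induction m generalizing g with
  | zero => rfl
  | succ k ih =>
    simp only [Function.iterate_succ_apply]
    rw [← ih (dLine_contDiff _ hg)]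
    refine congrFun (congrArg ((dLine _)^[k]) (funext fun η => ?_)) _
    simp only [dLine]
    have h := ((hg.differentiable (by simp) (y, η)).hasFDerivAt.comp η
      (hasFDerivAt_prodMk_right (𝕜 := ℝ) y η)).fderiv
    refine (congrArg (fun L => L v) h).trans ?_
    simp

lemma dLine_fst (v : W) (m : ℕ) {g : W × W → F} (hg : ContDiff ℝ ∞ g) (y ξ : W) :
    (dLine v)^[m] (fun y => g (y, ξ)) y = (dLine ((v, 0) : W × W))^[m] g (y, ξ) := by
  induction m generalizing g with
  | zero => rfl
  | succ k ih =>
    simp only [Function.iterate_succ_apply]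
    rw [← ih (dLine_contDiff _ hg)]
    refine congrFun (congrArg ((dLine _)^[k]) (funext fun η => ?_)) _
    simp only [dLine]
    have h := ((hg.differentiable (by simp) (η, ξ)).hasFDerivAt.comp η
      (hasFDerivAt_prodMk_left (𝕜 := ℝ) η ξ)).fderiv
    refine (congrArg (fun L => L v) h).trans ?_
    simp

lemma dLine_swap (v w : W) (m : ℕ) {g : W × W → F} (hg : ContDiff ℝ ∞ g) (z : W × W) :
    (dLine ((v, w) : W × W))^[m] (fun z => g z.swap) z
      = (dLine ((w, v) : W × W))^[m] g z.swap := by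
  induction m generalizing g with
  | zero => rfl
  | succ k ih =>
    simp only [Function.iterate_succ_apply]
    rw [← ih (dLine_contDiff _ hg)]
    refine congrFun (congrArg ((dLine _)^[k]) (funext fun η => ?_)) _
    simp only [dLine]
    have h := ((hg.differentiable (by simp) η.swap).hasFDerivAt.comp η
      ((ContinuousLinearEquiv.prodComm ℝ W W).hasFDerivAt)).fderiv
    refine (congrArg (fun L => L (v, w)) h).trans ?_
    simp

lemma dLine_comm (v w : W) {g : W → F} (hg : ContDiff ℝ ∞ g) :
    dLine v (dLine w g) = dLine w (dLine v g) := by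
  ext x
  have hs : IsSymmSndFDerivAt ℝ g x :=
    hg.contDiffAt.isSymmSndFDerivAt (by simp only [minSmoothness_of_isRCLikeNormedField]; exact WithTop.coe_le_coe.2 le_top)
  have hd : DifferentiableAt ℝ (fderiv ℝ g) x :=
    (hg.fderiv_right (m := ∞) (by simp)).differentiable (by simp) x
  have : ∀ a b : W, dLine a (dLine b g) x = fderiv ℝ (fderiv ℝ g) x a b := by
    intro a b
    unfold dLine
    rw [fderiv_clm_apply hd (differentiableAt_const b)]
    simp
  rw [this, this]
  exact hs v w

lemma dLine_iter_comm (v w : W) (m : ℕ) {g : W → F} (hg : ContDiff ℝ ∞ g) :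
    dLine v ((dLine w)^[m] g) = (dLine w)^[m] (dLine v g) := by
  induction m generalizing g with
  | zero => rfl
  | succ k ih =>
    simp only [Function.iterate_succ_apply]
    rw [ih (dLine_contDiff _ hg), dLine_comm v w hg]

lemma foldr_id {X : Type*} (n : ℕ) (f : Fin n → X → X) (h : ∀ i, f i = id) :
    (List.ofFn f).foldr (· ∘ ·) id = id := by
  induction n with
  | zero => simp
  | succ n ih =>
    rw [List.ofFn_succ, List.foldr_cons, ih _ (fun i => h _), h]; rfl

lemma foldr_single {X : Type*} (n : ℕ) (f : Fin n → X → X) (j : Fin n) (h : ∀ i ≠ j, f i = id) :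
    (List.ofFn f).foldr (· ∘ ·) id = f j := by
  induction n with
  | zero => exact j.elim0
  | succ n ih =>
    rw [List.ofFn_succ, List.foldr_cons]
    refine Fin.cases ?_ (fun j => ?_) j (motive := fun j => (∀ i ≠ j, f i = id) →
      f 0 ∘ List.foldr (· ∘ ·) id (List.ofFn fun i => f i.succ) = f j) h
    · intro h
      rw [foldr_id _ _ (fun i => h _ (Fin.succ_ne_zero i))]; rfl
    · intro h
      rw [ih (fun i => f i.succ) j (fun i hi => h _ (by simpa using hi)),
        h 0 (Fin.succ_ne_zero j).symm]; rfl

lemma mderiv_single {n : ℕ} (dirs : Fin n → W) (j : Fin n) (m : ℕ) (g : W → F) :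
    mderiv dirs (Pi.single j m) g = (dLine (dirs j))^[m] g := by
  unfold mderiv
  rw [foldr_single _ _ j]
  · simp
  · intro i hi
    simp [Pi.single_eq_of_ne hi]

lemma mdeg_single {n : ℕ} (j : Fin n) (m : ℕ) : mdeg (Pi.single j m : Fin n → ℕ) = m := by
  simp [mdeg]

end calculus



lemma hadamard {E : Type*} [NormedAddCommGroup E] [NormedSpace ℝ E] [FiniteDimensional ℝ E]
    (F : E → E) (hF : Differentiable ℝ F) (M L : ℝ) (hM : 0 < M) (hL : 0 ≤ L)
    (hinv : ∀ x v, ‖v‖ ≤ M * ‖fderiv ℝ F x v‖)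
    (hlip : ∀ x y, ‖fderiv ℝ F x - fderiv ℝ F y‖ ≤ L * ‖x - y‖) (a b : E) :
    ‖a - b‖ ≤ 2 * M * ‖F a - F b‖ := by
  haveI : CompleteSpace E := FiniteDimensional.complete ℝ E
  set R : ℝ := 1 / (2 * M * (L + 1)) with hR
  have hR0 : 0 < R := by positivity
  have hLR : L * R ≤ 1 / (2 * M) := by
    rw [hR, mul_one_div, div_le_div_iff₀ (by positivity) (by positivity)]
    nlinarith
  set r := R / 3 with hr
  have hr0 : 0 < r := by positivity
  set δ := r / (2 * M) with hδ
  have hδ0 : 0 < δ := by positivity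
  have approx : ∀ x, ∀ u ∈ Metric.closedBall x R, ∀ v ∈ Metric.closedBall x R,
      ‖F u - F v - fderiv ℝ F x (u - v)‖ ≤ L * R * ‖u - v‖ := by
    intro x u hu v hv
    refine (convex_closedBall x R).norm_image_sub_le_of_norm_fderiv_le' (𝕜 := ℝ)
      (fun y _ => hF y) (fun y hy => ?_) hv hu
    refine (hlip y x).trans ?_
    gcongr
    simpa [dist_eq_norm] using hy
  have hexp : ∀ x, ∀ u ∈ Metric.closedBall x R, ∀ v ∈ Metric.closedBall x R,
      ‖u - v‖ ≤ 2 * M * ‖F u - F v‖ := by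
    intro x u hu v hv
    have h1 := hinv x (u - v)
    have h2 := approx x u hu v hv
    have h3 : ‖fderiv ℝ F x (u - v)‖ ≤ ‖F u - F v‖ + L * R * ‖u - v‖ := by
      calc _ = ‖(F u - F v) - (F u - F v - fderiv ℝ F x (u - v))‖ := by congr 1; abel
        _ ≤ _ := (norm_sub_le _ _).trans (by gcongr)
    have h4 : L * R * ‖u - v‖ ≤ 1 / (2 * M) * ‖u - v‖ := by gcongr
    have h5 : M * (‖F u - F v‖ + 1 / (2 * M) * ‖u - v‖) = M * ‖F u - F v‖ + ‖u - v‖ / 2 := by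
      field_simp
    have h6 : ‖u - v‖ ≤ M * (‖F u - F v‖ + 1 / (2 * M) * ‖u - v‖) :=
      h1.trans (by gcongr; linarith)
    linarith
  have hsurj : ∀ x p, ‖p - F x‖ ≤ δ → ∃ x', ‖x' - x‖ ≤ r ∧ F x' = p := by
    intro x p hp
    have hinj : Function.Injective (fderiv ℝ F x : E →ₗ[ℝ] E) := by
      rw [← LinearMap.ker_eq_bot, LinearMap.ker_eq_bot']
      intro v hv
      have := hinv x v
      have hv' : fderiv ℝ F x v = 0 := hv
      rw [hv', norm_zero, mul_zero] at this
      exact norm_le_zero_iff.1 this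
    have hs : Function.Surjective (fderiv ℝ F x : E →ₗ[ℝ] E) :=
      LinearMap.injective_iff_surjective.1 hinj
    choose g hg using hs
    let S : (fderiv ℝ F x).NonlinearRightInverse :=
      { toFun := g
        nnnorm := ⟨M, hM.le⟩
        bound' := fun y => by
          have := hinv x (g y)
          have h2 : fderiv ℝ F x (g y) = y := hg y
          rw [h2] at this
          exact this
        right_inv' := fun y => hg y }
    have hap : ApproximatesLinearOn F (fderiv ℝ F x) (Metric.closedBall x R)
        ⟨L * R, by positivity⟩ := by
      intro u hu v hv
      exact approx x u hu v hv
    have := hap.surjOn_closedBall_of_nonlinearRightInverse S (ε := r) (b := x) hr0.le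
      (Metric.closedBall_subset_closedBall (by rw [hr]; linarith))
    have hp' : p ∈ Metric.closedBall (F x) (((S.nnnorm : ℝ)⁻¹ -
        ((⟨L * R, by positivity⟩ : NNReal) : ℝ)) * r) := by
      rw [mem_closedBall_iff_norm]
      refine hp.trans ?_
      change r / (2 * M) ≤ (M⁻¹ - L * R) * r
      have : (1 : ℝ) / (2 * M) ≤ M⁻¹ - L * R := by
        have : M⁻¹ = 1 / (2 * M) + 1 / (2 * M) := by field_simp; norm_num
        linarith
      calc r / (2 * M) = 1 / (2 * M) * r := by ring
        _ ≤ _ := by gcongr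
    obtain ⟨x', hx', h⟩ := this hp'
    exact ⟨x', by simpa [dist_eq_norm] using hx', h⟩
  choose! σ hσ using hsurj
  have hdist : ∀ x x' p p', ‖p - F x‖ ≤ δ → ‖p' - F x'‖ ≤ δ → ‖x' - x‖ ≤ r →
      ‖σ x' p' - σ x p‖ ≤ 2 * M * ‖p' - p‖ := by
    intro x x' p p' h1 h2 h3
    obtain ⟨h4, h5⟩ := hσ x p h1
    obtain ⟨h6, h7⟩ := hσ x' p' h2
    have := hexp x (σ x' p') ?_ (σ x p) ?_
    · rwa [h5, h7] at this
    · rw [mem_closedBall_iff_norm]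
      have := norm_sub_le_norm_sub_add_norm_sub (σ x' p') x' x
      rw [hr] at *; linarith
    · rw [mem_closedBall_iff_norm]; rw [hr] at *; linarith
  have hdist0 : ∀ x p, ‖p - F x‖ ≤ δ → ‖σ x p - x‖ ≤ 2 * M * ‖p - F x‖ := by
    intro x p h1
    obtain ⟨h4, h5⟩ := hσ x p h1
    have := hexp x (σ x p) ?_ x ?_
    · rwa [h5] at this
    · rw [mem_closedBall_iff_norm]; rw [hr] at *; linarith
    · simp [hR0.le]
  -- injectivity
  have inj : ∀ a b, F a = F b → a = b := by
    intro a b hab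
    set γ : unitInterval → E := fun t => a + (t : ℝ) • (b - a) with hγ
    have hγc : Continuous γ := by fun_prop
    set w : unitInterval → E := fun t => F (γ t) - F a with hw
    have hwc : Continuous w := (hF.continuous.comp hγc).sub continuous_const
    obtain ⟨K, hK⟩ : ∃ K, ∀ t, ‖w t‖ ≤ K := by
      obtain ⟨K, hK⟩ := (isCompact_range hwc).isBounded.exists_norm_le
      exact ⟨K, fun t => hK _ ⟨t, rfl⟩⟩
    obtain ⟨N, hN⟩ := exists_nat_gt (K / δ)
    have hK0 : 0 ≤ K := (norm_nonneg _).trans (hK 0)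
    have hN0 : (0 : ℝ) < N := lt_of_le_of_lt (by positivity) hN
    have hKN : K / N ≤ δ := by
      rw [div_lt_iff₀ hδ0] at hN
      rw [div_le_iff₀ hN0]; linarith
    set p : ℕ → unitInterval → E := fun i t => F a + (1 - (i : ℝ) / N) • w t with hp
    let x : ℕ → unitInterval → E := fun i => Nat.rec γ (fun i xi t => σ (xi t) (p (i + 1) t)) i
    have hx0 : x 0 = γ := rfl
    have hxs : ∀ i t, x (i + 1) t = σ (x i t) (p (i + 1) t) := fun i t => rfl
    have hstep : ∀ i t, ‖p (i + 1) t - p i t‖ ≤ δ := by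
      intro i t
      have : p (i + 1) t - p i t = (-(1 / (N : ℝ))) • w t := by
        simp only [hp]
        rw [add_sub_add_left_eq_sub, ← sub_smul]
        congr 1
        push_cast; ring
      rw [this, norm_smul, norm_neg, Real.norm_of_nonneg (by positivity)]
      calc _ = ‖w t‖ / N := by ring
        _ ≤ K / N := by gcongr; exact hK t
        _ ≤ δ := hKN
    have hFx : ∀ i t, F (x i t) = p i t := by
      intro i
      induction i with
      | zero => intro t; simp [hx0, hp, hw]
      | succ i ih =>
        intro t
        rw [hxs]
        exact (hσ _ _ (by rw [ih]; exact hstep i t)).2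
    have hc : ∀ i, Continuous (x i) := by
      intro i
      induction i with
      | zero => exact hγc
      | succ i ih =>
        rw [continuous_iff_continuousAt]
        intro t
        have hpc : Continuous (p (i + 1)) := by fun_prop
        have h1 : ∀ᶠ t' in nhds t, ‖x i t' - x i t‖ ≤ r := by
          have := (ih.tendsto t).eventually (Metric.closedBall_mem_nhds (x i t) hr0)
          simpa [dist_eq_norm] using this
        rw [ContinuousAt, tendsto_iff_norm_sub_tendsto_zero]
        have h2 : Filter.Tendsto (fun t' => 2 * M * ‖p (i + 1) t' - p (i + 1) t‖) (nhds t)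
            (nhds 0) := by
          have := (tendsto_iff_norm_sub_tendsto_zero.1 (hpc.tendsto t)).const_mul (2 * M)
          simpa using this
        refine squeeze_zero' (Filter.Eventually.of_forall fun _ => norm_nonneg _) ?_ h2
        filter_upwards [h1] with t' ht'
        rw [hxs, hxs]
        exact hdist _ _ _ _ (by rw [hFx]; exact hstep i t) (by rw [hFx]; exact hstep i t') ht'
    have hN1 : ∀ t, p N t = F a := by
      intro t; simp [hp, hN0.ne']
    have hlc : IsLocallyConstant (x N) := by
      rw [IsLocallyConstant.iff_eventually_eq]
      intro t
      have := ((hc N).tendsto t).eventually (Metric.closedBall_mem_nhds (x N t) hR0)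
      filter_upwards [this] with t' ht'
      have := hexp (x N t) (x N t') ht' (x N t) (by simp [hR0.le])
      rw [hFx, hFx, hN1, hN1, sub_self, norm_zero, mul_zero] at this
      exact sub_eq_zero.1 (norm_le_zero_iff.1 this)
    have hfix : ∀ t, w t = 0 → ∀ i, x i t = γ t := by
      intro t ht i
      induction i with
      | zero => rfl
      | succ i ih =>
        have h1 : p (i + 1) t = F (x i t) := by rw [hFx]; simp [hp, ht]
        have h2 := hdist0 (x i t) (p (i + 1) t) (by rw [h1]; simp [hδ0.le])
        rw [hxs]
        rw [h1, sub_self, norm_zero, mul_zero, ← h1] at h2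
        rw [sub_eq_zero.1 (norm_le_zero_iff.1 h2), ih]
    have e0 := hfix 0 (by simp [hw, hγ]) N
    have e1 := hfix 1 (by simp [hw, hγ, hab]) N
    have := hlc.apply_eq_of_preconnectedSpace 0 1
    rw [e0, e1] at this
    simpa [hγ] using this
  -- lifting the segment
  obtain ⟨N, hN⟩ := exists_nat_gt (‖F b - F a‖ / δ)
  have hN0 : (0 : ℝ) < N := lt_of_le_of_lt (by positivity) hN
  have hKN : ‖F b - F a‖ / N ≤ δ := by
    rw [div_lt_iff₀ hδ0] at hN
    rw [div_le_iff₀ hN0]; linarith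
  set p : ℕ → E := fun i => F a + ((i : ℝ) / N) • (F b - F a) with hp
  let x : ℕ → E := fun i => Nat.rec a (fun i xi => σ xi (p (i + 1))) i
  have hx0 : x 0 = a := rfl
  have hxs : ∀ i, x (i + 1) = σ (x i) (p (i + 1)) := fun i => rfl
  have hstep : ∀ i, ‖p (i + 1) - p i‖ = ‖F b - F a‖ / N := by
    intro i
    have : p (i + 1) - p i = (1 / (N : ℝ)) • (F b - F a) := by
      simp only [hp]
      rw [add_sub_add_left_eq_sub, ← sub_smul]
      congr 1
      push_cast; ring
    rw [this, norm_smul, Real.norm_of_nonneg (by positivity)]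
    ring
  have hFx : ∀ i, F (x i) = p i := by
    intro i
    induction i with
    | zero => simp [hx0, hp]
    | succ i ih =>
      rw [hxs]
      exact (hσ _ _ (by rw [ih, hstep]; exact hKN)).2
  have hb : ∀ i : ℕ, ‖x i - a‖ ≤ 2 * M * (i * (‖F b - F a‖ / N)) := by
    intro i
    induction i with
    | zero => simp [hx0]
    | succ i ih =>
      have h1 := hdist0 (x i) (p (i + 1)) (by rw [hFx, hstep]; exact hKN)
      rw [← hxs, hFx, hstep] at h1
      have := norm_sub_le_norm_sub_add_norm_sub (x (i + 1)) (x i) a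
      push_cast
      linarith
  have hxN : x N = b := inj _ _ (by rw [hFx]; simp [hp, hN0.ne'])
  have := hb N
  rw [hxN, mul_div_cancel₀ _ hN0.ne'] at this
  rw [norm_sub_rev a b, norm_sub_rev (F a)]
  exact this


open scoped ContDiff

section nsp
variable {E : Type*} [NormedAddCommGroup E] [NormedSpace ℝ E] [FiniteDimensional ℝ E]
  [MeasurableSpace E] [BorelSpace E] {μ : Measure E} [μ.IsAddHaarMeasure]

lemma tsupport_dLine_subset (v : E) (g : E → ℂ) : tsupport (dLine v g) ⊆ tsupport g :=
  tsupport_fderiv_apply_subset ℝ v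

lemma ibp (v : E) {f g : E → ℂ} (hf : ContDiff ℝ ∞ f) (hg : ContDiff ℝ ∞ g)
    (hgs : HasCompactSupport g) :
    ∫ x, f x * dLine v g x ∂μ = - ∫ x, dLine v f x * g x ∂μ := by
  have hg's : HasCompactSupport (dLine v g) := hgs.mono' ((subset_tsupport _).trans
    (tsupport_dLine_subset v g))
  refine integral_mul_fderiv_eq_neg_fderiv_mul_of_integrable ?_ ?_ ?_ ?_ ?_
  · exact ((dLine_contDiff v hf).continuous.mul hg.continuous).integrable_of_hasCompactSupport
      hgs.mul_left
  · exact (hf.continuous.mul (dLine_contDiff v hg).continuous).integrable_of_hasCompactSupport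
      hg's.mul_left
  · exact (hf.continuous.mul hg.continuous).integrable_of_hasCompactSupport hgs.mul_left
  · exact fun x _ => hf.differentiable (by simp) x
  · exact fun x _ => hg.differentiable (by simp) x

lemma dLine_exp (v : E) (c : ℂ) {p : E → ℝ} (hp : ContDiff ℝ ∞ p) (x : E) :
    dLine v (fun x => Complex.exp (c * (p x : ℂ))) x =
      c * ((dLine v p x : ℝ) : ℂ) * Complex.exp (c * (p x : ℂ)) := by
  have h0 := ((Complex.ofRealCLM.hasFDerivAt.comp x
      (hp.differentiable (by simp) x).hasFDerivAt).const_mul c).cexp.fderiv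
  have := congrArg (fun L => L v) h0
  refine this.trans ?_
  simp [dLine]
  ring

lemma nsp (N : ℕ) (c : ℝ) (hc : 0 < c) (M : ℝ) (Mg : ℝ) :
    ∃ C : ℝ, 0 ≤ C ∧ ∀ (v : E) (p : E → ℝ) (g : E → ℂ) (U S : Set E), ContDiff ℝ ∞ p → IsOpen U →
      IsCompact S → S ⊆ U → ContDiff ℝ ∞ g → tsupport g ⊆ S →
      (∀ x ∈ U, c ≤ |dLine v p x|) →
      (∀ m ≤ N, ∀ x ∈ U, |(dLine v)^[m] (dLine v p) x| ≤ M) →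
      (∀ m ≤ N, ∀ x ∈ U, ‖(dLine v)^[m] g x‖ ≤ Mg) → ∀ l : ℝ, 0 < l →
      ‖∫ x, Complex.exp (Complex.I * l * (p x : ℂ)) * g x ∂μ‖ ≤ C * (l ^ N)⁻¹ * μ.real S := by
  induction N generalizing Mg with
  | zero =>
    refine ⟨max Mg 0, by simp, fun v p g U S hp hU hS hSU hg hgS _ _ hMg l hl => ?_⟩
    have h1 : ∫ x, Complex.exp (Complex.I * l * (p x : ℂ)) * g x ∂μ
        = ∫ x in S, Complex.exp (Complex.I * l * (p x : ℂ)) * g x ∂μ := by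
      rw [setIntegral_eq_integral_of_forall_compl_eq_zero]
      intro x hx
      rw [image_eq_zero_of_notMem_tsupport (fun h => hx (hgS h)), mul_zero]
    rw [h1]
    have := norm_setIntegral_le_of_norm_le_const (μ := μ) (C := max Mg 0)
      (f := fun x => Complex.exp (Complex.I * l * (p x : ℂ)) * g x) hS.measure_lt_top
      (fun x hx => ?_)
    · simpa using this
    · have h2 : ‖Complex.exp (Complex.I * l * (p x : ℂ))‖ = 1 := by
        rw [show Complex.I * l * (p x : ℂ) = ((l * p x : ℝ) : ℂ) * Complex.I by push_cast; ring]
        exact Complex.norm_exp_ofReal_mul_I _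
      rw [norm_mul, h2, one_mul]
      exact (hMg 0 le_rfl x (hSU hx)).trans (le_max_left _ _)
  | succ N ih =>
    obtain ⟨M', hM', Hinv⟩ := BW.inv (W := E) (N + 1) (M / c)
    obtain ⟨C, hC, H⟩ := ih (2 ^ (N + 1) * (Mg * M') * (1 * c⁻¹))
    refine ⟨C, hC, fun v p g U S hp hU hS hSU hg hgS hlow hMp hMg l hl => ?_⟩
    have hp' : ContDiff ℝ ∞ (dLine v p) := dLine_contDiff v hp
    set q : E → ℂ := fun x => ((dLine v p x : ℝ) : ℂ) with hq
    have hqs : ContDiff ℝ ∞ q := Complex.ofRealCLM.contDiff.comp hp'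
    have hBq : BW v U (fun _ => c) (N + 1) (M / c) q := by
      refine ⟨hqs.contDiffOn, fun m hm x hx => ?_⟩
      rw [hq, dLine_ofReal v m hp', Complex.norm_real, div_mul_cancel₀ _ hc.ne']
      exact hMp m hm x hx
    have hBi := Hinv v U (fun _ => c) q hU (fun _ _ => hc) hBq (fun x hx => by
      simpa [hq] using hlow x hx)
    have hBg : BW v U (fun _ => 1) (N + 1) Mg g :=
      ⟨hg.contDiffOn, fun m hm x hx => by simpa using hMg m hm x hx⟩
    have hBgi := hBg.mul hU hBi
    set g1 : E → ℂ := fun x => g x * (q x)⁻¹ with hg1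
    have hg1S : tsupport g1 ⊆ S := (tsupport_mul_subset_left).trans hgS
    have hg1s : ContDiff ℝ ∞ g1 := by
      rw [contDiff_iff_contDiffAt]
      intro x
      by_cases hx : x ∈ U
      · exact hBgi.1.contDiffAt (hU.mem_nhds hx)
      · have : x ∈ (tsupport g1)ᶜ := fun h => hx (hSU (hg1S h))
        have h0 : g1 =ᶠ[nhds x] fun _ => 0 := by
          filter_upwards [(isClosed_tsupport g1).isOpen_compl.mem_nhds this] with y hy
          exact image_eq_zero_of_notMem_tsupport hy
        exact contDiffAt_const.congr_of_eventuallyEq h0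
    have hcs : HasCompactSupport g1 := hS.of_isClosed_subset (isClosed_tsupport _) hg1S
    have key := H v p (dLine v g1) U S hp hU hS hSU (dLine_contDiff v hg1s)
      ((tsupport_dLine_subset v g1).trans hg1S) hlow (fun m hm => hMp m (by omega))
      (fun m hm => (hBgi.dLine hU).2 m hm) l hl
    have hexp : ContDiff ℝ ∞ (fun x => Complex.exp (Complex.I * l * (p x : ℂ))) :=
      (contDiff_const.mul (Complex.ofRealCLM.contDiff.comp hp)).cexp
    rw [ibp (μ := μ) v hexp hg1s hcs] at key
    have h3 : ∀ x, dLine v (fun x => Complex.exp (Complex.I * l * (p x : ℂ))) x * g1 x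
        = (Complex.I * l) * (Complex.exp (Complex.I * l * (p x : ℂ)) * g x) := by
      intro x
      rw [dLine_exp v _ hp]
      by_cases hx : x ∈ U
      · have : ((dLine v p x : ℝ) : ℂ) ≠ 0 := by
          intro h
          have := hlow x hx
          rw [Complex.ofReal_eq_zero.1 h] at this
          simp at this; linarith
        simp only [hg1, hq]
        field_simp
      · have : g x = 0 := image_eq_zero_of_notMem_tsupport (fun h => hx (hSU (hgS h)))
        simp [hg1, this]
    simp_rw [h3] at key
    rw [integral_const_mul, norm_neg, norm_mul, norm_mul, Complex.norm_I, one_mul,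
      Complex.norm_real, Real.norm_of_nonneg hl.le] at key
    rw [pow_succ, mul_inv]
    calc _ = l⁻¹ * (l * ‖∫ x, Complex.exp (Complex.I * l * (p x : ℂ)) * g x ∂μ‖) := by
          field_simp
      _ ≤ l⁻¹ * (C * (l ^ N)⁻¹ * μ.real S) := by gcongr
      _ = _ := by ring

end nsp


open scoped ContDiff

section cotlar
variable {H : Type*} [NormedAddCommGroup H] [InnerProductSpace ℂ H] [CompleteSpace H]

lemma cotlar_step {ι : Type} [Fintype ι] (T : ι → H →L[ℂ] H) (γ : ι → ι → ℝ) (M B : ℝ)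
    (hγ : ∀ i j, 0 ≤ γ i j) (hM : 0 ≤ M) (hB : 0 ≤ B) (hT : ∀ i, ‖T i‖ ≤ B)
    (h1 : ∀ i j, ‖star (T i) * T j‖ ≤ γ i j ^ 2) (h2 : ∀ i j, ‖T i * star (T j)‖ ≤ γ i j ^ 2)
    (hs : ∀ i, ∑ j, γ i j ≤ M) (m : ℕ) :
    ∃ (J : Type) (_ : Fintype J) (e : J → ι) (Y : J → H →L[ℂ] H) (p q : J → ℝ),
      (∀ w, 0 ≤ p w) ∧ (∀ w, 0 ≤ q w) ∧
      (star (∑ i, T i) * ∑ i, T i) ^ (m + 1) = ∑ w, Y w * T (e w) ∧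
      (∀ w, ‖Y w * T (e w)‖ ≤ p w ^ 2) ∧ (∀ w, ‖Y w‖ ≤ q w ^ 2) ∧
      ∑ w, p w * q w ≤ Fintype.card ι * √B * M * (M ^ 2) ^ m := by
  have hA : star (∑ i, T i) * ∑ i, T i = ∑ w : ι × ι, star (T w.1) * T w.2 := by
    rw [star_sum, Finset.sum_mul_sum, Fintype.sum_prod_type]
  induction m with
  | zero =>
    refine ⟨ι × ι, inferInstance, Prod.snd, fun w => star (T w.1), fun w => γ w.1 w.2, fun _ => √B,
      fun w => hγ _ _, fun w => Real.sqrt_nonneg _, ?_, fun w => h1 _ _, fun w => ?_, ?_⟩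
    · rw [zero_add, pow_one, hA]
    · rw [norm_star, Real.sq_sqrt hB]; exact hT _
    · rw [Fintype.sum_prod_type]
      calc ∑ x : ι, ∑ y, γ x y * √B ≤ ∑ x : ι, M * √B := by
            refine Finset.sum_le_sum fun x _ => ?_
            rw [← Finset.sum_mul]
            exact mul_le_mul_of_nonneg_right (hs x) (Real.sqrt_nonneg _)
        _ = _ := by simp; ring
  | succ m ih =>
    obtain ⟨J, _, e, Y, p, q, hp, hq, hE, hP, hQ, hS⟩ := ih
    refine ⟨J × (ι × ι), inferInstance, fun w => w.2.2, fun w => Y w.1 * T (e w.1) * star (T w.2.1),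
      fun w => p w.1 * γ w.2.1 w.2.2, fun w => q w.1 * γ (e w.1) w.2.1,
      fun w => mul_nonneg (hp _) (hγ _ _), fun w => mul_nonneg (hq _) (hγ _ _), ?_, fun w => ?_,
      fun w => ?_, ?_⟩
    · rw [pow_succ, hE, hA, Finset.sum_mul_sum, Fintype.sum_prod_type]
      simp only [mul_assoc]
    · rw [mul_assoc, mul_pow]
      exact (norm_mul_le _ _).trans (mul_le_mul (hP _) (h1 _ _) (norm_nonneg _) (by positivity))
    · show ‖Y w.1 * T (e w.1) * star (T w.2.1)‖ ≤ (q w.1 * γ (e w.1) w.2.1) ^ 2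
      rw [mul_assoc, mul_pow]
      exact (norm_mul_le _ _).trans (mul_le_mul (hQ _) (h2 _ _) (norm_nonneg _) (by positivity))
    · rw [Fintype.sum_prod_type]
      simp only [Fintype.sum_prod_type]
      calc ∑ w, ∑ i, ∑ j, p w * γ i j * (q w * γ (e w) i)
          ≤ ∑ w, ∑ i, (p w * q w * γ (e w) i) * M := by
            refine Finset.sum_le_sum fun w _ => Finset.sum_le_sum fun i _ => ?_
            calc _ = (p w * q w * γ (e w) i) * ∑ j, γ i j := by
                  rw [Finset.mul_sum]; exact Finset.sum_congr rfl fun j _ => by ring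
              _ ≤ _ := mul_le_mul_of_nonneg_left (hs i)
                  (mul_nonneg (mul_nonneg (hp _) (hq _)) (hγ _ _))
        _ ≤ ∑ w, (p w * q w * M) * M := by
            refine Finset.sum_le_sum fun w _ => ?_
            rw [← Finset.sum_mul, ← Finset.mul_sum]
            exact mul_le_mul_of_nonneg_right (mul_le_mul_of_nonneg_left (hs _)
              (mul_nonneg (hp _) (hq _))) hM
        _ = (∑ w, p w * q w) * M ^ 2 := by
            rw [Finset.sum_mul]; exact Finset.sum_congr rfl fun j _ => by ring
        _ ≤ (Fintype.card ι * √B * M * (M ^ 2) ^ m) * M ^ 2 :=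
            mul_le_mul_of_nonneg_right hS (by positivity)
        _ = _ := by ring

/-- Cotlar-Stein lemma. -/
lemma cotlar {ι : Type} [Fintype ι] (T : ι → H →L[ℂ] H) (γ : ι → ι → ℝ) (M : ℝ)
    (hγ : ∀ i j, 0 ≤ γ i j) (hM : 0 < M)
    (h1 : ∀ i j, ‖star (T i) * T j‖ ≤ γ i j ^ 2) (h2 : ∀ i j, ‖T i * star (T j)‖ ≤ γ i j ^ 2)
    (hs : ∀ i, ∑ j, γ i j ≤ M) : ‖∑ i, T i‖ ≤ M := by
  set B := ∑ i, ‖T i‖ with hBdef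
  have hB : 0 ≤ B := Finset.sum_nonneg fun _ _ => norm_nonneg _
  have hT : ∀ i, ‖T i‖ ≤ B := fun i =>
    Finset.single_le_sum (f := fun i => ‖T i‖) (fun _ _ => norm_nonneg _) (Finset.mem_univ i)
  set A := star (∑ i, T i) * ∑ i, T i with hAdef
  have hAn : ‖A‖ = ‖∑ i, T i‖ * ‖∑ i, T i‖ := CStarRing.norm_star_mul_self
  have hAsa : IsSelfAdjoint A := IsSelfAdjoint.star_mul_self _
  set K := √B * (Fintype.card ι * √B * M) with hK
  have key : ∀ m : ℕ, ‖A ^ (m + 1)‖ ≤ K * (M ^ 2) ^ m := by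
    intro m
    obtain ⟨J, _, e, Y, p, q, hp, hq, hE, hP, hQ, hS⟩ :=
      cotlar_step T γ M B hγ hM.le hB hT h1 h2 hs m
    rw [hE]
    have hb : ∀ w, ‖Y w * T (e w)‖ ≤ √B * (p w * q w) := by
      intro w
      have e1 := hP w
      have e2 : ‖Y w * T (e w)‖ ≤ q w ^ 2 * B :=
        (norm_mul_le _ _).trans (mul_le_mul (hQ w) (hT _) (norm_nonneg _) (by positivity))
      have hpq : 0 ≤ √B * (p w * q w) :=
        mul_nonneg (Real.sqrt_nonneg _) (mul_nonneg (hp w) (hq w))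
      refine (sq_le_sq₀ (norm_nonneg _) hpq).1 ?_
      calc ‖Y w * T (e w)‖ ^ 2 = ‖Y w * T (e w)‖ * ‖Y w * T (e w)‖ := sq _
        _ ≤ p w ^ 2 * (q w ^ 2 * B) := mul_le_mul e1 e2 (norm_nonneg _) (by positivity)
        _ = (√B * (p w * q w)) ^ 2 := by rw [mul_pow, Real.sq_sqrt hB]; ring
    calc ‖∑ w, Y w * T (e w)‖ ≤ ∑ w, ‖Y w * T (e w)‖ := norm_sum_le _ _
      _ ≤ ∑ w, √B * (p w * q w) := Finset.sum_le_sum fun w _ => hb w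
      _ = √B * ∑ w, p w * q w := by rw [Finset.mul_sum]
      _ ≤ √B * (Fintype.card ι * √B * M * (M ^ 2) ^ m) :=
          mul_le_mul_of_nonneg_left hS (Real.sqrt_nonneg _)
      _ = _ := by rw [hK]; ring
  by_contra! hcon
  have hgt : 1 < ‖A‖ / M ^ 2 := by
    rw [one_lt_div (by positivity), hAn, ← sq]
    exact pow_lt_pow_left₀ hcon hM.le (by norm_num)
  have hall : ∀ k : ℕ, (‖A‖ / M ^ 2) ^ (2 ^ k) ≤ K / M ^ 2 := by
    intro k
    obtain ⟨m, hm⟩ : ∃ m, 2 ^ k = m + 1 := ⟨2 ^ k - 1, by have := Nat.one_le_two_pow (n := k); omega⟩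
    have e1 : ‖A ^ (2 ^ k)‖ = ‖A‖ ^ (2 ^ k) := by
      have := hAsa.nnnorm_pow_two_pow k
      have h4 := congrArg NNReal.toReal this
      rw [NNReal.coe_pow, coe_nnnorm, coe_nnnorm] at h4
      exact h4
    have e2 := key m
    rw [← hm, e1] at e2
    rw [div_pow, div_le_div_iff₀ (by positivity) (by positivity)]
    calc ‖A‖ ^ 2 ^ k * M ^ 2 ≤ (K * (M ^ 2) ^ m) * M ^ 2 := by gcongr
      _ = _ := by rw [hm]; ring
  obtain ⟨k, hk⟩ := ((tendsto_pow_atTop_atTop_of_one_lt hgt).eventually_gt_atTop (K / M ^ 2)).exists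
  have := hall k
  have h3 : (‖A‖ / M ^ 2) ^ k ≤ (‖A‖ / M ^ 2) ^ (2 ^ k) :=
    pow_le_pow_right₀ hgt.le Nat.lt_two_pow_self.le
  linarith
end cotlar


open scoped ContDiff

/-- Euclidean space. -/
abbrev En (n : ℕ) := EuclideanSpace ℝ (Fin n)

/-- coordinate vector -/
abbrev ev {n : ℕ} (i : Fin n) : En n := EuclideanSpace.single i (1 : ℝ)

section phase
variable {n : ℕ}

lemma en_sum (v : En n) : v = ∑ i, v i • ev i := by
  have := (EuclideanSpace.basisFun (Fin n) ℝ).sum_repr v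
  simpa using this.symm

lemma en_coord_le (v : En n) (i : Fin n) : |v i| ≤ ‖v‖ := PiLp.norm_apply_le v i

lemma en_norm_le (v : En n) : ‖v‖ ≤ ∑ i, |v i| := by
  conv_lhs => rw [en_sum v]
  refine (norm_sum_le _ _).trans (Finset.sum_le_sum fun i _ => ?_)
  rw [norm_smul]; simp

lemma fderiv_en {F : Type*} [NormedAddCommGroup F] [NormedSpace ℝ F] (g : En n → F) (x v : En n) :
    fderiv ℝ g x v = ∑ i, v i • dLine (ev i) g x := by
  conv_lhs => rw [en_sum v]
  rw [map_sum]
  simp [dLine]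

lemma fderiv_en_le {B : ℝ} {g : En n → ℝ} {x : En n} (h : ∀ i, |dLine (ev i) g x| ≤ B) (v : En n) :
    ‖fderiv ℝ g x v‖ ≤ n * B * ‖v‖ := by
  rw [fderiv_en]
  calc _ ≤ ∑ i : Fin n, ‖v‖ * B := by
        refine (norm_sum_le _ _).trans (Finset.sum_le_sum fun i _ => ?_)
        rw [norm_smul]
        exact mul_le_mul (en_coord_le v i) (h i) (norm_nonneg _) (norm_nonneg _)
    _ = _ := by simp; ring

lemma mv_bound {B : ℝ} (hB : 0 ≤ B) {g : En n → ℝ} (hg : Differentiable ℝ g)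
    (h : ∀ i x, |dLine (ev i) g x| ≤ B) (a b : En n) : |g a - g b| ≤ n * B * ‖a - b‖ :=
  Convex.norm_image_sub_le_of_norm_fderiv_le (𝕜 := ℝ) (s := Set.univ) (f := g)
    (fun x _ => hg x)
    (fun x _ => ContinuousLinearMap.opNorm_le_bound _ (by positivity)
      (fderiv_en_le fun i => h i x)) convex_univ (Set.mem_univ _) (Set.mem_univ _)

/-- hypotheses on the phase -/
def Good (B C₀ : ℝ) (φ : En n × En n → ℝ) : Prop :=
  ContDiff ℝ ∞ φ ∧
  (∀ z, C₀ ≤ |Matrix.det (Matrix.of fun i j => mixedHessXY φ i j z)|) ∧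
  ∀ i j l : Fin n, ∀ m ≤ 2 * n + 1, ∀ z,
    |(dLine (dX l))^[m] (mixedHessXY φ i j) z| ≤ B ∧
    |(dLine (dY l))^[m] (mixedHessXY φ i j) z| ≤ B

lemma mixed_swap {φ : En n × En n → ℝ} (hφ : ContDiff ℝ ∞ φ) (i j : Fin n) :
    mixedHessXY (fun z => φ z.swap) i j = fun z => mixedHessXY φ j i z.swap := by
  have h1 : dLine (dY j) (fun z : En n × En n => φ z.swap) = fun z => dLine (dX j) φ z.swap := by
    funext z; exact dLine_swap 0 (ev j) 1 hφ z
  have h2 : dLine (dX i) (fun z : En n × En n => dLine (dX j) φ z.swap)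
      = fun z => dLine (dY i) (dLine (dX j) φ) z.swap := by
    funext z; exact dLine_swap (ev i) 0 1 (dLine_contDiff _ hφ) z
  unfold mixedHessXY
  rw [h1, h2, dLine_comm _ _ hφ]

lemma mixed_contDiff {φ : En n × En n → ℝ} (hφ : ContDiff ℝ ∞ φ) (i j : Fin n) :
    ContDiff ℝ ∞ (mixedHessXY φ i j) := dLine_contDiff _ (dLine_contDiff _ hφ)

lemma Good.swap {B C₀ : ℝ} {φ : En n × En n → ℝ} (h : Good B C₀ φ) :
    Good B C₀ (fun z => φ z.swap) := by
  obtain ⟨h0, h1, h2⟩ := h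
  refine ⟨h0.comp (contDiff_snd.prodMk contDiff_fst), fun z => ?_, fun i j l m hm z => ?_⟩
  · rw [← Matrix.det_transpose]
    have : (Matrix.of fun i j => mixedHessXY (fun z : En n × En n => φ z.swap) i j z).transpose
        = Matrix.of fun i j => mixedHessXY φ i j z.swap := by
      ext i j
      simp [mixed_swap h0]
    rw [this]
    exact h1 _
  · rw [mixed_swap h0]
    have e1 := dLine_swap (ev l) 0 m (mixed_contDiff h0 j i) z
    have e2 := dLine_swap 0 (ev l) m (mixed_contDiff h0 j i) z
    constructor
    · refine (congrArg abs e1).trans_le ?_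
      exact (h2 j i l m hm z.swap).2
    · refine (congrArg abs e2).trans_le ?_
      exact (h2 j i l m hm z.swap).1

lemma Good.nonneg {B C₀ : ℝ} {φ : En n × En n → ℝ} (h : Good B C₀ φ) (i : Fin n) : 0 ≤ B :=
  (abs_nonneg _).trans ((h.2.2 i i i 0 (by simp) 0).1)

/-- inverse bound for matrices with bounded entries and determinant bounded below -/
lemma mat_inv_bound {B C₀ : ℝ} (hC : 0 < C₀) (A : Matrix (Fin n) (Fin n) ℝ)
    (hA : ∀ i j, |A i j| ≤ B) (hd : C₀ ≤ |A.det|) (v w : En n)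
    (hw : ∀ j, w j = ∑ i, v i * A i j) :
    ‖v‖ ≤ ((n * (n * (n.factorial * (max B 1) ^ n)) + 1) / C₀) * ‖w‖ := by
  set D : ℝ := n.factorial * (max B 1) ^ n with hD
  have hB1 : 0 ≤ max B 1 := zero_le_one.trans (le_max_right _ _)
  have hD0 : 0 ≤ D := by positivity
  have hadj : ∀ i j, |A.adjugate i j| ≤ D := by
    intro i j
    rw [Matrix.adjugate_apply]
    have := Matrix.det_le (A := A.updateRow j (Pi.single i 1)) (abv := AbsoluteValue.abs)
      (x := max B 1) (fun k l => ?_)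
    · simpa [hD] using this
    · rw [Matrix.updateRow_apply]
      split_ifs
      · by_cases hl : l = i
        · subst hl; simp
        · simp [hl]
      · exact (hA k l).trans (le_max_left _ _)
  have hvw : Matrix.vecMul (fun j => w j) A.adjugate = A.det • (fun i => v i) := by
    have : (fun j => w j) = Matrix.vecMul (fun i => v i) A := by
      funext j; rw [hw]; rfl
    rw [this, Matrix.vecMul_vecMul, Matrix.mul_adjugate, Matrix.vecMul_smul, Matrix.vecMul_one]
  have hc : ∀ i, |v i| ≤ n * D / C₀ * ‖w‖ := by
    intro i
    have h1 : A.det * v i = ∑ j, w j * A.adjugate j i := by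
      have := congrFun hvw i
      simp only [Pi.smul_apply, smul_eq_mul] at this
      rw [← this]; rfl
    have h2 : C₀ * |v i| ≤ n * D * ‖w‖ := by
      calc C₀ * |v i| ≤ |A.det| * |v i| := by gcongr
        _ = |∑ j, w j * A.adjugate j i| := by rw [← abs_mul, h1]
        _ ≤ ∑ j : Fin n, ‖w‖ * D := by
            refine (Finset.abs_sum_le_sum_abs _ _).trans (Finset.sum_le_sum fun j _ => ?_)
            rw [abs_mul]
            exact mul_le_mul (en_coord_le w j) (hadj j i) (abs_nonneg _) (norm_nonneg _)
        _ = _ := by simp; ring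
    rw [div_mul_eq_mul_div, le_div_iff₀ hC]
    linarith
  calc ‖v‖ ≤ ∑ i, |v i| := en_norm_le v
    _ ≤ ∑ i : Fin n, n * D / C₀ * ‖w‖ := Finset.sum_le_sum fun i _ => hc i
    _ = (n * (n * D)) / C₀ * ‖w‖ := by simp; ring
    _ ≤ _ := by gcongr; linarith

lemma phase_lower (n : ℕ) (B C₀ : ℝ) (hC : 0 < C₀) : ∃ c : ℝ, 0 < c ∧
    ∀ φ : En n × En n → ℝ, Good B C₀ φ → ∀ y y' ξ : En n,
      c * ‖y - y'‖ ≤ ∑ j, |dLine (dY j) φ (y, ξ) - dLine (dY j) φ (y', ξ)| := by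
  set M : ℝ := (n * (n * (n.factorial * (max B 1) ^ n)) + 1) / C₀ with hM
  have hB1 : 0 ≤ max B 1 := zero_le_one.trans (le_max_right _ _)
  have hM0 : 0 < M := by positivity
  refine ⟨1 / (2 * M), by positivity, fun φ hG y y' ξ => ?_⟩
  have hφ := hG.1
  rcases isEmpty_or_nonempty (Fin n) with hn | ⟨⟨i0⟩⟩
  · have : y = y' := by ext i; exact (hn.false i).elim
    simp [this]
  have hB : 0 ≤ B := hG.nonneg i0
  let Fj : Fin n → En n → ℝ := fun j y => dLine (dY j) φ (y, ξ)
  have hFj : ∀ j, ContDiff ℝ ∞ (Fj j) := fun j =>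
    (dLine_contDiff (dY j) hφ).comp (contDiff_id.prodMk contDiff_const)
  let F : En n → En n := fun y => WithLp.toLp 2 (fun j => Fj j y)
  have hF : Differentiable ℝ F := by
    rw [differentiable_euclidean]
    exact fun j => (hFj j).differentiable (by simp)
  have hFd : ∀ x v j, fderiv ℝ F x v j = fderiv ℝ (Fj j) x v := by
    intro x v j
    have h1 : HasFDerivAt F (fderiv ℝ F x) x := (hF x).hasFDerivAt
    rw [← hasFDerivWithinAt_univ, hasFDerivWithinAt_euclidean] at h1
    rw [((h1 j).hasFDerivAt Filter.univ_mem).fderiv]; rfl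
  have hent : ∀ x i j, dLine (ev i) (Fj j) x = mixedHessXY φ i j (x, ξ) := fun x i j =>
    dLine_fst (ev i) 1 (dLine_contDiff (dY j) hφ) x ξ
  have hFs : ∀ x v j, fderiv ℝ F x v j = ∑ i, v i * mixedHessXY φ i j (x, ξ) := by
    intro x v j
    rw [hFd, fderiv_en]
    simp only [hent, smul_eq_mul]
  have hinv : ∀ x v, ‖v‖ ≤ M * ‖fderiv ℝ F x v‖ := by
    intro x v
    refine mat_inv_bound hC (Matrix.of fun i j => mixedHessXY φ i j (x, ξ)) (fun i j => ?_)
      (hG.2.1 (x, ξ)) v _ (fun j => ?_)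
    · exact (hG.2.2 i j i 0 (by simp) (x, ξ)).1
    · rw [hFs]; rfl
  have hlip : ∀ x x', ‖fderiv ℝ F x - fderiv ℝ F x'‖ ≤ (n * (n * (n * B))) * ‖x - x'‖ := by
    intro x x'
    refine ContinuousLinearMap.opNorm_le_bound _ (by positivity) fun v => ?_
    have hd : ∀ i j, |mixedHessXY φ i j (x, ξ) - mixedHessXY φ i j (x', ξ)| ≤ n * B * ‖x - x'‖ := by
      intro i j
      refine mv_bound (g := fun x => mixedHessXY φ i j (x, ξ)) hB ?_ ?_ x x'
      · exact ((mixed_contDiff hφ i j).comp (contDiff_id.prodMk contDiff_const)).differentiable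
          (by simp)
      · intro l z
        have e := dLine_fst (ev l) 1 (mixed_contDiff hφ i j) z ξ
        refine (congrArg abs e).trans_le ?_
        exact (hG.2.2 i j l 1 (by omega) (z, ξ)).1
    calc _ ≤ ∑ j, |(fderiv ℝ F x - fderiv ℝ F x') v j| := en_norm_le _
      _ ≤ ∑ j : Fin n, ∑ i : Fin n, ‖v‖ * (n * B * ‖x - x'‖) := by
          refine Finset.sum_le_sum fun j _ => ?_
          have : (fderiv ℝ F x - fderiv ℝ F x') v j
              = ∑ i, v i * (mixedHessXY φ i j (x, ξ) - mixedHessXY φ i j (x', ξ)) := by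
            simp only [mul_sub, Finset.sum_sub_distrib, ← hFs]
            rfl
          rw [this]
          refine (Finset.abs_sum_le_sum_abs _ _).trans (Finset.sum_le_sum fun i _ => ?_)
          rw [abs_mul]
          exact mul_le_mul (en_coord_le v i) (hd i j) (abs_nonneg _) (norm_nonneg _)
      _ = _ := by simp; ring
  have := hadamard F hF M _ hM0 (by positivity) hinv hlip y y'
  have h3 := en_norm_le (F y - F y')
  have h4 : ∑ j, |(F y - F y') j| = ∑ j, |dLine (dY j) φ (y, ξ) - dLine (dY j) φ (y', ξ)| := rfl
  rw [← h4, one_div_mul_eq_div, div_le_iff₀ (by positivity)]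
  nlinarith
end phase


open scoped ContDiff

section osc

lemma norm_exp_I_real (t : ℝ) : ‖Complex.exp (Complex.I * (t : ℂ))‖ = 1 := by
  rw [mul_comm]; exact Complex.norm_exp_ofReal_mul_I t

lemma osc (n : ℕ) (B C₀ : ℝ) (hC : 0 < C₀) (hB : 0 ≤ B) : ∃ δ : ℝ, 0 < δ ∧ ∀ Mg : ℝ, ∃ C : ℝ, 0 ≤ C ∧
    ∀ φ : En n × En n → ℝ, Good B C₀ φ → ∀ (y y' ξ0 : En n) (g : En n → ℂ), ContDiff ℝ ∞ g →
      tsupport g ⊆ Metric.closedBall ξ0 δ →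
      (∀ j, ∀ m ≤ 2 * n + 1, ∀ x, ‖(dLine (ev j))^[m] g x‖ ≤ Mg) → (∀ x, ‖g x‖ ≤ Mg) →
      ‖∫ ξ, Complex.exp (Complex.I * ((φ (y, ξ) - φ (y', ξ) : ℝ) : ℂ)) * g ξ‖
        ≤ C * (1 + ‖y - y'‖ ^ (2 * n + 1))⁻¹ := by
  obtain ⟨c, hc, hlow⟩ := phase_lower n B C₀ hC
  set c1 := c / (n + 1) with hc1
  have hc10 : 0 < c1 := by positivity
  set ρ := c1 / (2 * (n * (n * B) + 1)) with hρ
  have hρ0 : 0 < ρ := by positivity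
  refine ⟨ρ / 2, by positivity, fun Mg => ?_⟩
  obtain ⟨C, hC0, hnsp⟩ := nsp (E := En n) (μ := volume) (2 * n + 1) (c1 / 2) (by positivity) (n * B) Mg
  set V := (volume : Measure (En n)).real (Metric.closedBall 0 (ρ / 2)) with hV
  refine ⟨2 * (C * V) + 2 * (|Mg| * V), by positivity, fun φ hG y y' ξ0 g hg hgs hgd hg0 => ?_⟩
  have hVx : (volume : Measure (En n)).real (Metric.closedBall ξ0 (ρ / 2)) = V := by
    rw [hV, measureReal_def, measureReal_def, Measure.addHaar_closedBall_center]
  have hφ := hG.1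
  rcases lt_or_ge ‖y - y'‖ 1 with hlt | hge
  · have h1 : ∫ ξ, Complex.exp (Complex.I * ((φ (y, ξ) - φ (y', ξ) : ℝ) : ℂ)) * g ξ
        = ∫ ξ in Metric.closedBall ξ0 (ρ / 2),
          Complex.exp (Complex.I * ((φ (y, ξ) - φ (y', ξ) : ℝ) : ℂ)) * g ξ := by
      rw [setIntegral_eq_integral_of_forall_compl_eq_zero]
      intro x hx
      rw [image_eq_zero_of_notMem_tsupport (fun h => hx (hgs h)), mul_zero]
    have h2 : ‖∫ ξ, Complex.exp (Complex.I * ((φ (y, ξ) - φ (y', ξ) : ℝ) : ℂ)) * g ξ‖ ≤ |Mg| * V := by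
      rw [h1, ← hVx]
      refine norm_setIntegral_le_of_norm_le_const (isCompact_closedBall _ _).measure_lt_top
        (fun x hx => ?_)
      rw [norm_mul, norm_exp_I_real, one_mul]
      exact (hg0 x).trans (le_abs_self _)
    refine h2.trans ?_
    have h3 : ‖y - y'‖ ^ (2 * n + 1) ≤ 1 := pow_le_one₀ (norm_nonneg _) hlt.le
    have hp : 0 ≤ ‖y - y'‖ ^ (2 * n + 1) := by positivity
    rw [← div_eq_mul_inv, le_div_iff₀ (by positivity)]
    have a1 : 0 ≤ |Mg| * V := by positivity
    have a2 : 0 ≤ C * V := by positivity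
    nlinarith
  · set l := ‖y - y'‖ with hl
    have hl0 : 0 < l := by linarith
    set Ψ : En n → ℝ := fun ξ => l⁻¹ • (φ (y, ξ) - φ (y', ξ)) with hΨ
    have hcy : ∀ y, ContDiff ℝ ∞ (fun ξ => φ (y, ξ)) := fun y =>
      hφ.comp (contDiff_const.prodMk contDiff_id)
    have hΨc : ContDiff ℝ ∞ Ψ := contDiff_const.mul ((hcy y).sub (hcy y'))
    -- derivative formulas
    have hder : ∀ j m ξ, (dLine (ev j))^[m] (dLine (ev j) Ψ) ξ
        = l⁻¹ * ((dLine (dY j))^[m] (dLine (dY j) φ) (y, ξ)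
          - (dLine (dY j))^[m] (dLine (dY j) φ) (y', ξ)) := by
      intro j m ξ
      rw [← Function.iterate_succ_apply, dLine_const_smul _ _ _ ((hcy y).sub (hcy y')),
        dLine_iter_sub _ _ (hcy y) (hcy y'), dLine_snd _ _ hφ, dLine_snd _ _ hφ]
      rfl
    have hder2 : ∀ i j ξ, dLine (ev i) (dLine (ev j) Ψ) ξ
        = l⁻¹ * (dLine (dY i) (dLine (dY j) φ) (y, ξ)
          - dLine (dY i) (dLine (dY j) φ) (y', ξ)) := by
      intro i j ξ
      have e1 : dLine (ev j) Ψ = fun ξ => l⁻¹ • (dLine (dY j) φ (y, ξ) - dLine (dY j) φ (y', ξ)) := by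
        funext ξ; exact hder j 0 ξ
      have hc' : ∀ y, ContDiff ℝ ∞ (fun ξ => dLine (dY j) φ (y, ξ)) := fun y =>
        (dLine_contDiff _ hφ).comp (contDiff_const.prodMk contDiff_id)
      rw [e1]
      have e2 := dLine_const_smul (ev i) 1 l⁻¹ ((hc' y).sub (hc' y')) ξ
      have e3 := dLine_iter_sub (ev i) 1 (hc' y) (hc' y') ξ
      have e4 := fun y => dLine_snd (ev i) 1 (dLine_contDiff (dY j) hφ) y ξ
      simp only [Function.iterate_one] at e2 e3 e4
      rw [e2, e3, e4, e4]
      rfl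
    have hmv : ∀ G : En n × En n → ℝ, ContDiff ℝ ∞ G → (∀ i z, |dLine (dX i) G z| ≤ B) → ∀ ξ,
        |l⁻¹ * (G (y, ξ) - G (y', ξ))| ≤ n * B := by
      intro G hG1 hG2 ξ
      have := mv_bound (g := fun y => G (y, ξ)) hB ((hG1.comp
        (contDiff_id.prodMk contDiff_const)).differentiable (by simp)) (fun i x => ?_) y y'
      · rw [abs_mul, abs_of_pos (inv_pos.2 hl0), inv_mul_le_iff₀ hl0]
        refine this.trans_eq ?_
        ring
      · have e := dLine_fst (ev i) 1 hG1 x ξ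
        exact (congrArg abs e).trans_le (hG2 i _)
    have hup : ∀ j, ∀ m ≤ 2 * n + 1, ∀ ξ, |(dLine (ev j))^[m] (dLine (ev j) Ψ) ξ| ≤ n * B := by
      intro j m hm ξ
      rw [hder]
      refine hmv _ (dLine_iter_contDiff _ _ (dLine_contDiff _ hφ)) (fun i z => ?_) ξ
      rw [dLine_iter_comm _ _ _ (dLine_contDiff _ hφ)]
      exact (hG.2.2 i j j m hm z).2
    have hup2 : ∀ i j ξ, |dLine (ev i) (dLine (ev j) Ψ) ξ| ≤ n * B := by
      intro i j ξ
      rw [hder2]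
      refine hmv _ (dLine_contDiff _ (dLine_contDiff _ hφ)) (fun k z => ?_) ξ
      rw [dLine_comm _ _ (dLine_contDiff _ hφ)]
      exact (hG.2.2 k j i 1 (by omega) z).2
    -- choose the coordinate
    obtain ⟨j, hj⟩ : ∃ j, c1 ≤ |dLine (ev j) Ψ ξ0| := by
      by_contra! hcon
      have h1 := hlow φ hG y y' ξ0
      have h2 : ∀ j, |dLine (dY j) φ (y, ξ0) - dLine (dY j) φ (y', ξ0)| ≤ l * c1 := by
        intro j
        have h3 := hder j 0 ξ0
        simp only [Function.iterate_zero, id] at h3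
        have h4 := (hcon j).le
        rw [h3, abs_mul, abs_of_pos (inv_pos.2 hl0), inv_mul_le_iff₀ hl0] at h4
        exact h4
      have h5 : c * l ≤ n * (l * c1) := by
        refine h1.trans ((Finset.sum_le_sum fun j _ => h2 j).trans_eq ?_)
        simp
      have h6 : c1 * (n + 1) = c := by rw [hc1]; field_simp
      nlinarith [mul_pos hl0 hc10]
    have hU : ∀ x ∈ Metric.ball ξ0 ρ, c1 / 2 ≤ |dLine (ev j) Ψ x| := by
      intro x hx
      have h1 := mv_bound (by positivity) ((dLine_contDiff (ev j) hΨc).differentiable (by simp))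
        (fun i x => hup2 i j x) x ξ0
      rw [Metric.mem_ball, dist_eq_norm] at hx
      have h2 : (n : ℝ) * (n * B) * ‖x - ξ0‖ ≤ c1 / 2 := by
        calc (n : ℝ) * (n * B) * ‖x - ξ0‖ ≤ (n * (n * B) + 1) * ρ := by
              gcongr; linarith
          _ = c1 / 2 := by rw [hρ]; field_simp
      have h3 := abs_sub_abs_le_abs_sub (dLine (ev j) Ψ ξ0) (dLine (ev j) Ψ x)
      rw [abs_sub_comm] at h3
      linarith
    have := hnsp (ev j) Ψ g (Metric.ball ξ0 ρ) (Metric.closedBall ξ0 (ρ / 2)) hΨc Metric.isOpen_ball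
      (isCompact_closedBall _ _) (Metric.closedBall_subset_ball (by linarith)) hg hgs hU
      (fun m hm x _ => hup j m hm x) (fun m hm x _ => hgd j m hm x) l hl0
    have heq : ∀ x, Complex.exp (Complex.I * l * (Ψ x : ℂ)) * g x
        = Complex.exp (Complex.I * ((φ (y, x) - φ (y', x) : ℝ) : ℂ)) * g x := by
      intro x
      congr 2
      rw [mul_assoc, ← Complex.ofReal_mul]
      congr 2
      simp only [hΨ, smul_eq_mul]
      field_simp
    simp only [heq] at this
    refine this.trans ?_
    rw [hVx]
    have h3 : 1 ≤ l ^ (2 * n + 1) := one_le_pow₀ hge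
    have h4 : (l ^ (2 * n + 1))⁻¹ ≤ 2 * (1 + l ^ (2 * n + 1))⁻¹ := by
      rw [← div_eq_mul_inv, inv_le_comm₀ (by positivity) (by positivity), inv_div]
      linarith
    calc C * (l ^ (2 * n + 1))⁻¹ * V ≤ C * (2 * (1 + l ^ (2 * n + 1))⁻¹) * V := by gcongr
      _ = 2 * (C * V) * (1 + l ^ (2 * n + 1))⁻¹ := by ring
      _ ≤ _ := by
        gcongr
        have : 0 ≤ |Mg| * V := by positivity
        linarith
end osc


open scoped ContDiff

set_option linter.unusedSectionVars false

section ker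
variable {α : Type*} [MeasurableSpace α] {μ : Measure α} [SigmaFinite μ]

/-- bounded measurable kernels supported in a product of sets of finite measure -/
structure Ker (μ : Measure α) (K : α → α → ℂ) (S S' : Set α) (V M : ℝ) : Prop where
  meas : StronglyMeasurable (Function.uncurry K)
  hS : MeasurableSet S
  hS' : MeasurableSet S'
  vS : μ S ≤ ENNReal.ofReal V
  vS' : μ S' ≤ ENNReal.ofReal V
  hV : 0 ≤ V
  hM : 0 ≤ M
  zero : ∀ x y, ¬ (x ∈ S ∧ y ∈ S') → K x y = 0
  bd : ∀ x y, ‖K x y‖ ≤ M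

variable {K : α → α → ℂ} {S S' : Set α} {V M : ℝ}

lemma Ker.cj (h : Ker μ K S S' V M) : Ker μ (fun y x => (starRingEnd ℂ) (K x y)) S' S V M where
  meas := by
    have : StronglyMeasurable (fun p : α × α => Function.uncurry K p.swap) :=
      h.meas.comp_measurable measurable_swap
    exact Complex.continuous_conj.comp_stronglyMeasurable this
  hS := h.hS'
  hS' := h.hS
  vS := h.vS'
  vS' := h.vS
  hV := h.hV
  hM := h.hM
  zero x y hxy := by rw [h.zero y x (fun h' => hxy h'.symm), map_zero]
  bd x y := by rw [RCLike.norm_conj]; exact h.bd y x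

lemma l2_intOn {f : α → ℂ} (hf : MemLp f 2 μ) {S : Set α} {V : ℝ} 
    (hV : μ S ≤ ENNReal.ofReal V) : IntegrableOn f S μ := by
  have : IsFiniteMeasure (μ.restrict S) := ⟨by
    rw [Measure.restrict_apply_univ]; exact hV.trans_lt ENNReal.ofReal_lt_top⟩
  exact (hf.restrict S).integrable one_le_two

lemma l2_int_le {f : α → ℂ} (hf : MemLp f 2 μ) {S : Set α} {V : ℝ} (hV0 : 0 ≤ V)
    (hV : μ S ≤ ENNReal.ofReal V) : ∫ x in S, ‖f x‖ ∂μ ≤ √V * (eLpNorm f 2 μ).toReal := by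
  have h1 := eLpNorm_le_eLpNorm_mul_rpow_measure_univ (μ := μ.restrict S) (f := f)
    (p := 1) (q := 2) one_le_two (hf.1.restrict)
  rw [integral_norm_eq_lintegral_enorm hf.1.restrict, ← eLpNorm_one_eq_lintegral_enorm]
  have h2 : eLpNorm f 1 (μ.restrict S) ≤ ENNReal.ofReal (√V) * eLpNorm f 2 μ := by
    refine h1.trans ?_
    rw [mul_comm, Measure.restrict_apply_univ]
    refine mul_le_mul' ?_ (eLpNorm_mono_measure _ Measure.restrict_le_self)
    rw [Real.sqrt_eq_rpow, ← ENNReal.ofReal_rpow_of_nonneg hV0 (by norm_num)]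
    have : (1 / (1 : ℝ≥0∞).toReal - 1 / (2 : ℝ≥0∞).toReal) = 1 / 2 := by norm_num
    rw [this]
    exact ENNReal.rpow_le_rpow hV (by norm_num)
  have h3 := ENNReal.toReal_mono (ENNReal.mul_ne_top ENNReal.ofReal_ne_top hf.2.ne) h2
  rwa [ENNReal.toReal_mul, ENNReal.toReal_ofReal (Real.sqrt_nonneg _)] at h3

lemma Ker.integrable (h : Ker μ K S S' V M) {f : α → ℂ} (hf : MemLp f 2 μ) (x : α) :
    Integrable (fun y => K x y * f y) μ := by
  have h1 : Integrable (fun y => S'.indicator f y) μ :=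
    (integrable_indicator_iff h.hS').2 (l2_intOn hf h.vS')
  refine (h1.norm.const_mul M).mono' ((h.meas.comp_measurable
    measurable_prodMk_left).aestronglyMeasurable.mul hf.1) (Filter.Eventually.of_forall fun y => ?_)
  rw [norm_mul]
  by_cases hy : y ∈ S'
  · rw [Set.indicator_of_mem hy]
    exact mul_le_mul_of_nonneg_right (h.bd x y) (norm_nonneg _)
  · rw [h.zero x y (fun h' => hy h'.2)]
    simp [hy]

lemma Ker.pt_le (h : Ker μ K S S' V M) {f : α → ℂ} (hf : MemLp f 2 μ) (x : α) :
    ‖∫ y, K x y * f y ∂μ‖ ≤ S.indicator (fun _ => M * (√V * (eLpNorm f 2 μ).toReal)) x := by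
  by_cases hx : x ∈ S
  · rw [Set.indicator_of_mem hx]
    calc ‖∫ y, K x y * f y ∂μ‖ ≤ ∫ y, M * S'.indicator (fun y => ‖f y‖) y ∂μ := by
          refine norm_integral_le_of_norm_le
            (((integrable_indicator_iff h.hS').2 (l2_intOn hf h.vS').norm).const_mul M)
            (Filter.Eventually.of_forall fun y => ?_)
          rw [norm_mul]
          by_cases hy : y ∈ S'
          · rw [Set.indicator_of_mem hy]
            exact mul_le_mul_of_nonneg_right (h.bd x y) (norm_nonneg _)
          · rw [h.zero x y (fun h' => hy h'.2)]
            simp [hy]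
      _ = M * ∫ y in S', ‖f y‖ ∂μ := by rw [integral_const_mul, integral_indicator h.hS']
      _ ≤ _ := mul_le_mul_of_nonneg_left (l2_int_le hf h.hV h.vS') h.hM
  · rw [Set.indicator_of_notMem hx]
    have : ∀ y, K x y * f y = 0 := fun y => by rw [h.zero x y (fun h' => hx h'.1), zero_mul]
    simp [this]

lemma Ker.eLp_le (h : Ker μ K S S' V M) {f : α → ℂ} (hf : MemLp f 2 μ) :
    eLpNorm (fun x => ∫ y, K x y * f y ∂μ) 2 μ ≤ ENNReal.ofReal (M * V * (eLpNorm f 2 μ).toReal) := by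
  have h0 : 0 ≤ M * (√V * (eLpNorm f 2 μ).toReal) :=
    mul_nonneg h.hM (mul_nonneg (Real.sqrt_nonneg _) ENNReal.toReal_nonneg)
  refine (eLpNorm_mono_real (h.pt_le hf)).trans ((eLpNorm_indicator_const_le _ _).trans ?_)
  rw [Real.enorm_eq_ofReal h0]
  have h1 : μ S ^ (1 / (2 : ℝ≥0∞).toReal) ≤ ENNReal.ofReal (√V) := by
    rw [Real.sqrt_eq_rpow, ← ENNReal.ofReal_rpow_of_nonneg h.hV (by norm_num)]
    norm_num
    exact ENNReal.rpow_le_rpow h.vS (by norm_num)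
  refine (mul_le_mul' le_rfl h1).trans_eq ?_
  rw [← ENNReal.ofReal_mul h0]
  congr 1
  have := Real.mul_self_sqrt h.hV
  linear_combination M * (eLpNorm f 2 μ).toReal * this

lemma Ker.memLp (h : Ker μ K S S' V M) {f : α → ℂ} (hf : MemLp f 2 μ) :
    MemLp (fun x => ∫ y, K x y * f y ∂μ) 2 μ := by
  refine ⟨?_, (h.eLp_le hf).trans_lt ENNReal.ofReal_lt_top⟩
  have : AEStronglyMeasurable (fun p : α × α => Function.uncurry K p * f p.2) (μ.prod μ) :=
    h.meas.aestronglyMeasurable.mul hf.1.comp_snd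
  exact this.integral_prod_right'

/-- the operator with kernel `K` -/
def Ker.op (h : Ker μ K S S' V M) : Lp ℂ 2 μ →L[ℂ] Lp ℂ 2 μ :=
  LinearMap.mkContinuous
    { toFun := fun f => (h.memLp (Lp.memLp f)).toLp _
      map_add' := fun f g => by
        rw [← MemLp.toLp_add, MemLp.toLp_eq_toLp_iff]
        refine Filter.Eventually.of_forall fun x => ?_
        rw [Pi.add_apply, ← integral_add (h.integrable (Lp.memLp f) x) (h.integrable (Lp.memLp g) x)]
        refine integral_congr_ae ?_
        filter_upwards [Lp.coeFn_add f g] with y hy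
        rw [hy, Pi.add_apply, mul_add]
      map_smul' := fun c f => by
        rw [RingHom.id_apply, ← MemLp.toLp_const_smul, MemLp.toLp_eq_toLp_iff]
        refine Filter.Eventually.of_forall fun x => ?_
        rw [Pi.smul_apply, smul_eq_mul, ← integral_const_mul]
        refine integral_congr_ae ?_
        filter_upwards [Lp.coeFn_smul c f] with y hy
        rw [hy, Pi.smul_apply, smul_eq_mul]
        ring }
    (M * V) (fun f => by
      rw [LinearMap.coe_mk, AddHom.coe_mk, Lp.norm_toLp, Lp.norm_def]
      refine ENNReal.toReal_le_of_le_ofReal ?_ (h.eLp_le (Lp.memLp f))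
      exact mul_nonneg (mul_nonneg h.hM h.hV) ENNReal.toReal_nonneg)

lemma Ker.op_norm (h : Ker μ K S S' V M) : ‖h.op‖ ≤ M * V :=
  LinearMap.mkContinuous_norm_le _ (mul_nonneg h.hM h.hV) _

lemma Ker.op_coe (h : Ker μ K S S' V M) (f : Lp ℂ 2 μ) :
    h.op f =ᵐ[μ] fun x => ∫ y, K x y * f y ∂μ := (h.memLp (Lp.memLp f)).coeFn_toLp

lemma Ker.fubini_int (h : Ker μ K S S' V M) {f g : α → ℂ} (hf : MemLp f 2 μ) (hg : MemLp g 2 μ) :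
    Integrable (fun p : α × α => g p.1 * (K p.1 p.2 * f p.2)) (μ.prod μ) := by
  have h1 : Integrable (fun y => S'.indicator f y) μ :=
    (integrable_indicator_iff h.hS').2 (l2_intOn hf h.vS')
  have h2 : Integrable (fun y => S.indicator g y) μ :=
    (integrable_indicator_iff h.hS).2 (l2_intOn hg h.vS)
  refine ((h2.mul_prod h1).norm.const_mul M).mono' (hg.1.comp_fst.mul
    (h.meas.aestronglyMeasurable.mul hf.1.comp_snd)) (Filter.Eventually.of_forall fun p => ?_)
  by_cases hp : p.1 ∈ S ∧ p.2 ∈ S'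
  · rw [Set.indicator_of_mem hp.1, Set.indicator_of_mem hp.2]
    simp only [norm_mul]
    have := h.bd p.1 p.2
    calc _ = ‖K p.1 p.2‖ * (‖g p.1‖ * ‖f p.2‖) := by ring
      _ ≤ _ := by gcongr
  · rw [h.zero _ _ hp]
    simp only [zero_mul, mul_zero, norm_zero]
    exact mul_nonneg h.hM (norm_nonneg _)

lemma Ker.op_star (h : Ker μ K S S' V M) : star h.op = h.cj.op := by
  symm
  rw [ContinuousLinearMap.star_eq_adjoint, ContinuousLinearMap.eq_adjoint_iff]
  intro f g
  rw [L2.inner_def, L2.inner_def]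
  have e1 : ∫ a, inner ℂ (h.cj.op f a) (g a) ∂μ
      = ∫ y, ∫ x, (starRingEnd ℂ (f x) * (K x y * g y)) ∂μ ∂μ := by
    refine integral_congr_ae ?_
    filter_upwards [h.cj.op_coe f] with y hy
    rw [hy, RCLike.inner_apply, ← integral_conj, ← integral_const_mul]
    refine integral_congr_ae (Filter.Eventually.of_forall fun x => ?_)
    simp only [map_mul, Complex.conj_conj]
    ring
  have e2 : ∫ a, inner ℂ (f a) (h.op g a) ∂μ
      = ∫ x, ∫ y, (starRingEnd ℂ (f x) * (K x y * g y)) ∂μ ∂μ := by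
    refine integral_congr_ae ?_
    filter_upwards [h.op_coe g] with x hx
    rw [hx, RCLike.inner_apply, ← integral_mul_const]
    refine integral_congr_ae (Filter.Eventually.of_forall fun y => ?_)
    simp only []
    ring
  rw [e1, e2]
  exact (integral_integral_swap (h.fubini_int (Lp.memLp g) (Lp.memLp f).star)).symm

lemma Ker.op_mul {K' K'' : α → α → ℂ} {S'' : Set α} {M' M'' : ℝ} {S₁ : Set α}
    (h : Ker μ K S S' V M) (h' : Ker μ K' S₁ S'' V M')
    (h'' : Ker μ K'' S S'' V M'') (hK : ∀ x z, K'' x z = ∫ y, K x y * K' y z ∂μ) :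
    h.op * h'.op = h''.op := by
  ext1 f
  rw [mul_apply_eq_comp]
  ext1
  filter_upwards [h.op_coe (h'.op f), h''.op_coe f] with x hx hx''
  rw [hx, hx'']
  have hKx : MemLp (fun y => K x y) 2 μ := by
    refine (memLp_indicator_const 2 h.hS' M
      (Or.inr (h.vS'.trans_lt ENNReal.ofReal_lt_top).ne)).mono' (h.meas.comp_measurable
      measurable_prodMk_left).aestronglyMeasurable (Filter.Eventually.of_forall fun y => ?_)
    by_cases hy : y ∈ S'
    · rw [Set.indicator_of_mem hy]
      exact h.bd x y
    · simp [h.zero x y (fun h' => hy h'.2), hy]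
  have e1 : ∫ y, K x y * h'.op f y ∂μ = ∫ y, ∫ z, K x y * (K' y z * f z) ∂μ ∂μ := by
    refine integral_congr_ae ?_
    filter_upwards [h'.op_coe f] with y hy
    rw [hy, integral_const_mul]
  rw [e1, integral_integral_swap (h'.fubini_int (Lp.memLp f) hKx)]
  refine integral_congr_ae (Filter.Eventually.of_forall fun z => ?_)
  simp only []
  rw [hK, ← integral_mul_const]
  refine integral_congr_ae (Filter.Eventually.of_forall fun y => ?_)
  simp only []
  ring

lemma Ker.star_mul {K' : α → α → ℂ} {S₁ S'' : Set α} {M' M'' : ℝ}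
    (h : Ker μ K S S' V M) (h' : Ker μ K' S₁ S'' V M') (hM'' : 0 ≤ M'')
    (hb : ∀ y z, ‖∫ x, starRingEnd ℂ (K x y) * K' x z ∂μ‖ ≤ M'') :
    ‖star h.op * h'.op‖ ≤ M'' * V := by
  have h'' : Ker μ (fun y z => ∫ x, starRingEnd ℂ (K x y) * K' x z ∂μ) S' S'' V M'' :=
    { meas := by
        have m1 : StronglyMeasurable (fun p : (α × α) × α => starRingEnd ℂ (K p.2 p.1.1)) :=
          Complex.continuous_conj.comp_stronglyMeasurable (h.meas.comp_measurable
            (measurable_snd.prodMk (measurable_fst.comp measurable_fst)))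
        have m2 : StronglyMeasurable (fun p : (α × α) × α => K' p.2 p.1.2) :=
          (h'.meas.comp_measurable
            (measurable_snd.prodMk (measurable_snd.comp measurable_fst)))
        exact (m1.mul m2).integral_prod_right'
      hS := h.hS'
      hS' := h'.hS'
      vS := h.vS'
      vS' := h'.vS'
      hV := h.hV
      hM := hM''
      zero := fun y z hyz => by
        refine integral_eq_zero_of_ae (Filter.Eventually.of_forall fun x => ?_)
        by_cases hy : y ∈ S'
        · simp [h'.zero x z (fun hh => hyz ⟨hy, hh.2⟩)]
        · simp [h.zero x y (fun hh => hy hh.2)]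
      bd := hb }
  rw [h.op_star, h.cj.op_mul h' h'' (fun _ _ => rfl)]
  exact h''.op_norm
end ker


open scoped ContDiff

set_option linter.unusedSectionVars false

section cutoff

/-- one-dimensional bump -/
def bump1 (t : ℝ) : ℝ := Real.smoothTransition (t + 1) - Real.smoothTransition t

lemma bump1_contDiff : ContDiff ℝ ∞ bump1 :=
  (Real.smoothTransition.contDiff.comp (contDiff_id.add contDiff_const)).sub
    Real.smoothTransition.contDiff

lemma bump1_ne {t : ℝ} (h : bump1 t ≠ 0) : |t| ≤ 1 := by
  by_contra! hc
  apply h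
  rcases lt_abs.1 hc with h1 | h1
  · rw [bump1, Real.smoothTransition.one_of_one_le (by linarith),
      Real.smoothTransition.one_of_one_le (by linarith), sub_self]
  · rw [bump1, Real.smoothTransition.zero_of_nonpos (by linarith),
      Real.smoothTransition.zero_of_nonpos (by linarith), sub_self]

lemma bump1_abs (t : ℝ) : |bump1 t| ≤ 1 := by
  have a1 := Real.smoothTransition.nonneg t
  have a2 := Real.smoothTransition.le_one t
  have a3 := Real.smoothTransition.nonneg (t + 1)
  have a4 := Real.smoothTransition.le_one (t + 1)
  rw [bump1, abs_le]; constructor <;> linarith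

lemma bump1_sum (R : ℕ) (t : ℝ) : ∑ k ∈ Finset.Icc (-(R : ℤ)) R, bump1 (t - k)
    = Real.smoothTransition (t + R + 1) - Real.smoothTransition (t - R) := by
  induction R with
  | zero => simp [bump1]
  | succ R ih =>
    have : Finset.Icc (-((R + 1 : ℕ) : ℤ)) ((R + 1 : ℕ) : ℤ)
        = insert (-((R : ℤ) + 1)) (insert ((R : ℤ) + 1) (Finset.Icc (-(R : ℤ)) R)) := by
      ext k; simp only [Finset.mem_Icc, Finset.mem_insert]; push_cast; omega
    rw [this, Finset.sum_insert, Finset.sum_insert, ih]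
    · simp only [bump1]
      push_cast
      have e1 : t - (-1 + -(R : ℝ)) + 1 = t + (R + 1) + 1 := by ring
      have e2 : t - -((R : ℝ) + 1) = t + R + 1 := by ring
      have e3 : t - ((R : ℝ) + 1) + 1 = t - R := by ring
      have e4 : t + R + 1 + 1 = t + (R + 1) + 1 := by ring
      rw [e2, e3, e4]
      ring
    · simp
    · simp only [Finset.mem_Icc, Finset.mem_insert]; omega

variable {n : ℕ}

/-- the cutoff at scale `δ` -/
def chi (δ : ℝ) (x : En n) : ℂ := ∏ i, ((bump1 (x i / δ) : ℝ) : ℂ)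

/-- lattice points -/
def pt (δ : ℝ) (k : Fin n → ℤ) : En n := WithLp.toLp 2 (fun i => δ * k i)

lemma chi_contDiff (δ : ℝ) : ContDiff ℝ ∞ (chi (n := n) δ) := by
  refine contDiff_prod fun i _ => ?_
  have h : ContDiff ℝ ∞ (fun x : En n => x i) := (EuclideanSpace.proj (𝕜 := ℝ) i).contDiff
  exact Complex.ofRealCLM.contDiff.comp (bump1_contDiff.comp (h.div_const δ))

lemma chi_ne {δ : ℝ} (hδ : 0 < δ) {x : En n} (h : chi δ x ≠ 0) (i : Fin n) : |x i| ≤ δ := by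
  rw [chi, Finset.prod_ne_zero_iff] at h
  have h1 := bump1_ne (Complex.ofReal_ne_zero.1 (h i (Finset.mem_univ i)))
  rwa [abs_div, abs_of_pos hδ, div_le_one hδ] at h1

lemma chi_norm (δ : ℝ) (x : En n) : ‖chi δ x‖ ≤ 1 := by
  rw [chi, norm_prod]
  refine Finset.prod_le_one (fun _ _ => norm_nonneg _) fun i _ => ?_
  rw [Complex.norm_real]; exact bump1_abs _

lemma chi_tsupport {δ : ℝ} (hδ : 0 < δ) : tsupport (chi (n := n) δ) ⊆ Metric.closedBall 0 (n * δ) := by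
  refine closure_minimal (fun x hx => ?_) Metric.isClosed_closedBall
  rw [mem_closedBall_zero_iff]
  refine (en_norm_le x).trans ((Finset.sum_le_sum fun i _ => chi_ne hδ hx i).trans_eq ?_)
  simp

lemma chi_hcs {δ : ℝ} (hδ : 0 < δ) : HasCompactSupport (chi (n := n) δ) :=
  (isCompact_closedBall _ _).of_isClosed_subset (isClosed_tsupport _) (chi_tsupport hδ)

lemma hcs_dLine_iter {E : Type*} [NormedAddCommGroup E] [NormedSpace ℝ E] (v : E) (m : ℕ) {g : E → ℂ}
    (hg : HasCompactSupport g) : HasCompactSupport ((dLine v)^[m] g) := by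
  induction m generalizing g with
  | zero => exact hg
  | succ k ih => exact ih (hg.mono' ((subset_tsupport _).trans (tsupport_fderiv_apply_subset ℝ v)))

lemma hcs_bounds {g : En n → ℂ} (hg : ContDiff ℝ ∞ g) (hs : HasCompactSupport g) (N : ℕ) :
    ∃ M : ℝ, 0 ≤ M ∧ ∀ j, ∀ m ≤ N, ∀ x, ‖(dLine (ev j))^[m] g x‖ ≤ M := by
  have h : ∀ (j : Fin n) (m : ℕ), ∃ C, ∀ x, ‖(dLine (ev j))^[m] g x‖ ≤ C := fun j m =>
    (dLine_iter_contDiff (ev j) m hg).continuous.bounded_above_of_compact_support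
      (hcs_dLine_iter (ev j) m hs)
  choose C hC using h
  refine ⟨∑ j, ∑ m ∈ Finset.range (N + 1), |C j m|, by positivity, fun j m hm x => ?_⟩
  refine (hC j m x).trans ((le_abs_self _).trans ?_)
  refine (Finset.single_le_sum (f := fun m => |C j m|) (fun _ _ => abs_nonneg _)
    (Finset.mem_range.2 (Nat.lt_succ_of_le hm))).trans ?_
  exact Finset.single_le_sum (f := fun j => ∑ m ∈ Finset.range (N + 1), |C j m|)
    (fun _ _ => by positivity) (Finset.mem_univ j)

/-- translated cutoffs -/
def chik (δ : ℝ) (k : Fin n → ℤ) (x : En n) : ℂ := chi δ (x - pt δ k)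

lemma chik_contDiff (δ : ℝ) (k : Fin n → ℤ) : ContDiff ℝ ∞ (chik (n := n) δ k) :=
  (chi_contDiff δ).comp (contDiff_id.sub contDiff_const)

lemma chik_norm (δ : ℝ) (k : Fin n → ℤ) (x : En n) : ‖chik δ k x‖ ≤ 1 := chi_norm _ _

lemma chik_ne {δ : ℝ} (hδ : 0 < δ) {k : Fin n → ℤ} {x : En n} (h : chik δ k x ≠ 0) (i : Fin n) :
    |x i - δ * k i| ≤ δ := chi_ne hδ h i

lemma chik_supp {δ : ℝ} (hδ : 0 < δ) {k : Fin n → ℤ} {x : En n} (h : chik δ k x ≠ 0) :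
    x ∈ Metric.closedBall (pt δ k) (n * δ) := by
  have := chi_tsupport hδ (subset_tsupport _ h)
  rw [mem_closedBall_zero_iff] at this
  rwa [Metric.mem_closedBall, dist_eq_norm]

lemma chik_dist {δ : ℝ} (hδ : 0 < δ) {k k' : Fin n → ℤ} {x x' : En n} (h : chik δ k x ≠ 0)
    (h' : chik δ k' x' ≠ 0) (i : Fin n) : |((k i - k' i : ℤ) : ℝ)| ≤ ‖x - x'‖ / δ + 2 := by
  have h1 := chik_ne hδ h i
  have h2 := chik_ne hδ h' i
  have h3 : |x i - x' i| ≤ ‖x - x'‖ := en_coord_le (x - x') i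
  have h4 : δ * |((k i - k' i : ℤ) : ℝ)| ≤ ‖x - x'‖ + 2 * δ := by
    rw [← abs_of_pos hδ, ← abs_mul, abs_of_pos hδ]
    push_cast
    rw [abs_le] at *
    constructor <;> linarith
  rw [div_add' _ _ _ hδ.ne', le_div_iff₀ hδ]
  linarith

lemma chik_sum {δ : ℝ} (R : ℕ) (hδ : 0 < δ) (x : En n) :
    ∑ k : Fin n → ↥(Finset.Icc (-(R : ℤ)) R), chik δ (fun i => (k i : ℤ)) x
      = ((∏ i, (Real.smoothTransition (x i / δ + R + 1) - Real.smoothTransition (x i / δ - R)) : ℝ) : ℂ) := by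
  have h1 : ∀ i, (Real.smoothTransition (x i / δ + R + 1) - Real.smoothTransition (x i / δ - R))
      = ∑ k : ↥(Finset.Icc (-(R : ℤ)) R), bump1 (x i / δ - ((k : ℤ) : ℝ)) := by
    intro i
    rw [← bump1_sum]
    exact (Finset.sum_coe_sort (Finset.Icc (-(R : ℤ)) R) (fun k => bump1 (x i / δ - (k : ℝ)))).symm
  simp only [h1]
  rw [Finset.prod_univ_sum, Fintype.piFinset_univ]
  push_cast
  refine Finset.sum_congr rfl fun k _ => ?_
  rw [chik, chi]
  refine Finset.prod_congr rfl fun i _ => ?_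
  congr 2
  simp only [pt, PiLp.sub_apply]
  field_simp

lemma chik_sum_norm {δ : ℝ} (R : ℕ) (hδ : 0 < δ) (x : En n) :
    ‖∑ k : Fin n → ↥(Finset.Icc (-(R : ℤ)) R), chik δ (fun i => (k i : ℤ)) x‖ ≤ 1 := by
  rw [chik_sum R hδ, Complex.norm_real, norm_prod]
  refine Finset.prod_le_one (fun _ _ => norm_nonneg _) fun i _ => ?_
  have a1 := Real.smoothTransition.nonneg (x i / δ - R)
  have a2 := Real.smoothTransition.le_one (x i / δ - R)
  have a3 := Real.smoothTransition.nonneg (x i / δ + R + 1)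
  have a4 := Real.smoothTransition.le_one (x i / δ + R + 1)
  rw [Real.norm_eq_abs, abs_le]; constructor <;> linarith

lemma chik_sum_tendsto {δ : ℝ} (hδ : 0 < δ) (x : En n) :
    ∀ᶠ R : ℕ in Filter.atTop, 
    ∑ k : Fin n → ↥(Finset.Icc (-(R : ℤ)) R), chik δ (fun i => (k i : ℤ)) x = 1 := by
  filter_upwards [Filter.eventually_ge_atTop ⌈‖x‖ / δ⌉₊] with R hR
  have hR' : ‖x‖ / δ ≤ R := (Nat.le_ceil _).trans (by exact_mod_cast hR)
  rw [chik_sum R hδ]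
  have : ∀ i, Real.smoothTransition (x i / δ + R + 1) - Real.smoothTransition (x i / δ - R) = 1 := by
    intro i
    have h1 : |x i / δ| ≤ R := by
      rw [abs_div, abs_of_pos hδ]
      exact (div_le_div_of_nonneg_right (en_coord_le x i) hδ.le).trans hR'
    rw [abs_le] at h1
    rw [Real.smoothTransition.one_of_one_le (by linarith),
      Real.smoothTransition.zero_of_nonpos (by linarith), sub_zero]
  simp [this]

/-- derivative bounds for products of cutoffs -/
lemma chik_mul_bounds (δ : ℝ) (hδ : 0 < δ) (N : ℕ) : ∃ M : ℝ, 0 ≤ M ∧ ∀ (k k' : Fin n → ℤ) j, ∀ m ≤ N, ∀ x,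
    ‖(dLine (ev j))^[m] (fun x => chik δ k x * chik δ k' x) x‖ ≤ M := by
  obtain ⟨M, hM, hb⟩ := hcs_bounds (chi_contDiff δ) (chi_hcs (n := n) hδ) N
  refine ⟨2 ^ N * (M * M), by positivity, fun k k' j m hm x => ?_⟩
  have h : ∀ k, BW (ev j) Set.univ (fun _ => 1) N M (chik (n := n) δ k) := by
    intro k
    refine ⟨(chik_contDiff δ k).contDiffOn, fun m hm x _ => ?_⟩
    have := dLine_iter_comp_sub (ev j) (pt δ k) m (chi δ) x
    unfold chik
    rw [this, mul_one]
    exact hb j m hm _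
  have := ((h k).mul isOpen_univ (h k')).2 m hm x (Set.mem_univ _)
  simpa using this


/-- the one-dimensional weight -/
def wt (n : ℕ) (d : ℤ) : ℝ := (1 + |(d : ℝ)|) ^ (-(1 + 1 / (2 * n + 1) : ℝ))

lemma wt_pos (n : ℕ) (d : ℤ) : 0 < wt n d := Real.rpow_pos_of_pos (by positivity) _

lemma wt_summable (n : ℕ) : Summable (wt n) := by
  have hp : 1 < (1 + 1 / (2 * n + 1) : ℝ) := by
    have : (0 : ℝ) < 1 / (2 * n + 1) := by positivity
    linarith
  have hs : ∀ f : ℕ → ℤ, (∀ k, |((f k : ℤ) : ℝ)| = k) → Summable (fun k : ℕ => wt n (f k)) := by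
    intro f hf
    have h1 := (Real.summable_nat_rpow_inv.2 hp)
    refine ((summable_nat_add_iff 1).2 h1).congr fun k => ?_
    rw [wt, hf, Real.rpow_neg (by positivity)]
    push_cast
    rw [add_comm]
  refine Summable.of_nat_of_neg (hs (fun k => (k : ℤ)) fun k => ?_) (hs (fun k => -(k : ℤ)) fun k => ?_)
  · simp
  · simp

/-- multi-dimensional weight -/
def wtn (d : Fin n → ℤ) : ℝ := ∏ i, wt n (d i)

lemma wtn_pos (d : Fin n → ℤ) : 0 < wtn d := Finset.prod_pos fun i _ => wt_pos _ _

lemma wtn_sum (R : ℕ) (k : Fin n → ℤ) :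
    ∑ k' : Fin n → ↥(Finset.Icc (-(R : ℤ)) R), wtn (fun i => k i - (k' i : ℤ)) ≤ (∑' d, wt n d) ^ n := by
  have h1 := Finset.prod_univ_sum (fun _ : Fin n => (Finset.univ : Finset ↥(Finset.Icc (-(R : ℤ)) R)))
    (fun i k' => wt n (k i - (k' : ℤ)))
  rw [Fintype.piFinset_univ] at h1
  unfold wtn
  rw [← h1]
  calc _ ≤ ∏ i : Fin n, ∑' d, wt n d := by
        refine Finset.prod_le_prod (fun _ _ => Finset.sum_nonneg fun _ _ => (wt_pos _ _).le) fun i _ => ?_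
        have h2 : ∑' d, wt n d = ∑' d, wt n (k i - d) := ((Equiv.subLeft (k i)).tsum_eq (wt n)).symm
        have h3 : Summable (fun d => wt n (k i - d)) := (Equiv.subLeft (k i)).summable_iff.2 (wt_summable n)
        rw [h2]
        have h4 := h3.sum_le_tsum (Finset.Icc (-(R : ℤ)) R) (fun d _ => (wt_pos _ _).le)
        refine le_trans (le_of_eq ?_) h4
        exact (Finset.sum_coe_sort (Finset.Icc (-(R : ℤ)) R) (fun d => wt n (k i - d)))
    _ = _ := by simp

lemma wtn_ge (d : Fin n → ℤ) (t : ℝ) (ht : 1 ≤ t) (h : ∀ i, 1 + |(d i : ℝ)| ≤ t) :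
    (t ^ (2 * n + 1))⁻¹ ≤ wtn d ^ 2 := by
  set p : ℝ := 1 + 1 / (2 * n + 1) with hp
  have hp0 : 0 < p := by positivity
  have h1 : (t ^ (-p)) ^ n ≤ wtn d := by
    have e : (t ^ (-p)) ^ n = ∏ _i : Fin n, t ^ (-p) := by simp
    rw [wtn, e]
    refine Finset.prod_le_prod (fun _ _ => by positivity) fun i _ => ?_
    exact Real.rpow_le_rpow_of_nonpos (by positivity) (h i) (by linarith)
  refine le_trans ?_ (pow_le_pow_left₀ (by positivity) h1 2)
  have ht0 : 0 ≤ t := by linarith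
  rw [← pow_mul, ← Real.rpow_natCast, ← Real.rpow_natCast, ← Real.rpow_mul ht0, ← Real.rpow_neg ht0]
  refine Real.rpow_le_rpow_of_exponent_le ht ?_
  push_cast
  have : p * (n * 2) ≤ 2 * n + 1 := by
    rw [hp]
    have : (1 / (2 * n + 1) : ℝ) * (2 * n) ≤ 1 := by
      rw [one_div_mul_eq_div, div_le_one (by positivity)]; linarith
    linarith
  linarith
end cutoff


open scoped ContDiff

set_option linter.unusedSectionVars false

section Sbound
variable {n : ℕ}

/-- localized kernel -/
def kerK (δ : ℝ) (φ : En n × En n → ℝ) (k m : Fin n → ℤ) (ξ y : En n) : ℂ :=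
  chik δ k ξ * chik δ m y * Complex.exp (Complex.I * ((φ (y, ξ) : ℝ) : ℂ))

lemma chik_conj (δ : ℝ) (k : Fin n → ℤ) (x : En n) : starRingEnd ℂ (chik δ k x) = chik δ k x := by
  simp [chik, chi, map_prod]

lemma exp_conj' (t : ℝ) : starRingEnd ℂ (Complex.exp (Complex.I * (t : ℂ)))
    = Complex.exp (-(Complex.I * (t : ℂ))) := by
  rw [← Complex.exp_conj]; simp

lemma kerK_ker {δ : ℝ} (hδ : 0 < δ) {φ : En n × En n → ℝ} (hφ : ContDiff ℝ ∞ φ) (k m : Fin n → ℤ) :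
    Ker volume (kerK δ φ k m) (Metric.closedBall (pt δ k) (n * δ)) (Metric.closedBall (pt δ m) (n * δ))
      ((volume : Measure (En n)).real (Metric.closedBall 0 (n * δ))) 1 where
  meas := by
    refine Continuous.stronglyMeasurable ?_
    have h1 := (chik_contDiff (n := n) δ k).continuous
    have h2 := (chik_contDiff (n := n) δ m).continuous
    have h3 := hφ.continuous
    unfold kerK Function.uncurry
    fun_prop
  hS := measurableSet_closedBall
  hS' := measurableSet_closedBall
  vS := by
    rw [measureReal_def, ENNReal.ofReal_toReal measure_closedBall_lt_top.ne,
      Measure.addHaar_closedBall_center]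
  vS' := by
    rw [measureReal_def, ENNReal.ofReal_toReal measure_closedBall_lt_top.ne,
      Measure.addHaar_closedBall_center]
  hV := measureReal_nonneg
  hM := zero_le_one
  zero := fun x y h => by
    by_contra hne
    rw [kerK] at hne
    have h1 := left_ne_zero_of_mul hne
    exact h ⟨chik_supp hδ (left_ne_zero_of_mul h1), chik_supp hδ (right_ne_zero_of_mul h1)⟩
  bd := fun x y => by
    rw [kerK, norm_mul, norm_mul, norm_exp_I_real, mul_one]
    exact mul_le_one₀ (chik_norm _ _ _) (norm_nonneg _) (chik_norm _ _ _)

lemma kerK_core (n : ℕ) (B C₀ : ℝ) (hC : 0 < C₀) (hB : 0 ≤ B) : ∃ δ : ℝ, 0 < δ ∧ ∃ C1 : ℝ, 0 ≤ C1 ∧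
    ∀ φ : En n × En n → ℝ, Good B C₀ φ → ∀ (k m k' m' : Fin n → ℤ) (y z : En n),
      ‖∫ ξ, starRingEnd ℂ (kerK δ φ k m ξ y) * kerK δ φ k' m' ξ z‖ ≤
        C1 * (wtn (fun i => k i - k' i) * wtn (fun i => m i - m' i)) ^ 2 := by
  obtain ⟨δ', hδ', hosc⟩ := osc n B C₀ hC hB
  set δ := δ' / (n + 1) with hδdef
  have hδ : 0 < δ := by positivity
  obtain ⟨Mg, hMg, hchi⟩ := chik_mul_bounds (n := n) δ hδ (2 * n + 1)
  obtain ⟨C, hC0, hosc⟩ := hosc (max Mg 1)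
  set a := 3 + 1 / δ with ha
  have ha0 : 0 < a := by positivity
  set N := 2 * n + 1 with hN
  refine ⟨δ, hδ, C * (2 ^ N * a ^ N) * 3 ^ N, by positivity, fun φ hG k m k' m' y z => ?_⟩
  have hnn : 0 ≤ C * (2 ^ N * a ^ N) * 3 ^ N *
    (wtn (fun i => k i - k' i) * wtn (fun i => m i - m' i)) ^ 2 := by positivity
  have hIeq : ∫ ξ, starRingEnd ℂ (kerK δ φ k m ξ y) * kerK δ φ k' m' ξ z
      = (chik δ m y * chik δ m' z) * ∫ ξ, Complex.exp (Complex.I * ((φ (z, ξ) - φ (y, ξ) : ℝ) : ℂ))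
          * (chik δ k ξ * chik δ k' ξ) := by
    rw [← integral_const_mul]
    refine integral_congr_ae (Filter.Eventually.of_forall fun ξ => ?_)
    simp only [kerK, map_mul, chik_conj, exp_conj']
    have : Complex.exp (Complex.I * ((φ (z, ξ) - φ (y, ξ) : ℝ) : ℂ)) =
        Complex.exp (-(Complex.I * ((φ (y, ξ) : ℝ) : ℂ))) * Complex.exp (Complex.I * ((φ (z, ξ) : ℝ) : ℂ)) := by
      rw [← Complex.exp_add]; congr 1; push_cast; ring
    rw [this]; ring
  rw [hIeq]
  by_cases hy : chik δ m y = 0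
  · simpa [hy] using hnn
  by_cases hz : chik δ m' z = 0
  · simpa [hz] using hnn
  by_cases hk : ∀ ξ, chik δ k ξ * chik δ k' ξ = 0
  · simpa [hk] using hnn
  push Not at hk
  obtain ⟨ξ1, hξ1⟩ := hk
  have w1 : ((3 : ℝ) ^ N)⁻¹ ≤ wtn (fun i => k i - k' i) ^ 2 := by
    refine wtn_ge _ 3 (by norm_num) fun i => ?_
    have := chik_dist hδ (left_ne_zero_of_mul hξ1) (right_ne_zero_of_mul hξ1) i
    simp only [sub_self, norm_zero, zero_div] at this
    linarith
  set r := ‖z - y‖ with hr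
  have hr0 : 0 ≤ r := norm_nonneg _
  have w2 : ((a * (1 + r)) ^ N)⁻¹ ≤ wtn (fun i => m i - m' i) ^ 2 := by
    have h0 : 0 ≤ 1 / δ := by positivity
    have hle : r / δ + 3 ≤ a * (1 + r) := by
      rw [ha]
      have : r / δ = 1 / δ * r := by ring
      nlinarith
    refine wtn_ge _ _ ?_ fun i => ?_
    · have : 0 ≤ r / δ := by positivity
      linarith
    · have := chik_dist hδ hy hz i
      rw [norm_sub_rev] at this
      linarith
  have w3 : (1 + r ^ N)⁻¹ ≤ (2 ^ N * a ^ N) * wtn (fun i => m i - m' i) ^ 2 := by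
    have h1 : (1 + r) ^ N ≤ 2 ^ N * (1 + r ^ N) := by
      calc (1 + r) ^ N ≤ (2 * max 1 r) ^ N := by
            gcongr
            have := le_max_left 1 r
            have := le_max_right 1 r
            linarith
        _ = 2 ^ N * (max 1 r) ^ N := mul_pow _ _ _
        _ ≤ _ := by
            gcongr
            rcases max_cases 1 r with ⟨h, _⟩ | ⟨h, _⟩ <;> rw [h]
            · rw [one_pow]; linarith [pow_nonneg hr0 N]
            · linarith
    calc (1 + r ^ N)⁻¹ ≤ (2 ^ N * a ^ N) * ((a * (1 + r)) ^ N)⁻¹ := by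
          rw [mul_pow, ← div_eq_mul_inv, inv_eq_one_div, div_le_div_iff₀ (by positivity) (by positivity)]
          have : 0 ≤ a ^ N := by positivity
          nlinarith
      _ ≤ _ := by gcongr
  have hts : tsupport (fun ξ => chik δ k ξ * chik δ k' ξ) ⊆ Metric.closedBall (pt δ k) δ' := by
    refine closure_minimal (fun x hx => ?_) Metric.isClosed_closedBall
    refine Metric.closedBall_subset_closedBall ?_ (chik_supp hδ (left_ne_zero_of_mul hx))
    rw [hδdef, mul_div_assoc', div_le_iff₀ (by positivity)]
    nlinarith
  have hmain := hosc φ hG z y (pt δ k) (fun ξ => chik δ k ξ * chik δ k' ξ)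
    ((chik_contDiff δ k).mul (chik_contDiff δ k')) hts
    (fun j m hm x => (hchi k k' j m hm x).trans (le_max_left _ _)) (fun x => by
      rw [norm_mul]
      exact (mul_le_one₀ (chik_norm _ _ _) (norm_nonneg _) (chik_norm _ _ _)).trans (le_max_right _ _))
  rw [norm_mul]
  have hle1 : ‖chik δ m y * chik δ m' z‖ ≤ 1 := by
    rw [norm_mul]; exact mul_le_one₀ (chik_norm _ _ _) (norm_nonneg _) (chik_norm _ _ _)
  have w1' : 1 ≤ 3 ^ N * wtn (fun i => k i - k' i) ^ 2 := by
    rw [inv_le_iff_one_le_mul₀ (by positivity)] at w1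
    linarith
  calc _ ≤ 1 * (C * (1 + r ^ N)⁻¹) := mul_le_mul hle1 hmain (norm_nonneg _) zero_le_one
    _ ≤ 1 * (C * ((2 ^ N * a ^ N) * wtn (fun i => m i - m' i) ^ 2)) := by gcongr
    _ ≤ (3 ^ N * wtn (fun i => k i - k' i) ^ 2) *
        (C * ((2 ^ N * a ^ N) * wtn (fun i => m i - m' i) ^ 2)) := by gcongr
    _ = _ := by ring

/-- truncated operators are uniformly bounded -/
lemma S_trunc (n : ℕ) (B C₀ : ℝ) (hC : 0 < C₀) (hB : 0 ≤ B) : ∃ δ : ℝ, 0 < δ ∧ ∃ C : ℝ, 0 < C ∧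
    ∀ φ : En n × En n → ℝ, Good B C₀ φ → ∀ (R : ℕ) (u : En n → ℂ), MemLp u 2 volume →
      eLpNorm (fun ξ => ∑ k : Fin n → ↥(Finset.Icc (-(R : ℤ)) R),
        ∑ m : Fin n → ↥(Finset.Icc (-(R : ℤ)) R),
        ∫ y, kerK δ φ (fun i => (k i : ℤ)) (fun i => (m i : ℤ)) ξ y * u y) 2 volume
      ≤ ENNReal.ofReal C * eLpNorm u 2 volume := by
  obtain ⟨δ, hδ, C1, hC1, hcore⟩ := kerK_core n B C₀ hC hB
  set V := ((volume : Measure (En n)).real (Metric.closedBall 0 (n * δ))) with hV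
  have hV0 : 0 ≤ V := measureReal_nonneg
  set W := (∑' d, wt n d) ^ n with hW
  have hW0 : 0 ≤ W := by
    have : 0 ≤ ∑' d, wt n d := tsum_nonneg fun d => (wt_pos n d).le
    positivity
  set M := √(C1 * V) * (W * W) + 1 with hM
  refine ⟨δ, hδ, M, by positivity, fun φ hG R u hu => ?_⟩
  let ix := Fin n → ↥(Finset.Icc (-(R : ℤ)) R)
  let cz : ix → Fin n → ℤ := fun k i => (k i : ℤ)
  have hk : ∀ p : ix × ix, Ker volume (kerK δ φ (cz p.1) (cz p.2))
    (Metric.closedBall (pt δ (cz p.1)) (n * δ)) (Metric.closedBall (pt δ (cz p.2)) (n * δ)) V 1 :=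
    fun p => kerK_ker hδ hG.1 _ _
  let T : ix × ix → (Lp ℂ 2 (volume : Measure (En n)) →L[ℂ] Lp ℂ 2 (volume : Measure (En n))) :=
    fun p => (hk p).op
  let γ : ix × ix → ix × ix → ℝ := fun p q =>
    √(C1 * V) * (wtn (fun i => cz p.1 i - cz q.1 i) * wtn (fun i => cz p.2 i - cz q.2 i))
  have hw0 : ∀ d : Fin n → ℤ, 0 ≤ wtn d := fun d => (wtn_pos d).le
  have hγ : ∀ p q, 0 ≤ γ p q := fun p q =>
    mul_nonneg (Real.sqrt_nonneg _) (mul_nonneg (hw0 _) (hw0 _))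
  have hγsq : ∀ p q, γ p q ^ 2 = C1 * (wtn (fun i => cz p.1 i - cz q.1 i)
      * wtn (fun i => cz p.2 i - cz q.2 i)) ^ 2 * V := by
    intro p q
    simp only [γ]
    rw [mul_pow, Real.sq_sqrt (by positivity)]; ring
  have h1 : ∀ p q, ‖star (T p) * T q‖ ≤ γ p q ^ 2 := by
    intro p q
    rw [hγsq]
    exact (hk p).star_mul (hk q) (by positivity) (fun y z => hcore φ hG _ _ _ _ y z)
  have h2 : ∀ p q, ‖T p * star (T q)‖ ≤ γ p q ^ 2 := by
    intro p q
    rw [hγsq]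
    have e1 : T p * star (T q) = star ((hk p).cj.op) * (hk q).cj.op := by
      rw [← (hk p).op_star, ← (hk q).op_star, star_star]
    rw [e1]
    refine (hk p).cj.star_mul (hk q).cj (by positivity) (fun y z => ?_)
    have hsw : ∀ k m ξ y, kerK δ φ k m ξ y = kerK δ (fun z => φ z.swap) m k y ξ := by
      intro k m ξ y; simp only [kerK, Prod.swap_prod_mk]; ring
    have := hcore _ hG.swap (cz p.2) (cz p.1) (cz q.2) (cz q.1) y z
    rw [← RCLike.norm_conj, ← integral_conj] at this
    rw [mul_comm (wtn fun i => cz p.1 i - cz q.1 i)]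
    refine le_trans (le_of_eq ?_) this
    congr 1
    refine integral_congr_ae (Filter.Eventually.of_forall fun x => ?_)
    simp only [map_mul, Complex.conj_conj, hsw]
  have hs : ∀ p, ∑ q, γ p q ≤ M := by
    intro p
    simp only [γ]
    rw [← Finset.mul_sum, Fintype.sum_prod_type]
    have : ∑ x : ix, ∑ y : ix, wtn (fun i => cz p.1 i - cz x i) * wtn (fun i => cz p.2 i - cz y i)
        ≤ W * W := by
      simp only [← Finset.mul_sum, ← Finset.sum_mul]
      exact mul_le_mul (wtn_sum R _) (wtn_sum R _) (Finset.sum_nonneg fun _ _ => hw0 _) hW0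
    have := mul_le_mul_of_nonneg_left this (Real.sqrt_nonneg (C1 * V))
    linarith
  have hcot := cotlar T γ M hγ (by positivity) h1 h2 hs
  have h3 : ‖(∑ p, T p) (hu.toLp u)‖ ≤ M * ‖hu.toLp u‖ :=
    (ContinuousLinearMap.le_opNorm _ _).trans (mul_le_mul_of_nonneg_right hcot (norm_nonneg _))
  have h4 : ∀ᵐ ξ, (∑ p, T p) (hu.toLp u) ξ = ∑ k : ix, ∑ m : ix,
      ∫ y, kerK δ φ (cz k) (cz m) ξ y * u y := by
    have e0 : (∑ p, T p) (hu.toLp u) = ∑ p, T p (hu.toLp u) := by simp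
    have e1 := Lp.coeFn_fun_finsetSum (Finset.univ) (fun p => T p (hu.toLp u))
    have e2 : ∀ᵐ ξ, ∀ p, T p (hu.toLp u) ξ = ∫ y, kerK δ φ (cz p.1) (cz p.2) ξ y * (hu.toLp u) y :=
      ae_all_iff.2 fun p => (hk p).op_coe _
    rw [e0]
    filter_upwards [e1, e2] with ξ h5 h6
    rw [h5, ← Fintype.sum_prod_type']
    refine Finset.sum_congr rfl fun p _ => ?_
    rw [h6]
    refine integral_congr_ae ?_
    filter_upwards [hu.coeFn_toLp] with y hy
    rw [hy]
  rw [← eLpNorm_congr_ae h4, ← eLpNorm_congr_ae hu.coeFn_toLp, ← Lp.enorm_def, ← Lp.enorm_def,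
    ← ofReal_norm, ← ofReal_norm, ← ENNReal.ofReal_mul (by positivity)]
  exact ENNReal.ofReal_le_ofReal h3

lemma S_bound (n : ℕ) (B C₀ : ℝ) (hC : 0 < C₀) (hB : 0 ≤ B) : ∃ C : ℝ, 0 < C ∧
    ∀ φ : En n × En n → ℝ, Good B C₀ φ → ∀ (u : En n → ℂ), MemLp u 2 volume → Integrable u →
      eLpNorm (fun ξ => ∫ y, Complex.exp (Complex.I * ((φ (y, ξ) : ℝ) : ℂ)) * u y) 2 volume
      ≤ ENNReal.ofReal C * eLpNorm u 2 volume := by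
  obtain ⟨δ, hδ, C, hC, hT⟩ := S_trunc n B C₀ hC hB
  refine ⟨C, hC, fun φ hG u hu hui => ?_⟩
  let ψ : ℕ → En n → ℂ := fun R x =>
    ∑ k : Fin n → ↥(Finset.Icc (-(R : ℤ)) R), chik δ (fun i => (k i : ℤ)) x
  have hψ1 : ∀ R x, ‖ψ R x‖ ≤ 1 := fun R x => chik_sum_norm R hδ x
  have hψc : ∀ R, Continuous (ψ R) := fun R =>
    continuous_finsetSum _ fun k _ => (chik_contDiff δ _).continuous
  have hexp : ∀ ξ, Continuous fun y => Complex.exp (Complex.I * ((φ (y, ξ) : ℝ) : ℂ)) := by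
    intro ξ
    have := hG.1.continuous
    fun_prop
  have hform : ∀ (R : ℕ) ξ, ∑ k : Fin n → ↥(Finset.Icc (-(R : ℤ)) R),
        ∑ m : Fin n → ↥(Finset.Icc (-(R : ℤ)) R),
        ∫ y, kerK δ φ (fun i => (k i : ℤ)) (fun i => (m i : ℤ)) ξ y * u y
      = ψ R ξ * ∫ y, Complex.exp (Complex.I * ((φ (y, ξ) : ℝ) : ℂ)) * (ψ R y * u y) := by
    intro R ξ
    simp only [ψ]
    rw [Finset.sum_mul]
    refine Finset.sum_congr rfl fun k _ => ?_
    rw [← integral_finsetSum]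
    · rw [← integral_const_mul]
      refine integral_congr_ae (Filter.Eventually.of_forall fun y => ?_)
      simp only [kerK]
      rw [Finset.sum_mul, Finset.mul_sum, Finset.mul_sum]
      refine Finset.sum_congr rfl fun m _ => ?_
      ring
    · intro m _
      exact (kerK_ker hδ hG.1 _ _).integrable hu ξ
  have hFm : ∀ R, AEStronglyMeasurable (fun ξ => ψ R ξ *
      ∫ y, Complex.exp (Complex.I * ((φ (y, ξ) : ℝ) : ℂ)) * (ψ R y * u y)) volume := by
    intro R
    refine (hψc R).aestronglyMeasurable.mul ?_
    have : AEStronglyMeasurable (fun p : En n × En n =>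
        Complex.exp (Complex.I * ((φ (p.2, p.1) : ℝ) : ℂ)) * (ψ R p.2 * u p.2)) (volume.prod volume) := by
      refine AEStronglyMeasurable.mul ?_ ?_
      · refine Continuous.aestronglyMeasurable ?_
        have := hG.1.continuous
        fun_prop
      · exact AEStronglyMeasurable.comp_snd (f := fun y => ψ R y * u y)
          ((hψc R).aestronglyMeasurable.mul hu.1)
    exact this.integral_prod_right'
  refine (Lp.eLpNorm_lim_le_liminf_eLpNorm hFm _ (Filter.Eventually.of_forall fun ξ => ?_)).trans ?_
  · have hone : ∀ x, Filter.Tendsto (fun R => ψ R x) Filter.atTop (nhds 1) := fun x =>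
      tendsto_const_nhds.congr' ((chik_sum_tendsto hδ x).mono fun R h => h.symm)
    have h2 : Filter.Tendsto (fun R => ∫ y, Complex.exp (Complex.I * ((φ (y, ξ) : ℝ) : ℂ)) * (ψ R y * u y))
        Filter.atTop (nhds (∫ y, Complex.exp (Complex.I * ((φ (y, ξ) : ℝ) : ℂ)) * u y)) := by
      refine tendsto_integral_of_dominated_convergence (fun y => ‖u y‖) (fun R => ?_) hui.norm
        (fun R => Filter.Eventually.of_forall fun y => ?_) (Filter.Eventually.of_forall fun y => ?_)
      · exact (hexp ξ).aestronglyMeasurable.mul ((hψc R).aestronglyMeasurable.mul hu.1)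
      · rw [norm_mul, norm_mul, norm_exp_I_real, one_mul]
        exact mul_le_of_le_one_left (norm_nonneg _) (hψ1 R y)
      · have := ((hone y).mul_const (u y)).const_mul (Complex.exp (Complex.I * ((φ (y, ξ) : ℝ) : ℂ)))
        rwa [one_mul] at this
    have := (hone ξ).mul h2
    rwa [one_mul] at this
  · refine Filter.liminf_le_of_le (by isBoundedDefault) fun b hb => ?_
    obtain ⟨R, hR⟩ := hb.exists
    refine hR.trans ?_
    have := hT φ hG R u hu
    simpa only [hform] using this
end Sbound


open scoped ContDiff

set_option linter.unusedSectionVars false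

section weights
variable {n : ℕ}

/-- the weight `Q` -/
def Qw (s : ℕ) (z : En n) : ℝ := 1 + ∑ j, (z j) ^ (2 * s)

lemma Qw_ge (s : ℕ) (z : En n) (j : Fin n) : 1 + |z j| ^ (2 * s) ≤ Qw s z := by
  have h : ∀ i, 0 ≤ (z i) ^ (2 * s) := fun i => (even_two_mul s).pow_nonneg _
  have := Finset.single_le_sum (f := fun j => (z j) ^ (2 * s)) (fun i _ => h i) (Finset.mem_univ j)
  rw [(even_two_mul s).pow_abs, Qw]
  linarith

lemma Qw_one (s : ℕ) (z : En n) : 1 ≤ Qw s z := by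
  have h : ∀ i, 0 ≤ (z i) ^ (2 * s) := fun i => (even_two_mul s).pow_nonneg _
  have := Finset.sum_nonneg (s := Finset.univ) (fun i _ => h i)
  rw [Qw]; linarith

lemma coord_contDiff (j : Fin n) : ContDiff ℝ ∞ (fun z : En n => ((z j : ℝ) : ℂ)) :=
  Complex.ofRealCLM.contDiff.comp (EuclideanSpace.proj (𝕜 := ℝ) j).contDiff

lemma dLine_coord_pow (k j : Fin n) (c : ℂ) (r : ℕ) :
    dLine (ev k) (fun z : En n => c * ((z j : ℝ) : ℂ) ^ r)
      = fun z => (c * r * (if j = k then 1 else 0)) * ((z j : ℝ) : ℂ) ^ (r - 1) := by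
  funext z
  have h0 : HasFDerivAt (fun z : En n => ((z j : ℝ) : ℂ))
      (Complex.ofRealCLM ∘L (EuclideanSpace.proj (𝕜 := ℝ) j)) z :=
    (Complex.ofRealCLM ∘L (EuclideanSpace.proj (𝕜 := ℝ) j)).hasFDerivAt
  have h1 := ((h0.pow r).const_mul c).fderiv
  have h2 := congrArg (fun L => L (ev k)) h1
  refine h2.trans ?_
  simp [Pi.single_apply]
  split_ifs <;> simp
  ring

lemma coord_pow_iter (k j : Fin n) (r m : ℕ) : ∃ (c : ℂ) (r' : ℕ), r' ≤ r ∧ ‖c‖ ≤ (r : ℝ) ^ m ∧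
    (dLine (ev k))^[m] (fun z : En n => ((z j : ℝ) : ℂ) ^ r) = fun z => c * ((z j : ℝ) : ℂ) ^ r' := by
  induction m with
  | zero => exact ⟨1, r, le_rfl, by simp, by simp⟩
  | succ m ih =>
    obtain ⟨c, r', hr, hc, he⟩ := ih
    refine ⟨c * r' * (if j = k then 1 else 0), r' - 1, by omega, ?_, ?_⟩
    · have hr' : (r' : ℝ) ≤ r := by exact_mod_cast hr
      have h1 : ‖(if j = k then (1 : ℂ) else 0)‖ ≤ 1 := by split_ifs <;> simp
      rw [norm_mul, norm_mul, Complex.norm_natCast]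
      calc _ ≤ (r : ℝ) ^ m * r * 1 := by gcongr
        _ = _ := by ring
    · rw [Function.iterate_succ_apply', he, dLine_coord_pow]

lemma pow_le_one_add {t : ℝ} (ht : 0 ≤ t) {r' r : ℕ} (h : r' ≤ r) : t ^ r' ≤ 1 + t ^ r := by
  rcases le_total t 1 with h1 | h1
  · have := pow_le_one₀ (n := r') ht h1
    have := pow_nonneg ht r
    linarith
  · have := pow_le_pow_right₀ h1 h
    linarith

lemma coord_pow_bound (k j : Fin n) (r m N : ℕ) (hm : m ≤ N) (z : En n) :
    ‖(dLine (ev k))^[m] (fun z : En n => ((z j : ℝ) : ℂ) ^ r) z‖ ≤ (r + 1) ^ N * (1 + |z j| ^ r) := by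
  obtain ⟨c, r', hr, hc, he⟩ := coord_pow_iter k j r m
  rw [he]
  simp only [norm_mul, norm_pow, Complex.norm_real, Real.norm_eq_abs]
  have h1 : (r : ℝ) ^ m ≤ (r + 1) ^ N :=
    (pow_le_pow_left₀ (by positivity) (by linarith) m).trans
      (pow_le_pow_right₀ (by have : (0 : ℝ) ≤ r := by positivity
                             linarith) hm)
  exact mul_le_mul (hc.trans h1) (pow_le_one_add (abs_nonneg _) hr) (by positivity) (by positivity)

/-- the functions `q_j` -/
def qj (s : ℕ) : Option (Fin n) → En n → ℂ
  | none => fun z => ((Qw s z : ℝ) : ℂ)⁻¹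
  | some j => fun z => ((z j : ℝ) : ℂ) ^ s * ((Qw s z : ℝ) : ℂ)⁻¹

lemma Qw_contDiff (s : ℕ) : ContDiff ℝ ∞ (fun z : En n => ((Qw s z : ℝ) : ℂ)) := by
  unfold Qw
  refine Complex.ofRealCLM.contDiff.comp (contDiff_const.add (ContDiff.sum fun j _ => ?_))
  exact ((EuclideanSpace.proj (𝕜 := ℝ) j).contDiff).pow _

lemma Qw_ne (s : ℕ) (z : En n) : ((Qw s z : ℝ) : ℂ) ≠ 0 := by
  have := Qw_one s z
  exact Complex.ofReal_ne_zero.2 (by linarith)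

lemma qj_contDiff (s : ℕ) (j : Option (Fin n)) : ContDiff ℝ ∞ (qj (n := n) s j) := by
  have h := (Qw_contDiff (n := n) s).inv (Qw_ne s)
  cases j with
  | none => exact h
  | some j => exact ((coord_contDiff j).pow s).mul h

lemma qj_sum (s : ℕ) (z : En n) : qj s none z + ∑ j, qj s (some j) z * ((z j : ℝ) : ℂ) ^ s = 1 := by
  have h := Qw_ne s z
  have h1 : ∀ j, qj s (some j) z * ((z j : ℝ) : ℂ) ^ s
      = ((z j : ℝ) : ℂ) ^ (2 * s) * ((Qw s z : ℝ) : ℂ)⁻¹ := fun j => by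
    simp only [qj]; ring
  simp only [h1, ← Finset.sum_mul]
  simp only [qj]
  rw [← one_add_mul]
  rw [mul_inv_eq_one₀ h]
  simp [Qw]

lemma dLine_iter_zero' {W F : Type*} [NormedAddCommGroup W] [NormedSpace ℝ W]
    [NormedAddCommGroup F] [NormedSpace ℝ F] (v : W) (m : ℕ) :
    (dLine v)^[m] (fun _ : W => (0 : F)) = fun _ => 0 := by
  induction m with
  | zero => rfl
  | succ m ih =>
    rw [Function.iterate_succ_apply', ih]
    funext x; simp [dLine]

lemma dLine_iter_sum {W F ι : Type*} [NormedAddCommGroup W] [NormedSpace ℝ W]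
    [NormedAddCommGroup F] [NormedSpace ℝ F] (v : W) (m : ℕ) (t : Finset ι) (f : ι → W → F)
    (hf : ∀ i, ContDiff ℝ ∞ (f i)) (x : W) :
    (dLine v)^[m] (fun x => ∑ i ∈ t, f i x) x = ∑ i ∈ t, (dLine v)^[m] (f i) x := by
  classical
  induction t using Finset.induction_on with
  | empty => simp [dLine_iter_zero']
  | insert a t ha ih =>
    rw [Finset.sum_insert ha, ← ih]
    simp only [Finset.sum_insert ha]
    exact dLine_iter_add isOpen_univ v m (hf a).contDiffOn
      (ContDiff.sum fun i _ => hf i).contDiffOn (Set.mem_univ x)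

lemma Qw_BW (s N : ℕ) : ∃ M : ℝ, 0 ≤ M ∧ ∀ k : Fin n,
    BW (ev k) Set.univ (Qw s) N M (fun z : En n => ((Qw s z : ℝ) : ℂ)) := by
  refine ⟨1 + ∑ _j : Fin n, ((2 * s : ℕ) + 1 : ℝ) ^ N, by positivity, fun k =>
    ⟨(Qw_contDiff s).contDiffOn, fun m hm z _ => ?_⟩⟩
  have hQ : (fun z : En n => ((Qw s z : ℝ) : ℂ))
      = fun z => ((1 : ℝ) : ℂ) + ∑ j, ((z j : ℝ) : ℂ) ^ (2 * s) := by
    funext z; simp [Qw]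
  rw [hQ, dLine_iter_add isOpen_univ (ev k) m contDiff_const.contDiffOn
    (ContDiff.sum fun i _ => (coord_contDiff i).pow _).contDiffOn (Set.mem_univ z),
    dLine_iter_sum _ _ _ _ (fun i => (coord_contDiff i).pow _), add_mul, Finset.sum_mul, one_mul]
  refine (norm_add_le _ _).trans (add_le_add ?_ ((norm_sum_le _ _).trans
    (Finset.sum_le_sum fun j _ => ?_)))
  · refine le_trans ?_ (Qw_one s z)
    rcases m with _ | m
    · simp
    · rw [Function.iterate_succ_apply]
      have : dLine (ev k) (fun _ : En n => ((1 : ℝ) : ℂ)) = fun _ => 0 := by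
        funext x; simp [dLine]
      rw [this, dLine_iter_zero']; simp
  · refine (coord_pow_bound k j (2 * s) m N hm z).trans ?_
    exact mul_le_mul_of_nonneg_left (Qw_ge s z j) (by positivity)

lemma qj_BW (s N : ℕ) : ∃ M : ℝ, 0 ≤ M ∧ ∀ (k : Fin n) (j : Option (Fin n)), ∀ m ≤ N, ∀ z,
    ‖(dLine (ev k))^[m] (qj s j) z‖ ≤ M * (√(Qw s z))⁻¹ := by
  obtain ⟨M, hM, hQ⟩ := Qw_BW (n := n) s N
  obtain ⟨M', hM', hinv⟩ := BW.inv (W := En n) N M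
  have hi : ∀ k : Fin n, BW (ev k) Set.univ (fun z => (Qw s z)⁻¹) N M'
      (fun z : En n => ((Qw s z : ℝ) : ℂ)⁻¹) := fun k =>
    hinv (ev k) Set.univ (Qw s) _ isOpen_univ (fun x _ => by have := Qw_one s x; linarith) (hQ k)
      (fun x _ => by rw [Complex.norm_real]; exact le_abs_self _)
  have hp : ∀ k j : Fin n, BW (ev k) Set.univ (fun z => √(Qw s z)) N ((s + 1) ^ N * 2)
      (fun z : En n => ((z j : ℝ) : ℂ) ^ s) := by
    intro k j
    refine ⟨((coord_contDiff j).pow s).contDiffOn, fun m hm z _ => ?_⟩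
    refine (coord_pow_bound k j s m N hm z).trans ?_
    rw [mul_assoc]
    refine mul_le_mul_of_nonneg_left ?_ (by positivity)
    have h1 : 1 ≤ √(Qw s z) := Real.one_le_sqrt.2 (Qw_one s z)
    have h2 : |z j| ^ s ≤ √(Qw s z) := by
      refine Real.le_sqrt_of_sq_le ?_
      rw [← pow_mul, mul_comm s 2]
      have := Qw_ge s z j
      linarith
    linarith
  refine ⟨max M' (2 ^ N * ((s + 1) ^ N * 2 * M')), le_max_of_le_left hM', fun k j m hm z => ?_⟩
  have hq1 := Qw_one s z
  have hs0 : 0 < √(Qw s z) := Real.sqrt_pos.2 (by linarith)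
  cases j with
  | none =>
    refine ((hi k).2 m hm z (Set.mem_univ _)).trans ?_
    refine mul_le_mul (le_max_left _ _) ?_ (by positivity) (le_max_of_le_left hM')
    refine inv_anti₀ hs0 ?_
    exact Real.sqrt_le_left (by linarith) |>.2 (by nlinarith)
  | some j =>
    refine (((hp k j).mul isOpen_univ (hi k)).2 m hm z (Set.mem_univ _)).trans ?_
    have : √(Qw s z) * (Qw s z)⁻¹ = (√(Qw s z))⁻¹ := by
      have := Real.mul_self_sqrt (show 0 ≤ Qw s z by linarith)
      rw [mul_inv_eq_iff_eq_mul₀ (by linarith), inv_mul_eq_div, eq_div_iff hs0.ne']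
      exact this
    simp only [this]
    exact mul_le_mul_of_nonneg_right (le_max_right _ _) (by positivity)

lemma Qw_integrable (n : ℕ) {s : ℕ} (hs : n < 2 * s) :
    Integrable (fun z : En n => (Qw s z)⁻¹) := by
  have h0 := integrable_one_add_norm (E := En n) (μ := volume) (r := ((2 * s : ℕ) : ℝ))
    (by simpa using (by exact_mod_cast hs : (n : ℝ) < ((2 * s : ℕ) : ℝ)))
  refine (h0.const_mul (((n : ℝ) + 1) ^ (2 * s))).mono' ?_ (Filter.Eventually.of_forall fun z => ?_)
  · have : Continuous (fun z : En n => Qw s z) := by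
      unfold Qw; fun_prop
    exact (this.inv₀ fun z => by have := Qw_one s z; linarith).aestronglyMeasurable
  · have hq := Qw_one s z
    rw [Real.norm_of_nonneg (by positivity), Real.rpow_neg (by positivity), Real.rpow_natCast,
      ← div_eq_mul_inv, inv_eq_one_div, div_le_div_iff₀ (by linarith) (by positivity), one_mul]
    set t := (∑ j, |z j|) with ht
    have h1 : 1 + ‖z‖ ≤ 1 + ∑ j, |z j| := by linarith [en_norm_le z]
    -- every coordinate is at most a root of Q; use a maximal coordinate
    rcases isEmpty_or_nonempty (Fin n) with hn | hn
    · have : ‖z‖ ≤ 0 := (en_norm_le z).trans (by simp)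
      have hz : ‖z‖ = 0 := le_antisymm this (norm_nonneg _)
      rw [hz, add_zero, one_pow]
      refine one_le_mul_of_one_le_of_one_le (one_le_pow₀ ?_) hq
      linarith [(Nat.cast_nonneg n : (0 : ℝ) ≤ n)]
    · obtain ⟨i, hi⟩ := Finite.exists_max (fun j => |z j|)
      have h2 : 1 + ‖z‖ ≤ (n + 1) * max 1 |z i| := by
        have h3 : ∑ j, |z j| ≤ n * |z i| := by
          refine (Finset.sum_le_sum fun j _ => hi j).trans_eq (by simp)
        have h4 := le_max_left 1 |z i|
        have h5 := le_max_right 1 |z i|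
        nlinarith [(Nat.cast_nonneg n : (0 : ℝ) ≤ n)]
      calc (1 + ‖z‖) ^ (2 * s) ≤ ((n + 1) * max 1 |z i|) ^ (2 * s) := by gcongr
        _ = (n + 1) ^ (2 * s) * (max 1 |z i|) ^ (2 * s) := mul_pow _ _ _
        _ ≤ (n + 1) ^ (2 * s) * Qw s z := by
          gcongr
          rcases max_cases 1 |z i| with ⟨h, _⟩ | ⟨h, _⟩ <;> rw [h]
          · rw [one_pow]; exact hq
          · have := Qw_ge s z i
            linarith

lemma qj_memLp (n : ℕ) {s : ℕ} (hs : n < 2 * s) (k : Fin n) (j : Option (Fin n)) (m : ℕ) :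
    MemLp ((dLine (ev k))^[m] (qj (n := n) s j)) 2 volume := by
  obtain ⟨M, hM, hb⟩ := qj_BW (n := n) s m
  have hc := (dLine_iter_contDiff (ev k) m (qj_contDiff s j)).continuous
  rw [memLp_two_iff_integrable_sq_norm hc.aestronglyMeasurable]
  refine ((Qw_integrable n hs).const_mul (M ^ 2)).mono' (hc.norm.pow 2).aestronglyMeasurable
    (Filter.Eventually.of_forall fun z => ?_)
  have h1 := hb k j m le_rfl z
  have hq := Qw_one s z
  rw [Real.norm_of_nonneg (by positivity)]
  refine (pow_le_pow_left₀ (norm_nonneg _) h1 2).trans_eq ?_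
  rw [mul_pow, inv_pow, Real.sq_sqrt (by linarith)]

lemma qj_memLp0 (n : ℕ) {s : ℕ} (hs : n < 2 * s) (j : Option (Fin n)) :
    MemLp (qj (n := n) s j) 2 volume := by
  rcases isEmpty_or_nonempty (Fin n) with hn | ⟨⟨k⟩⟩
  · have hc := (qj_contDiff (n := n) s j).continuous
    have hu : (Set.univ : Set (En n)) ⊆ {0} := fun x _ => by
      ext i; exact (hn.false i).elim
    have hcs : HasCompactSupport (qj (n := n) s j) :=
      (isCompact_singleton (x := (0 : En n))).of_isClosed_subset (isClosed_tsupport _)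
        ((Set.subset_univ _).trans hu)
    exact hc.memLp_of_hasCompactSupport hcs
  · exact qj_memLp n hs k j 0
end weights


open scoped ContDiff

set_option linter.unusedSectionVars false

section planch
variable {n : ℕ}
open scoped FourierTransform

lemma fourier_scaled (g : En n → ℂ) (ξ : En n) :
    ∫ y, Complex.exp (-(I * ((⟪y, ξ⟫ : ℝ) : ℂ))) * g y = 𝓕 g ((2 * π)⁻¹ • ξ) := by
  rw [Real.fourier_eq']
  refine integral_congr_ae (Filter.Eventually.of_forall fun y => ?_)
  simp only [smul_eq_mul, inner_smul_right]
  congr 2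
  have : (-2 * π * ((2 * π)⁻¹ * ⟪y, ξ⟫) : ℝ) = -⟪y, ξ⟫ := by
    have := Real.pi_pos.ne'
    field_simp
  rw [this]; push_cast; ring

lemma planch0 {g : En n → ℂ} (hg : ContDiff ℝ ∞ g) (hs : HasCompactSupport g) :
    ∫⁻ ξ, ‖𝓕 g ξ‖ₑ ^ 2 = ∫⁻ x, ‖g x‖ₑ ^ 2 := by
  have h := SchwartzMap.integral_norm_sq_fourier (hs.toSchwartzMap hg)
  have e1 : ∀ f : 𝓢(En n, ℂ), ∫⁻ x, ‖f x‖ₑ ^ 2 = ENNReal.ofReal (∫ x, ‖f x‖ ^ 2) := by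
    intro f
    rw [ofReal_integral_eq_lintegral_ofReal]
    · refine lintegral_congr fun x => ?_
      rw [ENNReal.ofReal_pow (norm_nonneg _), ofReal_norm]
    · exact (f.memLp 2 volume).integrable_norm_pow (by simp)
    · exact Filter.Eventually.of_forall fun x => by positivity
  have e2 := e1 (hs.toSchwartzMap hg)
  have e3 := e1 (𝓕 (hs.toSchwartzMap hg))
  rw [h, ← e2] at e3
  rw [SchwartzMap.fourier_coe] at e3
  exact e3

lemma fourier_cont {g : En n → ℂ} (hg : ContDiff ℝ ∞ g) (hs : HasCompactSupport g) :
    Continuous (𝓕 g) := by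
  have := (𝓕 (hs.toSchwartzMap hg)).continuous
  rw [SchwartzMap.fourier_coe] at this
  exact this

lemma planch {g : En n → ℂ} (hg : ContDiff ℝ ∞ g) (hs : HasCompactSupport g) :
    ∫⁻ ξ : En n, ‖∫ y, Complex.exp (-(I * ((⟪y, ξ⟫ : ℝ) : ℂ))) * g y‖ₑ ^ 2 =
      ENNReal.ofReal ((2 * π) ^ n) * ∫⁻ x, ‖g x‖ₑ ^ 2 := by
  simp_rw [fourier_scaled]
  have hp : (0:ℝ) < 2 * π := by positivity
  have h := Measure.map_addHaar_smul (volume : Measure (En n)) (r := (2 * π)⁻¹) (by positivity)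
  have hm : Measurable fun ξ => ‖𝓕 g ξ‖ₑ ^ 2 := (fourier_cont hg hs).measurable.enorm.pow_const 2
  rw [← lintegral_map (f := fun ξ => ‖𝓕 g ξ‖ₑ ^ 2) hm (by fun_prop), h, lintegral_smul_measure, planch0 hg hs,
    smul_eq_mul]
  congr 2
  rw [finrank_euclideanSpace, Fintype.card_fin, inv_pow, inv_inv, abs_of_pos (by positivity)]
end planch


open scoped ContDiff

set_option linter.unusedSectionVars false

section UUsec
variable {n : ℕ}

/-- The windowed Fourier transform. -/
def UU (p f : En n → ℂ) (x ξ : En n) : ℂ :=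
  ∫ y, Complex.exp (-(I * ((⟪y, ξ⟫ : ℝ) : ℂ))) * (p (x - y) * f y)

lemma UU_meas {p f : En n → ℂ} (hp : Continuous p) (hf : Continuous f) :
    StronglyMeasurable (fun z : En n × En n => UU p f z.1 z.2) := by
  have : Continuous (fun w : (En n × En n) × En n =>
      Complex.exp (-(I * ((⟪w.2, w.1.2⟫ : ℝ) : ℂ))) * (p (w.1.1 - w.2) * f w.2)) := by fun_prop
  exact this.stronglyMeasurable.integral_prod_right

lemma UU_l2 {p f : En n → ℂ} (hp : ContDiff ℝ ∞ p) (hf : ContDiff ℝ ∞ f) (hs : HasCompactSupport f) :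
    ∫⁻ x, ∫⁻ ξ, ‖UU p f x ξ‖ₑ ^ 2 =
      ENNReal.ofReal ((2 * π) ^ n) * ((∫⁻ x, ‖p x‖ₑ ^ 2) * ∫⁻ x, ‖f x‖ₑ ^ 2) := by
  have h1 : ∀ x, ∫⁻ ξ, ‖UU p f x ξ‖ₑ ^ 2 = ENNReal.ofReal ((2 * π) ^ n) *
      ∫⁻ y, ‖p (x - y)‖ₑ ^ 2 * ‖f y‖ₑ ^ 2 := by
    intro x
    have := planch (g := fun y => p (x - y) * f y) ((hp.comp (contDiff_const.sub contDiff_id)).mul hf)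
      hs.mul_left
    refine this.trans ?_
    congr 1
    refine lintegral_congr fun y => ?_
    rw [enorm_mul, mul_pow]
  simp_rw [h1]
  have hpm := hp.continuous
  have hfm := hf.continuous
  rw [lintegral_const_mul' _ _ ENNReal.ofReal_ne_top, lintegral_lintegral_swap]
  · congr 1
    have : ∀ y, ∫⁻ x, ‖p (x - y)‖ₑ ^ 2 * ‖f y‖ₑ ^ 2 = (∫⁻ x, ‖p x‖ₑ ^ 2) * ‖f y‖ₑ ^ 2 := by
      intro y
      rw [lintegral_mul_const' _ _ (by finiteness), lintegral_sub_right_eq_self (fun x => ‖p x‖ₑ ^ 2)]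
    simp_rw [this]
    rw [lintegral_const_mul _ (by fun_prop)]
  · refine Measurable.aemeasurable ?_
    have : Measurable (fun q : En n × En n => ‖p (q.1 - q.2)‖ₑ ^ 2 * ‖f q.2‖ₑ ^ 2) := by
      have h1 : Measurable (fun q : En n × En n => p (q.1 - q.2)) := by
        refine Continuous.measurable ?_
        fun_prop
      have h2 : Measurable (fun q : En n × En n => f q.2) := by
        refine Continuous.measurable ?_
        fun_prop
      exact (h1.enorm.pow_const 2).mul (h2.enorm.pow_const 2)
    exact this

lemma UU_bdd {p f : En n → ℂ} {M : ℝ} (hpM : ∀ x, ‖p x‖ ≤ M)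
    (hf : Continuous f) (hs : HasCompactSupport f) (x ξ : En n) :
    ‖UU p f x ξ‖ ≤ M * ∫ y, ‖f y‖ := by
  unfold UU
  rw [← integral_const_mul]
  refine norm_integral_le_of_norm_le ?_ (Filter.Eventually.of_forall fun y => ?_)
  · exact ((hf.integrable_of_hasCompactSupport hs).norm).const_mul M
  · have h1 : ‖Complex.exp (-(I * ((⟪y, ξ⟫ : ℝ) : ℂ)))‖ = 1 := by
      have := norm_exp_I_real (-⟪y, ξ⟫)
      rwa [Complex.ofReal_neg, mul_neg] at this
    rw [norm_mul, norm_mul, h1, one_mul]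
    exact mul_le_mul_of_nonneg_right (hpM _) (norm_nonneg _)

lemma expf_contDiff (ξ : En n) (c : ℂ) :
    ContDiff ℝ ∞ (fun y : En n => Complex.exp (c * ((⟪y, ξ⟫ : ℝ) : ℂ))) := by
  refine ContDiff.cexp (contDiff_const.mul (Complex.ofRealCLM.contDiff.comp ?_))
  exact contDiff_id.inner ℝ contDiff_const

open scoped Convolution in
lemma UU_conv (p f : En n → ℂ) (x ξ : En n) :
    UU p f x ξ = ((fun y => Complex.exp (-I * ((⟪y, ξ⟫ : ℝ) : ℂ)) * f y) ⋆[ContinuousLinearMap.mul ℝ ℂ, volume] p) x := by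
  unfold UU MeasureTheory.convolution
  refine integral_congr_ae (Filter.Eventually.of_forall fun y => ?_)
  simp only [ContinuousLinearMap.mul_apply', neg_mul]
  ring

lemma UU_smooth {p f : En n → ℂ} (hp : Continuous p) (hf : ContDiff ℝ ∞ f) (hs : HasCompactSupport f)
    (ξ : En n) : ContDiff ℝ ∞ (fun x => UU p f x ξ) := by
  have h := HasCompactSupport.contDiff_convolution_left (μ := (volume : Measure (En n))) (ContinuousLinearMap.mul ℝ ℂ)
    (f := fun y => Complex.exp (-I * ((⟪y, ξ⟫ : ℝ) : ℂ)) * f y) (g := p) (n := (⊤ : ℕ∞))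
    hs.mul_left ((expf_contDiff ξ _).mul hf) hp.locallyIntegrable
  convert h using 1
  funext x
  exact UU_conv p f x ξ

lemma UU_dLine (v : En n) {p f : En n → ℂ} (hp : ContDiff ℝ ∞ p) (hf : ContDiff ℝ ∞ f) (hs : HasCompactSupport f)
    (ξ x : En n) : dLine v (fun x => UU p f x ξ) x = UU (dLine v p) f x ξ := by
  set g : En n → ℂ := fun y => Complex.exp (-I * ((⟪y, ξ⟫ : ℝ) : ℂ)) * f y with hg
  have hgc : ContDiff ℝ ∞ g := (expf_contDiff ξ _).mul hf
  have hgs : HasCompactSupport g := hs.mul_left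
  have h := HasCompactSupport.hasFDerivAt_convolution_left (μ := (volume : Measure (En n))) (ContinuousLinearMap.mul ℝ ℂ)
    (f := g) (g := p) hgs (hgc.of_le (by simp)) hp.continuous.locallyIntegrable x
  have e : (fun x => UU p f x ξ) = MeasureTheory.convolution g p (ContinuousLinearMap.mul ℝ ℂ) volume :=
    funext fun x => UU_conv p f x ξ
  unfold dLine at *
  rw [e, h.fderiv]
  have hi : Integrable (fun y => (ContinuousLinearMap.mul ℝ ℂ).precompL (En n) (fderiv ℝ g y) (p (x - y))) := by
    refine Continuous.integrable_of_hasCompactSupport ?_ ?_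
    · have h1 := (hgc.continuous_fderiv (by simp))
      have h2 := hp.continuous
      fun_prop
    · have := hgs.fderiv (𝕜 := ℝ)
      refine this.mono fun y hy => ?_
      contrapose! hy
      simp at hy
      simp [hy]
  unfold MeasureTheory.convolution
  rw [ContinuousLinearMap.integral_apply hi v]
  simp only [ContinuousLinearMap.precompL_apply, ContinuousLinearMap.mul_apply']
  have := ibp (μ := (volume : Measure (En n))) v (f := fun y => p (x - y)) (g := g)
    (hp.comp (contDiff_const.sub contDiff_id)) hgc hgs
  have e2 : ∀ y, dLine v (fun y => p (x - y)) y = - fderiv ℝ p (x - y) v := by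
    intro y
    have h3 : HasFDerivAt (fun y => p (x - y)) ((fderiv ℝ p (x - y)).comp (-(ContinuousLinearMap.id ℝ (En n)))) y :=
      ((hp.differentiable (by simp) (x - y)).hasFDerivAt).comp y ((hasFDerivAt_id y).const_sub x)
    unfold dLine
    rw [h3.fderiv]
    simp
  simp only [e2, neg_mul, integral_neg, neg_neg] at this
  unfold dLine at this
  simp_rw [mul_comm _ (p _)]
  rw [this]
  unfold UU
  refine integral_congr_ae (Filter.Eventually.of_forall fun y => ?_)
  simp only [hg, neg_mul]
  ring

lemma UU_dLine_iter (v : En n) (m : ℕ) {p f : En n → ℂ} (hp : ContDiff ℝ ∞ p) (hf : ContDiff ℝ ∞ f)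
    (hs : HasCompactSupport f) (ξ x : En n) :
    (dLine v)^[m] (fun x => UU p f x ξ) x = UU ((dLine v)^[m] p) f x ξ := by
  induction m generalizing p with
  | zero => rfl
  | succ k ih =>
    simp only [Function.iterate_succ_apply]
    rw [← ih (dLine_contDiff v hp)]
    exact congrFun (congrArg ((dLine _)^[k]) (funext fun y => UU_dLine v hp hf hs ξ y)) _

lemma UU_one (w : En n → ℂ) (x y ξ : En n) : UU 1 w x ξ = UU 1 w y ξ := rfl

attribute [irreducible] UU

end UUsec


open scoped ContDiff

set_option linter.unusedSectionVars false

section onestep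
variable {n : ℕ}

/-- The differential operators dual to the weights `qj`. -/
def DD (s : ℕ) : Option (Fin n) → (En n → ℂ) → En n → ℂ
  | none, b => b
  | some j, b => fun ξ => I ^ s * (dLine (ev j))^[s] b ξ

lemma J_iter (z : En n) (j : Fin n) (m : ℕ) {b : En n → ℂ} (hb : ContDiff ℝ ∞ b) (hs : HasCompactSupport b) :
    ∫ ξ, Complex.exp (I * ((⟪z, ξ⟫ : ℝ) : ℂ)) * (I ^ m * (dLine (ev j))^[m] b ξ) =
      ((z j : ℝ) : ℂ) ^ m * ∫ ξ, Complex.exp (I * ((⟪z, ξ⟫ : ℝ) : ℂ)) * b ξ := by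
  induction m generalizing b with
  | zero => simp
  | succ k ih =>
    have h1 := ih (dLine_contDiff (ev j) hb) (hcs_dLine_iter (ev j) 1 hs)
    have hp : ContDiff ℝ ∞ (fun ξ : En n => (⟪z, ξ⟫ : ℝ)) := contDiff_const.inner ℝ contDiff_id
    have h2 := ibp (μ := (volume : Measure (En n))) (ev j)
      (f := fun ξ => Complex.exp (I * ((⟪z, ξ⟫ : ℝ) : ℂ))) (g := b)
      (ContDiff.cexp (contDiff_const.mul (Complex.ofRealCLM.contDiff.comp hp))) hb hs
    have h3 : ∀ ξ, dLine (ev j) (fun ξ : En n => (⟪z, ξ⟫ : ℝ)) ξ = z j := by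
      intro ξ
      have h4 : HasFDerivAt (fun ξ : En n => (⟪z, ξ⟫ : ℝ)) (innerSL ℝ z) ξ := (innerSL ℝ z).hasFDerivAt
      unfold dLine
      rw [h4.fderiv]
      simp [EuclideanSpace.inner_single_right]
    simp only [dLine_exp _ _ hp, h3] at h2
    have h5 : ∀ ξ, Complex.exp (I * ((⟪z, ξ⟫ : ℝ) : ℂ)) * (I ^ (k+1) * (dLine (ev j))^[k+1] b ξ) =
      I * (Complex.exp (I * ((⟪z, ξ⟫ : ℝ) : ℂ)) * (I ^ k * (dLine (ev j))^[k] (dLine (ev j) b) ξ)) := by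
      intro ξ
      simp only [Function.iterate_succ_apply]
      ring
    simp_rw [h5]
    rw [integral_const_mul, h1, h2]
    simp_rw [mul_assoc]
    rw [integral_const_mul, integral_const_mul]
    have hI := Complex.I_mul_I
    linear_combination (-((z j : ℝ) : ℂ) ^ (k+1) * ∫ ξ, Complex.exp (I * ((⟪z, ξ⟫ : ℝ) : ℂ)) * b ξ) * hI

lemma UU_fubini (x : En n) {p f b : En n → ℂ} (hp : Continuous p) (hf : Continuous f) (hfs : HasCompactSupport f)
    (hb : Continuous b) (hbs : HasCompactSupport b) :
    Integrable (fun y => (p (x - y) * f y) * ∫ ξ, Complex.exp (I * ((⟪x - y, ξ⟫ : ℝ) : ℂ)) * b ξ) ∧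
    ∫ ξ, Complex.exp (I * ((⟪x, ξ⟫ : ℝ) : ℂ)) * (UU p f x ξ * b ξ) =
      ∫ y, (p (x - y) * f y) * ∫ ξ, Complex.exp (I * ((⟪x - y, ξ⟫ : ℝ) : ℂ)) * b ξ := by
  set h : En n × En n → ℂ := fun w => (p (x - w.1) * f w.1) * (Complex.exp (I * ((⟪x - w.1, w.2⟫ : ℝ) : ℂ)) * b w.2) with hh
  have hi : Integrable h (volume.prod volume) := by
    refine Continuous.integrable_of_hasCompactSupport (by fun_prop) ?_
    refine HasCompactSupport.intro (hfs.prod hbs) fun w hw => ?_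
    simp only [Set.mem_prod, not_and_or] at hw
    rcases hw with hw | hw
    · simp [hh, image_eq_zero_of_notMem_tsupport hw]
    · simp [hh, image_eq_zero_of_notMem_tsupport hw]
  have e1 : ∀ y, (p (x - y) * f y) * ∫ ξ, Complex.exp (I * ((⟪x - y, ξ⟫ : ℝ) : ℂ)) * b ξ = ∫ ξ, h (y, ξ) := by
    intro y
    rw [← integral_const_mul]
  simp_rw [e1]
  refine ⟨hi.integral_prod_left, ?_⟩
  rw [integral_integral_swap hi]
  refine integral_congr_ae (Filter.Eventually.of_forall fun ξ => ?_)
  simp only [UU]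
  rw [← integral_mul_const, ← integral_const_mul]
  refine integral_congr_ae (Filter.Eventually.of_forall fun y => ?_)
  simp only [hh, inner_sub_left]
  have : I * ((⟪x, ξ⟫ - ⟪y, ξ⟫ : ℝ) : ℂ) = I * ((⟪x, ξ⟫ : ℝ) : ℂ) + -(I * ((⟪y, ξ⟫ : ℝ) : ℂ)) := by
    push_cast; ring
  rw [this, Complex.exp_add]
  ring

lemma DD_contDiff (s : ℕ) (j : Option (Fin n)) {b : En n → ℂ} (hb : ContDiff ℝ ∞ b) : ContDiff ℝ ∞ (DD s j b) := by
  cases j with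
  | none => exact hb
  | some j => exact contDiff_const.mul (dLine_iter_contDiff _ _ hb)

lemma DD_hcs (s : ℕ) (j : Option (Fin n)) {b : En n → ℂ} (hb : HasCompactSupport b) : HasCompactSupport (DD s j b) := by
  cases j with
  | none => exact hb
  | some j => exact (hcs_dLine_iter _ _ hb).mul_left

lemma onestep (s : ℕ) (x : En n) {f b : En n → ℂ} (hf : ContDiff ℝ ∞ f) (hfs : HasCompactSupport f)
    (hb : ContDiff ℝ ∞ b) (hbs : HasCompactSupport b) :
    ∫ ξ, Complex.exp (I * ((⟪x, ξ⟫ : ℝ) : ℂ)) * (UU 1 f x ξ * b ξ) =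
      ∑ j : Option (Fin n), ∫ ξ, Complex.exp (I * ((⟪x, ξ⟫ : ℝ) : ℂ)) * (UU (qj s j) f x ξ * DD s j b ξ) := by
  have h1 := (UU_fubini x (p := 1) continuous_one hf.continuous hfs hb.continuous hbs).2
  have h2 := fun j => UU_fubini x (qj_contDiff (n := n) s j).continuous hf.continuous hfs
    (DD_contDiff s j hb).continuous (DD_hcs s j hbs)
  rw [h1]
  simp_rw [fun j => (h2 j).2]
  rw [← integral_finsetSum _ fun j _ => (h2 j).1]
  refine integral_congr_ae (Filter.Eventually.of_forall fun y => ?_)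
  simp only [Fintype.sum_option, DD, J_iter _ _ _ hb hbs, Pi.one_apply]
  rw [← qj_sum s (x - y)]
  simp only [add_mul, Finset.sum_mul]
  congr 1
  refine Finset.sum_congr rfl fun j _ => ?_
  ring

end onestep


open scoped ContDiff

set_option linter.unusedSectionVars false

section bilin
variable {n : ℕ}

/-- The `L²` norm as an extended nonnegative number. -/
def N2 (f : En n → ℂ) : ℝ≥0∞ := (∫⁻ x, ‖f x‖ₑ ^ 2) ^ (1 / 2 : ℝ)

lemma N2_eq (f : En n → ℂ) : N2 f = eLpNorm f 2 volume := by
  rw [eLpNorm_eq_lintegral_rpow_enorm_toReal (by simp) (by simp)]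
  simp [N2]

lemma cs_prod {F G : En n × En n → ℝ≥0∞} (hF : Measurable F) (hG : Measurable G) :
    ∫⁻ x, ∫⁻ y, F (x, y) * G (x, y) ≤
      (∫⁻ x, ∫⁻ y, F (x, y) ^ 2) ^ (1 / 2 : ℝ) * (∫⁻ x, ∫⁻ y, G (x, y) ^ 2) ^ (1 / 2 : ℝ) := by
  have h := ENNReal.lintegral_mul_le_Lp_mul_Lq ((volume : Measure (En n)).prod volume)
    Real.HolderConjugate.two_two hF.aemeasurable hG.aemeasurable
  simp only [ENNReal.rpow_two, Pi.mul_apply] at h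
  rw [lintegral_prod (fun z => F z * G z) (hF.mul hG).aemeasurable, lintegral_prod _ (hF.pow_const 2).aemeasurable,
    lintegral_prod _ (hG.pow_const 2).aemeasurable] at h
  exact h

lemma UU_ms {p f : En n → ℂ} (hp : Continuous p) (hf : Continuous f) :
    Measurable (fun z : En n × En n => ‖UU p f z.1 z.2‖ₑ) := (UU_meas hp hf).measurable.enorm

lemma UU_ms' {p f : En n → ℂ} (hp : Continuous p) (hf : Continuous f) :
    Measurable (fun z : En n × En n => ‖UU p f z.2 z.1‖ₑ) := by
  have h := UU_ms hp hf
  generalize UU p f = g at *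
  exact h.comp measurable_swap

lemma UU_cs {p q f w : En n → ℂ} (hp : ContDiff ℝ ∞ p) (hq : ContDiff ℝ ∞ q)
    (hf : ContDiff ℝ ∞ f) (hfs : HasCompactSupport f) (hw : ContDiff ℝ ∞ w) (hws : HasCompactSupport w) :
    ∫⁻ ξ, ∫⁻ x, ‖UU q w ξ x‖ₑ * ‖UU p f x ξ‖ₑ ≤
      ENNReal.ofReal ((2 * π) ^ n) * (N2 q * N2 p) * (N2 f * N2 w) := by
  have h := cs_prod (UU_ms hq.continuous hw.continuous) (UU_ms' hp.continuous hf.continuous)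
  have m3 := (UU_ms' hp.continuous hf.continuous).pow_const 2
  have h1 := UU_l2 hp hf hfs
  have h2 := UU_l2 hq hw hws
  generalize UU p f = g1 at *
  generalize UU q w = g2 at *
  simp only [] at h
  rw [lintegral_lintegral_swap (f := fun x y => ‖g1 y x‖ₑ ^ 2) m3.aemeasurable, h1, h2] at h
  refine h.trans (le_of_eq ?_)
  rw [← ENNReal.mul_rpow_of_nonneg _ _ (by norm_num)]
  unfold N2
  simp only [← ENNReal.mul_rpow_of_nonneg _ _ (show (0:ℝ) ≤ 1 / 2 by norm_num)]
  set c := ENNReal.ofReal ((2 * π) ^ n)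
  have hc : c = (c * c) ^ (1 / 2 : ℝ) := by
    rw [← sq, ← ENNReal.rpow_two, ← ENNReal.rpow_mul]; simp
  conv_rhs => rw [hc]
  simp only [← ENNReal.mul_rpow_of_nonneg _ _ (show (0:ℝ) ≤ 1 / 2 by norm_num)]
  congr 1
  ring

/-- Second-variable derivatives of the amplitude. -/
def DYs (s : ℕ) : Option (Fin n) → (En n × En n → ℂ) → En n × En n → ℂ
  | none, a => a
  | some j, a => fun z => I ^ s * (dLine (dY j))^[s] a z

/-- The amplitude bounds used in the argument. -/
def AB (s : ℕ) (A : ℝ) (a : En n × En n → ℂ) : Prop :=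
  ∀ j z, ‖DYs s j a z‖ ≤ A ∧ ∀ k, ∀ m ≤ s, ‖(dLine (dX k))^[m] (DYs s j a) z‖ ≤ A

/-- Derivatives of the weights. -/
def PP (s : ℕ) : Option (Fin n) → ℕ → Option (Fin n) → En n → ℂ
  | none, _, j => qj s j
  | some k, m, j => (dLine (ev k))^[m] (qj s j)

lemma PP_contDiff (s : ℕ) (k : Option (Fin n)) (m : ℕ) (j : Option (Fin n)) : ContDiff ℝ ∞ (PP s k m j) := by
  cases k with
  | none => exact qj_contDiff s j
  | some k => exact dLine_iter_contDiff _ _ (qj_contDiff s j)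

lemma PP_N2 {s : ℕ} (hs : n < 2 * s) (k : Option (Fin n)) (m : ℕ) (j : Option (Fin n)) : N2 (PP s k m j) ≠ ⊤ := by
  rw [N2_eq]
  cases k with
  | none => exact (qj_memLp0 n hs j).2.ne
  | some k => exact (qj_memLp n hs k j m).2.ne

lemma DYs_contDiff (s : ℕ) (j : Option (Fin n)) {a : En n × En n → ℂ} (ha : ContDiff ℝ ∞ a) :
    ContDiff ℝ ∞ (DYs s j a) := by
  cases j with
  | none => exact ha
  | some j => exact contDiff_const.mul (dLine_iter_contDiff _ _ ha)

lemma DYs_hcs (s : ℕ) (j : Option (Fin n)) {a : En n × En n → ℂ} (ha : HasCompactSupport a) :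
    HasCompactSupport (DYs s j a) := by
  cases j with
  | none => exact ha
  | some j => exact (hcs_dLine_iter _ _ ha).mul_left

lemma hcs_snd {a : En n × En n → ℂ} (ha : HasCompactSupport a) (x : En n) :
    HasCompactSupport (fun ξ => a (x, ξ)) := by
  refine HasCompactSupport.intro (ha.isCompact.image continuous_snd) fun ξ hξ => ?_
  by_contra h
  exact hξ ⟨(x, ξ), subset_tsupport _ h, rfl⟩

lemma hcs_fst {a : En n × En n → ℂ} (ha : HasCompactSupport a) (ξ : En n) :
    HasCompactSupport (fun x => a (x, ξ)) := by
  refine HasCompactSupport.intro (ha.isCompact.image continuous_fst) fun x hx => ?_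
  by_contra h
  exact hx ⟨(x, ξ), subset_tsupport _ h, rfl⟩

lemma DD_slice (s : ℕ) (j : Option (Fin n)) {a : En n × En n → ℂ} (ha : ContDiff ℝ ∞ a) (x ξ : En n) :
    DD s j (fun ξ => a (x, ξ)) ξ = DYs s j a (x, ξ) := by
  cases j with
  | none => rfl
  | some j =>
    simp only [DD, DYs]
    rw [dLine_snd _ _ ha]
    rfl

lemma qj_bdd (s : ℕ) (j : Option (Fin n)) : ∃ M, ∀ z, ‖qj (n := n) s j z‖ ≤ M := by
  refine ⟨1, fun z => ?_⟩
  have hQ := Qw_one s z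
  cases j with
  | none => simp [qj, abs_of_pos (lt_of_lt_of_le one_pos hQ)]; exact inv_le_one_of_one_le₀ hQ
  | some j =>
    have h1 := Qw_ge s z j
    simp [qj, abs_of_pos (lt_of_lt_of_le one_pos hQ)]
    rw [← div_eq_mul_inv, div_le_one (by linarith)]
    have := pow_le_one_add (abs_nonneg (z j)) (show s ≤ 2 * s by omega)
    linarith

lemma DD_prod_bound {s : ℕ} {A : ℝ} {a : En n × En n → ℂ} (ha : ContDiff ℝ ∞ a) (hAB : AB s A a)
    {f : En n → ℂ} (hf : ContDiff ℝ ∞ f) (hfs : HasCompactSupport f) (j k : Option (Fin n)) (x ξ : En n) :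
    ‖DD s k (fun x => UU (qj s j) f x ξ * DYs s j a (x, ξ)) x‖ₑ ≤
      ENNReal.ofReal A * ∑ m ∈ Finset.range (s + 1), (s.choose m : ℝ≥0∞) * ‖UU (PP s k m j) f x ξ‖ₑ := by
  have hb : ∀ c : ℂ, ‖c‖ ≤ A → ‖c‖ₑ ≤ ENNReal.ofReal A := by
    intro c hc
    rw [← ofReal_norm]
    exact ENNReal.ofReal_le_ofReal hc
  cases k with
  | none =>
    simp only [DD, PP]
    rw [enorm_mul, mul_comm]
    refine mul_le_mul' (hb _ (hAB j _).1) ?_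
    have := Finset.single_le_sum (f := fun m => (s.choose m : ℝ≥0∞) * ‖UU (qj s j) f x ξ‖ₑ)
      (fun _ _ => bot_le) (Finset.mem_range.2 (Nat.succ_pos s))
    simpa using this
  | some k =>
    simp only [DD, PP]
    have hsl : ContDiff ℝ ∞ (fun x => DYs s j a (x, ξ)) :=
      (DYs_contDiff s j ha).comp (contDiff_id.prodMk contDiff_const)
    rw [leibniz isOpen_univ (ev k) s (UU_smooth (qj_contDiff s j).continuous hf hfs ξ).contDiffOn
      hsl.contDiffOn (Set.mem_univ x),
      Finset.Nat.sum_antidiagonal_eq_sum_range_succ_mk]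
    rw [enorm_mul]
    have : ‖I ^ s‖ₑ = 1 := by rw [← ofReal_norm]; simp
    rw [this, one_mul, Finset.mul_sum]
    refine (enorm_sum_le _ _).trans (Finset.sum_le_sum fun m hm => ?_)
    rw [UU_dLine_iter _ _ (qj_contDiff s j) hf hfs, enorm_mul, enorm_mul]
    have e : (dLine (ev k))^[s - m] (fun x => DYs s j a (x, ξ)) x = (dLine (dX k))^[s-m] (DYs s j a) (x, ξ) :=
      dLine_fst _ _ (DYs_contDiff s j ha) x ξ
    have h3 := hb _ ((hAB j (x, ξ)).2 k (s - m) (Nat.sub_le _ _))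
    rw [← e] at h3
    have h4 : ‖((s.choose m : ℕ) : ℂ)‖ₑ = (s.choose m : ℝ≥0∞) := by
      rw [← ofReal_norm]; simp
    rw [h4]
    calc _ ≤ (s.choose m : ℝ≥0∞) * (‖UU ((dLine (ev k))^[m] (qj s j)) f x ξ‖ₑ * ENNReal.ofReal A) := by
          gcongr
      _ = _ := by ring

/-- The constant. -/
def Cst (n s : ℕ) : ℝ≥0∞ := ∑ j : Option (Fin n), ∑ k : Option (Fin n), ∑ m ∈ Finset.range (s + 1),
  (s.choose m : ℝ≥0∞) * (ENNReal.ofReal ((2 * π) ^ n) * (N2 (qj (n := n) s k) * N2 (PP s k m j)))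

lemma Cst_ne {s : ℕ} (hs : n < 2 * s) : Cst n s ≠ ⊤ := by
  unfold Cst
  refine ENNReal.sum_ne_top.2 fun j _ => ENNReal.sum_ne_top.2 fun k _ => ENNReal.sum_ne_top.2 fun m _ => ?_
  have h1 := PP_N2 hs k m j
  have h2 := PP_N2 hs none m k
  refine ENNReal.mul_ne_top (by simp) (ENNReal.mul_ne_top (by simp) (ENNReal.mul_ne_top h2 h1))

lemma bilin {s : ℕ} {A : ℝ} {a : En n × En n → ℂ} (ha : ContDiff ℝ ∞ a)
    (has : HasCompactSupport a) (hAB : AB s A a)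
    {f w : En n → ℂ} (hf : ContDiff ℝ ∞ f) (hfs : HasCompactSupport f) (hw : ContDiff ℝ ∞ w) (hws : HasCompactSupport w) :
    ‖∫ x, UU 1 w 0 x * ∫ ξ, Complex.exp (I * ((⟪x, ξ⟫ : ℝ) : ℂ)) * (UU 1 f 0 ξ * a (x, ξ))‖ₑ ≤
      ENNReal.ofReal A * Cst n s * (N2 f * N2 w) := by
  set H : Option (Fin n) → En n × En n → ℂ := fun j z =>
    UU 1 w 0 z.1 * (Complex.exp (I * ((⟪z.1, z.2⟫ : ℝ) : ℂ)) * (UU (qj s j) f z.1 z.2 * DYs s j a z)) with hH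
  have hHi : ∀ j, Integrable (H j) (volume.prod volume) := by
    intro j
    obtain ⟨M, hM⟩ := qj_bdd (n := n) s j
    have h1 : Integrable (DYs s j a) (volume.prod volume) :=
      (DYs_contDiff s j ha).continuous.integrable_of_hasCompactSupport (DYs_hcs s j has)
    have m1 : StronglyMeasurable (fun z : En n × En n => UU 1 w 0 z.1) := by
      have := (UU_meas (p := 1) continuous_one hw.continuous).comp_measurable
        (measurable_const.prodMk measurable_fst : Measurable (fun z : En n × En n => ((0 : En n), z.1)))
      exact this
    have m2 := UU_meas (qj_contDiff (n := n) s j).continuous hf.continuous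
    have m3 : Continuous (fun z : En n × En n => Complex.exp (I * ((⟪z.1, z.2⟫ : ℝ) : ℂ))) := by fun_prop
    refine Integrable.bdd_mul (c := 1 * ∫ y, ‖w y‖) ?_ m1.aestronglyMeasurable
      (Filter.Eventually.of_forall fun z => UU_bdd (by simp) hw.continuous hws _ _)
    refine Integrable.bdd_mul (c := 1) ?_ m3.aestronglyMeasurable
      (Filter.Eventually.of_forall fun z => (norm_exp_I_real _).le)
    exact h1.bdd_mul m2.aestronglyMeasurable
      (Filter.Eventually.of_forall fun z => UU_bdd hM hf.continuous hfs _ _)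
  have e1 : ∀ x, UU 1 w 0 x * ∫ ξ, Complex.exp (I * ((⟪x, ξ⟫ : ℝ) : ℂ)) * (UU 1 f 0 ξ * a (x, ξ)) =
      ∑ j, ∫ ξ, H j (x, ξ) := by
    intro x
    have h := onestep s x hf hfs (b := fun ξ => a (x, ξ)) (ha.comp (contDiff_const.prodMk contDiff_id)) (hcs_snd has x)
    simp_rw [UU_one f x 0] at h
    rw [h, Finset.mul_sum]
    refine Finset.sum_congr rfl fun j _ => ?_
    rw [← integral_const_mul]
    simp only [hH, DD_slice s j ha]
  simp_rw [e1]
  rw [integral_finsetSum _ fun j _ => (hHi j).integral_prod_left]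
  refine (enorm_sum_le _ _).trans ?_
  unfold Cst
  rw [Finset.mul_sum, Finset.sum_mul]
  refine Finset.sum_le_sum fun j _ => ?_
  rw [integral_integral_swap (hHi j)]
  have e2 : ∀ ξ, ∫ x, H j (x, ξ) = ∑ k, ∫ x, Complex.exp (I * ((⟪ξ, x⟫ : ℝ) : ℂ)) *
      (UU (qj s k) w ξ x * DD s k (fun x => UU (qj s j) f x ξ * DYs s j a (x, ξ)) x) := by
    intro ξ
    rw [← onestep s ξ hw hws]
    · refine integral_congr_ae (Filter.Eventually.of_forall fun x => ?_)
      simp only [hH, real_inner_comm ξ x]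
      have : UU 1 w 0 x = UU 1 w ξ x := UU_one _ _ _ _
      rw [this]
      ring
    · exact (UU_smooth (qj_contDiff s j).continuous hf hfs ξ).mul
        ((DYs_contDiff s j ha).comp (contDiff_id.prodMk contDiff_const))
    · exact (hcs_fst (DYs_hcs s j has) ξ).mul_left
  simp_rw [e2]
  refine (enorm_integral_le_lintegral_enorm _).trans ?_
  have mU : ∀ k m, Measurable (fun z : En n × En n =>
      ‖UU (qj s k) w z.1 z.2‖ₑ * ‖UU (PP s k m j) f z.2 z.1‖ₑ) := by
    intro k m
    have m1 := UU_ms (qj_contDiff s k).continuous hw.continuous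
    have m2 := UU_ms' (PP_contDiff s k m j).continuous hf.continuous
    exact m1.mul m2
  have e3 : ∀ ξ, ‖∑ k, ∫ x, Complex.exp (I * ((⟪ξ, x⟫ : ℝ) : ℂ)) *
      (UU (qj s k) w ξ x * DD s k (fun x => UU (qj s j) f x ξ * DYs s j a (x, ξ)) x)‖ₑ ≤
      ENNReal.ofReal A * ∑ k, ∑ m ∈ Finset.range (s + 1), (s.choose m : ℝ≥0∞) *
        ∫⁻ x, ‖UU (qj s k) w ξ x‖ₑ * ‖UU (PP s k m j) f x ξ‖ₑ := by
    intro ξ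
    refine (enorm_sum_le _ _).trans ?_
    rw [Finset.mul_sum]
    refine Finset.sum_le_sum fun k _ => ?_
    refine (enorm_integral_le_lintegral_enorm _).trans ?_
    have mm : ∀ m, Measurable fun x => ‖UU (qj s k) w ξ x‖ₑ * ‖UU (PP s k m j) f x ξ‖ₑ :=
      fun m => (mU k m).comp measurable_prodMk_left
    calc _ ≤ ∫⁻ x, ENNReal.ofReal A * ∑ m ∈ Finset.range (s + 1), (s.choose m : ℝ≥0∞) *
          (‖UU (qj s k) w ξ x‖ₑ * ‖UU (PP s k m j) f x ξ‖ₑ) := by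
          refine lintegral_mono fun x => ?_
          have h1 : ‖Complex.exp (I * ((⟪ξ, x⟫ : ℝ) : ℂ))‖ₑ = 1 := by
            rw [← ofReal_norm, norm_exp_I_real]; simp
          simp only []
          rw [enorm_mul, enorm_mul, h1, one_mul]
          refine (mul_le_mul_right (DD_prod_bound ha hAB hf hfs j k x ξ) _).trans (le_of_eq ?_)
          rw [mul_left_comm, Finset.mul_sum]
          congr 1
          exact Finset.sum_congr rfl fun m _ => by ring
      _ = _ := by
          rw [lintegral_const_mul' _ _ ENNReal.ofReal_ne_top, lintegral_finsetSum]
          · congr 1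
            refine Finset.sum_congr rfl fun m _ => ?_
            rw [lintegral_const_mul' _ _ (by simp)]
          · exact fun m _ => (mm m).const_mul _
  refine (lintegral_mono e3).trans ?_
  rw [lintegral_const_mul' _ _ ENNReal.ofReal_ne_top, mul_assoc]
  refine mul_le_mul_right ?_ _
  have mI : ∀ k m, Measurable fun ξ => ∫⁻ x, ‖UU (qj s k) w ξ x‖ₑ * ‖UU (PP s k m j) f x ξ‖ₑ :=
    fun k m => (mU k m).lintegral_prod_right'
  rw [lintegral_finsetSum _ (fun k _ => Finset.measurable_fun_sum _ fun m _ => (mI k m).const_mul _), Finset.sum_mul]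
  refine Finset.sum_le_sum fun k _ => ?_
  rw [lintegral_finsetSum _ (fun m _ => (mI k m).const_mul _), Finset.sum_mul]
  refine Finset.sum_le_sum fun m _ => ?_
  rw [lintegral_const_mul' _ _ (by simp), mul_assoc]
  refine mul_le_mul_right ?_ _
  exact UU_cs (PP_contDiff s k m j) (qj_contDiff s k) hf hfs hw hws

end bilin


open scoped ContDiff

set_option linter.unusedSectionVars false

section density
variable {n : ℕ}
open scoped FourierTransform

lemma UU_one_eq (f : En n → ℂ) (ξ : En n) :
    UU 1 f 0 ξ = ∫ y, Complex.exp (-(I * ((⟪y, ξ⟫ : ℝ) : ℂ))) * f y := by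
  simp [UU]

lemma fourier_eq_UU (f : En n → ℂ) (ξ : En n) :
    𝓕 f ξ = UU 1 (fun y => ((((2 * π) ^ n)⁻¹ : ℝ) : ℂ) * f ((2 * π)⁻¹ • y)) 0 ξ := by
  rw [UU_one_eq, Real.fourier_eq']
  have h := Measure.integral_comp_inv_smul (volume : Measure (En n))
    (fun v => Complex.exp (((-2 * π * ⟪v, ξ⟫ : ℝ) : ℂ) * I) • f v) (2 * π)
  rw [finrank_euclideanSpace, Fintype.card_fin, abs_of_pos (by positivity)] at h
  have hp : (0:ℝ) < (2 * π) ^ n := by positivity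
  have h2 : (∫ v, Complex.exp (((-2 * π * ⟪v, ξ⟫ : ℝ) : ℂ) * I) • f v) =
      ((2 * π) ^ n)⁻¹ • ((2 * π) ^ n) • ∫ v, Complex.exp (((-2 * π * ⟪v, ξ⟫ : ℝ) : ℂ) * I) • f v := by
    rw [smul_smul, inv_mul_cancel₀ hp.ne', one_smul]
  rw [h2, ← h, ← integral_smul]
  refine integral_congr_ae (Filter.Eventually.of_forall fun y => ?_)
  simp only [smul_eq_mul, Complex.real_smul, inner_smul_left]
  have e : ((-2 * π * ((starRingEnd ℝ) (2 * π)⁻¹ * ⟪y, ξ⟫) : ℝ) : ℂ) * I = -(I * ((⟪y, ξ⟫ : ℝ) : ℂ)) := by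
    have : (-2 * π * ((starRingEnd ℝ) (2 * π)⁻¹ * ⟪y, ξ⟫) : ℝ) = -⟪y, ξ⟫ := by
      have := Real.pi_pos.ne'
      simp only [conj_trivial]
      field_simp
    rw [this]; push_cast; ring
  rw [e]
  ring

lemma UU_conj (f : En n → ℂ) (ξ : En n) :
    (starRingEnd ℂ) (UU 1 f 0 ξ) = UU 1 (fun y => (starRingEnd ℂ) (f (-y))) 0 ξ := by
  rw [UU_one_eq, UU_one_eq, ← integral_conj, ← integral_neg_eq_self]
  refine integral_congr_ae (Filter.Eventually.of_forall fun y => ?_)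
  simp only [map_mul, ← Complex.exp_conj, map_neg, Complex.conj_I, Complex.conj_ofReal, inner_neg_left]
  congr 2
  push_cast; ring

/-- Test functions on the Fourier side. -/
def TD (n : ℕ) : Set (Lp (α := En n) ℂ 2) :=
  {g | ∃ f : En n → ℂ, ContDiff ℝ ∞ f ∧ HasCompactSupport f ∧ g =ᵐ[volume] UU 1 f 0}

lemma TD_dense (n : ℕ) : Dense (TD n) := by
  have h0 := Lp.dense_hasCompactSupport_contDiff (E := En n) (F := ℂ) (μ := volume) (p := 2) (by simp)
  have h1 := (Lp.fourierTransformₗᵢ (En n) ℂ).surjective.denseRange.dense_image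
    (Lp.fourierTransformₗᵢ (En n) ℂ).continuous h0
  refine h1.mono ?_
  rintro _ ⟨g, ⟨f, hgf, hfs, hf⟩, rfl⟩
  refine ⟨fun y => ((((2 * π) ^ n)⁻¹ : ℝ) : ℂ) * f ((2 * π)⁻¹ • y), ?_, ?_, ?_⟩
  · exact contDiff_const.mul (hf.comp (contDiff_const_smul _))
  · refine HasCompactSupport.mul_left (f' := fun y : En n => f ((2 * π)⁻¹ • y)) ?_
    exact hfs.comp_smul (by positivity)
  · have e1 : g = (hfs.toSchwartzMap hf).toLp 2 volume := by
      refine Lp.ext ?_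
      filter_upwards [hgf, (hfs.toSchwartzMap hf).coeFn_toLp 2 volume] with x h2 h3
      rw [h2, h3]; rfl
    have e2 : Lp.fourierTransformₗᵢ (En n) ℂ g = (𝓕 (hfs.toSchwartzMap hf)).toLp 2 volume := by
      rw [e1]
      exact SchwartzMap.toLp_fourier_eq _
    rw [e2]
    filter_upwards [(𝓕 (hfs.toSchwartzMap hf)).coeFn_toLp 2 volume] with x h3
    rw [h3, SchwartzMap.fourier_coe]
    exact fourier_eq_UU f x

lemma UU_N2 {f : En n → ℂ} (hf : ContDiff ℝ ∞ f) (hfs : HasCompactSupport f) : N2 f ≤ N2 (UU 1 f 0) := by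
  unfold N2
  refine ENNReal.rpow_le_rpow ?_ (by norm_num)
  simp_rw [UU_one_eq]
  rw [planch hf hfs]
  refine le_mul_of_one_le_left bot_le ?_
  rw [ENNReal.one_le_ofReal]
  exact one_le_pow₀ (by linarith [Real.pi_gt_three])

lemma hwang_cpt {s : ℕ} (hs : n < 2 * s) {A : ℝ} (hA : 0 ≤ A) {a : En n × En n → ℂ} (ha : ContDiff ℝ ∞ a)
    (has : HasCompactSupport a) (hAB : AB s A a) {F : En n → ℂ} (hF : MemLp F 2 volume) :
    eLpNorm (fun x => ∫ ξ, Complex.exp (I * ((⟪x, ξ⟫ : ℝ) : ℂ)) * a (x, ξ) * F ξ) 2 volume ≤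
      ENNReal.ofReal (A * (Cst n s).toReal) * eLpNorm F 2 volume := by
  set S := Set.image Prod.fst (tsupport a)
  set S' := Set.image Prod.snd (tsupport a)
  have hSc : IsCompact S := has.isCompact.image continuous_fst
  have hSc' : IsCompact S' := has.isCompact.image continuous_snd
  have hk : Ker volume (fun x ξ => Complex.exp (I * ((⟪x, ξ⟫ : ℝ) : ℂ)) * a (x, ξ)) S S'
      ((volume S).toReal + (volume S').toReal) A := by
    refine ⟨?_, hSc.measurableSet, hSc'.measurableSet, ?_, ?_, by positivity, hA, ?_, ?_⟩
    · have hac := ha.continuous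
      have : Continuous (fun z : En n × En n => Complex.exp (I * ((⟪z.1, z.2⟫ : ℝ) : ℂ)) * a z) := by fun_prop
      exact this.stronglyMeasurable
    · refine (ENNReal.ofReal_toReal hSc.measure_lt_top.ne).symm.le.trans ?_
      exact ENNReal.ofReal_le_ofReal (le_add_of_nonneg_right ENNReal.toReal_nonneg)
    · refine (ENNReal.ofReal_toReal hSc'.measure_lt_top.ne).symm.le.trans ?_
      exact ENNReal.ofReal_le_ofReal (le_add_of_nonneg_left ENNReal.toReal_nonneg)
    · intro x ξ h
      have : a (x, ξ) = 0 := by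
        by_contra h'
        exact h ⟨⟨_, subset_tsupport _ h', rfl⟩, ⟨_, subset_tsupport _ h', rfl⟩⟩
      rw [this, mul_zero]
    · intro x ξ
      rw [norm_mul, norm_exp_I_real, one_mul]
      exact (hAB none _).1
  set c : ℝ := A * (Cst n s).toReal with hc
  have hc0 : 0 ≤ c := by positivity
  have hmain : ∀ G F : Lp (α := En n) ℂ 2, ‖inner ℂ G (hk.op F)‖ ≤ c * (‖F‖ * ‖G‖) := by
    refine isClosed_property2 (e := fun g : TD n => g.1) (TD_dense n).denseRange_val ?_ ?_
    · refine isClosed_le ?_ ?_ <;> fun_prop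
    · rintro ⟨G, w, hw, hws, hG⟩ ⟨F, f, hf, hfs, hF⟩
      simp only []
      have e1 : inner ℂ G (hk.op F) = ∫ x, UU 1 (fun y => (starRingEnd ℂ) (w (-y))) 0 x *
          ∫ ξ, Complex.exp (I * ((⟪x, ξ⟫ : ℝ) : ℂ)) * (UU 1 f 0 ξ * a (x, ξ)) := by
        rw [L2.inner_def]
        refine integral_congr_ae ?_
        filter_upwards [hG, hk.op_coe F] with x h1 h2
        rw [h1, h2, RCLike.inner_apply, UU_conj, mul_comm]
        congr 1
        refine integral_congr_ae ?_
        filter_upwards [hF] with ξ h3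
        rw [h3]; ring
      have hw' : ContDiff ℝ ∞ (fun y => (starRingEnd ℂ) (w (-y))) :=
        (Complex.conjCLE.contDiff).comp (hw.comp contDiff_neg)
      have hws' : HasCompactSupport (fun y => (starRingEnd ℂ) (w (-y))) :=
        (hws.comp_homeomorph (Homeomorph.neg (En n))).comp_left (g := starRingEnd ℂ) (map_zero _)
      have hb := bilin ha has hAB hf hfs hw' hws'
      rw [← e1] at hb
      have n1 : N2 (fun y => (starRingEnd ℂ) (w (-y))) ≤ N2 (UU 1 w 0) := by
        refine (UU_N2 hw' hws').trans (le_of_eq ?_)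
        unfold N2
        congr 1
        refine lintegral_congr fun x => ?_
        rw [← UU_conj, ← ofReal_norm, RCLike.norm_conj, ofReal_norm]
      have n2 : N2 (UU 1 w 0) = ‖G‖ₑ := by
        rw [N2_eq, Lp.enorm_def, eLpNorm_congr_ae hG]
      have n3 : N2 (UU 1 f 0) = ‖F‖ₑ := by
        rw [N2_eq, Lp.enorm_def, eLpNorm_congr_ae hF]
      have n4 := UU_N2 hf hfs
      rw [n2] at n1
      rw [n3] at n4
      have hb2 := hb.trans (mul_le_mul_right (mul_le_mul' n4 n1) _)
      have : ENNReal.ofReal A * Cst n s * (‖F‖ₑ * ‖G‖ₑ) = ENNReal.ofReal (c * (‖F‖ * ‖G‖)) := by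
        rw [ENNReal.ofReal_mul hc0, hc, ENNReal.ofReal_mul hA, ENNReal.ofReal_toReal (Cst_ne hs),
          ENNReal.ofReal_mul (norm_nonneg _), ofReal_norm, ofReal_norm]
      rw [this, ← ofReal_norm] at hb2
      exact (ENNReal.ofReal_le_ofReal_iff (by positivity)).1 hb2
  have hop : ‖hk.op (hF.toLp F)‖ ≤ c * ‖hF.toLp F‖ := by
    set y := hk.op (hF.toLp F)
    have h := hmain y (hF.toLp F)
    rw [inner_self_eq_norm_sq_to_K, norm_pow, RCLike.norm_ofReal, abs_of_nonneg (norm_nonneg _)] at h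
    rcases (norm_nonneg y).eq_or_lt with h0 | h0
    · rw [← h0]; positivity
    · refine le_of_mul_le_mul_right ?_ h0
      nlinarith
  have e2 : (fun x => ∫ ξ, Complex.exp (I * ((⟪x, ξ⟫ : ℝ) : ℂ)) * a (x, ξ) * F ξ) =ᵐ[volume] hk.op (hF.toLp F) := by
    filter_upwards [hk.op_coe (hF.toLp F)] with x h1
    rw [h1]
    refine integral_congr_ae ?_
    filter_upwards [hF.coeFn_toLp] with ξ h2
    rw [h2]
  rw [eLpNorm_congr_ae e2, ← Lp.enorm_def, ← ofReal_norm]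
  refine (ENNReal.ofReal_le_ofReal hop).trans (le_of_eq ?_)
  rw [ENNReal.ofReal_mul hc0, ofReal_norm, Lp.enorm_toLp]

end density


open scoped ContDiff

set_option linter.unusedSectionVars false

section cutoff
variable {n : ℕ}

lemma dLine_const_mul_iter {W : Type*} [NormedAddCommGroup W] [NormedSpace ℝ W] (v : W) (m : ℕ) (c : ℂ)
    {g : W → ℂ} (hg : ContDiff ℝ ∞ g) (x : W) :
    (dLine v)^[m] (fun x => c * g x) x = c * (dLine v)^[m] g x := by
  induction m generalizing g with
  | zero => rfl
  | succ k ih =>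
    simp only [Function.iterate_succ_apply]
    rw [← ih (dLine_contDiff v hg)]
    refine congrFun (congrArg ((dLine _)^[k]) (funext fun y => ?_)) _
    simp only [dLine]
    rw [((hg.differentiable (by simp) y).hasFDerivAt.const_mul c).fderiv]
    simp

lemma dLine_dil_iter (v : En n) (m : ℕ) (c : ℝ) {g : En n → ℂ} (hg : ContDiff ℝ ∞ g) (x : En n) :
    (dLine v)^[m] (fun x => g (c • x)) x = ((c : ℝ) : ℂ) ^ m * (dLine v)^[m] g (c • x) := by
  induction m generalizing g with
  | zero => simp
  | succ k ih =>
    simp only [Function.iterate_succ_apply]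
    have h1 : dLine v (fun x => g (c • x)) = fun x => (c : ℂ) * dLine v g (c • x) := by
      funext y
      have h3 : HasFDerivAt (fun y => g (c • y)) ((fderiv ℝ g (c • y)).comp (c • (ContinuousLinearMap.id ℝ (En n)))) y :=
        ((hg.differentiable (by simp) (c • y)).hasFDerivAt).comp y ((hasFDerivAt_id y).const_smul c)
      simp only [dLine]
      rw [h3.fderiv]
      simp
    have h2 : ContDiff ℝ ∞ (fun x => dLine v g (c • x)) := (dLine_contDiff v hg).comp (contDiff_const_smul c)
    rw [h1, dLine_const_mul_iter v k _ h2, ih (dLine_contDiff v hg)]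
    ring

lemma chi_dil (R : ℝ) (x : En n) : chi R x = chi 1 (R⁻¹ • x) := by
  simp only [chi]
  refine Finset.prod_congr rfl fun i _ => ?_
  simp [div_eq_inv_mul]

lemma chi_zero : chi (n := n) 1 0 = 1 := by
  simp [chi, bump1, Real.smoothTransition.one, Real.smoothTransition.zero]

lemma chi_bounds (n s : ℕ) : ∃ M : ℝ, 1 ≤ M ∧ ∀ R : ℝ, 1 ≤ R → ∀ k : Fin n, ∀ m ≤ s, ∀ x,
    ‖(dLine (ev k))^[m] (chi (n := n) R) x‖ ≤ M := by
  obtain ⟨M, hM0, hM⟩ := hcs_bounds (chi_contDiff (n := n) 1) (chi_hcs one_pos) s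
  refine ⟨M + 1, by linarith, fun R hR k m hm x => ?_⟩
  have e : (chi (n := n) R) = fun x => chi 1 (R⁻¹ • x) := funext fun x => chi_dil R x
  rw [e, dLine_dil_iter _ _ _ (chi_contDiff 1), norm_mul, norm_pow, Complex.norm_real, Real.norm_eq_abs,
    abs_of_pos (by positivity)]
  have h1 : (R⁻¹) ^ m ≤ 1 := pow_le_one₀ (by positivity) (inv_le_one_of_one_le₀ hR)
  have h2 := hM k m hm (R⁻¹ • x)
  nlinarith [norm_nonneg ((dLine (ev k))^[m] (chi (n := n) 1) (R⁻¹ • x))]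

lemma cutoff_AB (n s : ℕ) : ∃ M : ℝ, 1 ≤ M ∧ ∀ R : ℝ, 1 ≤ R → ∀ (a : En n × En n → ℂ) (A : ℝ), 0 ≤ A →
    ContDiff ℝ ∞ a → AB s A a → AB s (M * A) (fun z => chi R z.1 * a z) := by
  obtain ⟨M, hM1, hM⟩ := chi_bounds n s
  refine ⟨2 ^ s * M, ?_, fun R hR a A hA ha hAB => ?_⟩
  · exact one_le_mul_of_one_le_of_one_le (one_le_pow₀ (by norm_num)) hM1
  have h1 : (1:ℝ) ≤ 2 ^ s * M := one_le_mul_of_one_le_of_one_le (one_le_pow₀ (by norm_num)) hM1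
  have hcc : ContDiff ℝ ∞ (fun z : En n × En n => chi R z.1 * a z) :=
    ((chi_contDiff R).comp contDiff_fst).mul ha
  have e : ∀ j, DYs s j (fun z => chi R z.1 * a z) = fun z => chi R z.1 * DYs s j a z := by
    intro j
    funext ⟨x, ξ⟩
    rw [← DD_slice s j hcc, ← DD_slice s j ha]
    cases j with
    | none => rfl
    | some j =>
      simp only [DD]
      rw [dLine_const_mul_iter _ _ (chi R x) (g := fun ξ => a (x, ξ)) (ha.comp (contDiff_const.prodMk contDiff_id))]
      ring
  rintro j ⟨x, ξ⟩
  rw [e]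
  refine ⟨?_, fun k m hm => ?_⟩
  · rw [norm_mul]
    have h2 := chi_norm R x
    have h3 := (hAB j (x, ξ)).1
    calc _ ≤ 1 * A := mul_le_mul h2 h3 (norm_nonneg _) zero_le_one
      _ ≤ _ := mul_le_mul_of_nonneg_right h1 hA
  · have hd := DYs_contDiff s j ha
    have hsl : ContDiff ℝ ∞ (fun x => DYs s j a (x, ξ)) := hd.comp (contDiff_id.prodMk contDiff_const)
    have e2 : (dLine (ev k))^[m] (fun x => chi R x * DYs s j a (x, ξ)) x =
        (dLine (dX k))^[m] (fun z => chi R z.1 * DYs s j a z) (x, ξ) :=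
      dLine_fst (ev k) m (g := fun z => chi R z.1 * DYs s j a z) (((chi_contDiff R).comp contDiff_fst).mul hd) x ξ
    rw [← e2, leibniz isOpen_univ (ev k) m (chi_contDiff R).contDiffOn hsl.contDiffOn (Set.mem_univ x)]
    refine (norm_sum_le _ _).trans ?_
    calc _ ≤ ∑ ij ∈ Finset.HasAntidiagonal.antidiagonal m, (m.choose ij.1 : ℝ) * (M * A) := by
          refine Finset.sum_le_sum fun ij hij => ?_
          have hij' : ij.1 + ij.2 = m := by simpa using hij
          have e3 : (dLine (ev k))^[ij.2] (fun x => DYs s j a (x, ξ)) x =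
            (dLine (dX k))^[ij.2] (DYs s j a) (x, ξ) := dLine_fst (ev k) ij.2 hd x ξ
          rw [norm_mul, norm_mul, e3]
          have h4 := hM R hR k ij.1 (by omega) x
          have h5 := (hAB j (x, ξ)).2 k ij.2 (by omega)
          rw [show ‖((m.choose ij.1 : ℕ) : ℂ)‖ = (m.choose ij.1 : ℝ) by simp]
          gcongr
      _ = 2 ^ m * (M * A) := by
          rw [← Finset.sum_mul, Finset.Nat.sum_antidiagonal_eq_sum_range_succ_mk]
          congr 1
          have := Nat.sum_range_choose m
          exact_mod_cast this
      _ ≤ 2 ^ s * M * A := by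
          rw [← mul_assoc]
          gcongr
          norm_num

lemma hwang (n s : ℕ) (hs : n < 2 * s) : ∃ C : ℝ, 0 ≤ C ∧ ∀ (a : En n × En n → ℂ) (A : ℝ) (K : Set (En n)), 0 ≤ A →
    IsCompact K → ContDiff ℝ ∞ a → (∀ x ξ, ξ ∉ K → a (x, ξ) = 0) → AB s A a → ∀ F : En n → ℂ, MemLp F 2 volume →
    eLpNorm (fun x => ∫ ξ, Complex.exp (I * ((⟪x, ξ⟫ : ℝ) : ℂ)) * a (x, ξ) * F ξ) 2 volume ≤
      ENNReal.ofReal (C * A) * eLpNorm F 2 volume := by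
  obtain ⟨M, hM1, hM⟩ := cutoff_AB n s
  refine ⟨M * (Cst n s).toReal, by positivity, fun a A K hA hK ha haK hAB F hF => ?_⟩
  have key : ∀ R : ℕ, eLpNorm (fun x => chi ((R : ℝ) + 1) x *
      ∫ ξ, Complex.exp (I * ((⟪x, ξ⟫ : ℝ) : ℂ)) * a (x, ξ) * F ξ) 2 volume ≤
      ENNReal.ofReal (M * (Cst n s).toReal * A) * eLpNorm F 2 volume := by
    intro R
    have hR : (1:ℝ) ≤ (R : ℝ) + 1 := by linarith [Nat.cast_nonneg (α := ℝ) R]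
    have h := hwang_cpt hs (A := M * A) (by positivity) (a := fun z => chi ((R : ℝ) + 1) z.1 * a z)
      (((chi_contDiff _).comp contDiff_fst).mul ha) ?_ (hM _ hR a A hA ha hAB) hF
    · rw [mul_right_comm] at h
      refine le_trans (le_of_eq ?_) h
      congr 1
      funext x
      rw [← integral_const_mul]
      refine integral_congr_ae (Filter.Eventually.of_forall fun ξ => ?_)
      simp only []
      ring
    · refine HasCompactSupport.intro ((chi_hcs (n := n) (lt_of_lt_of_le one_pos hR)).isCompact.prod hK) ?_
      rintro ⟨x, ξ⟩ hz
      simp only [Set.mem_prod, not_and_or] at hz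
      rcases hz with hz | hz
      · simp [image_eq_zero_of_notMem_tsupport hz]
      · simp [haK x ξ hz]
  have hm : AEStronglyMeasurable (fun x => ∫ ξ, Complex.exp (I * ((⟪x, ξ⟫ : ℝ) : ℂ)) * a (x, ξ) * F ξ) volume := by
    have : AEStronglyMeasurable (fun p : En n × En n =>
        Complex.exp (I * ((⟪p.1, p.2⟫ : ℝ) : ℂ)) * a (p.1, p.2) * F p.2) (volume.prod volume) := by
      refine AEStronglyMeasurable.mul ?_ (AEStronglyMeasurable.comp_snd hF.1)
      refine Continuous.aestronglyMeasurable ?_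
      have := ha.continuous
      fun_prop
    exact this.integral_prod_right'
  refine (Lp.eLpNorm_lim_le_liminf_eLpNorm (f := fun (R : ℕ) x => chi ((R : ℝ) + 1) x *
      ∫ ξ, Complex.exp (I * ((⟪x, ξ⟫ : ℝ) : ℂ)) * a (x, ξ) * F ξ)
      (fun R => (chi_contDiff _).continuous.aestronglyMeasurable.mul hm) _ (Filter.Eventually.of_forall fun x => ?_)).trans ?_
  · have h1 : Filter.Tendsto (fun R : ℕ => chi ((R : ℝ) + 1) x) Filter.atTop (nhds 1) := by
      have h2 : Filter.Tendsto (fun R : ℕ => ((R : ℝ) + 1)⁻¹ • x) Filter.atTop (nhds 0) := by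
        have h3 := (tendsto_one_div_add_atTop_nhds_zero_nat (𝕜 := ℝ)).smul_const x
        simpa using h3
      have h4 := ((chi_contDiff (n := n) 1).continuous.tendsto 0).comp h2
      rw [chi_zero] at h4
      refine h4.congr fun R => ?_
      exact (chi_dil _ x).symm
    have := h1.mul_const (∫ ξ, Complex.exp (I * ((⟪x, ξ⟫ : ℝ) : ℂ)) * a (x, ξ) * F ξ)
    rwa [one_mul] at this
  · exact Filter.liminf_le_of_le (by isBoundedDefault) fun b hb => by
      obtain ⟨R, hR⟩ := hb.exists
      exact hR.trans (key R)

end cutoff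

open scoped ContDiff

section final
variable {n : ℕ}

lemma mderiv_zero {n : ℕ} {W F : Type*} [NormedAddCommGroup W] [NormedSpace ℝ W]
    [NormedAddCommGroup F] [NormedSpace ℝ F] (dirs : Fin n → W) (g : W → F) :
    mderiv dirs 0 g = g := by
  unfold mderiv
  rw [foldr_id _ _ (fun i => by simp)]
  rfl

lemma mdeg_zero {n : ℕ} : mdeg (0 : Fin n → ℕ) = 0 := by simp [mdeg]

lemma AB_of {A : ℝ} {a : En n × En n → ℂ} (ha : ContDiff ℝ ∞ a)
    (h : ∀ α β : Fin n → ℕ, mdeg α ≤ n / 2 + 1 → mdeg β ≤ n / 2 + 1 →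
          ∀ z, ‖mderiv dX α (mderiv dY β a) z‖ ≤ A) : AB (n / 2 + 1) A a := by
  intro j z
  cases j with
  | none =>
    simp only [DYs]
    refine ⟨?_, fun k m hm => ?_⟩
    · have := h 0 0 (by simp [mdeg_zero]) (by simp [mdeg_zero]) z
      rwa [mderiv_zero, mderiv_zero] at this
    · have := h (Pi.single k m) 0 (by rwa [mdeg_single]) (by simp [mdeg_zero]) z
      rwa [mderiv_zero, mderiv_single] at this
  | some j =>
    simp only [DYs]
    refine ⟨?_, fun k m hm => ?_⟩
    · have := h 0 (Pi.single j (n / 2 + 1)) (by simp [mdeg_zero]) (by rw [mdeg_single]) z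
      rw [mderiv_zero, mderiv_single] at this
      rw [norm_mul, norm_pow, Complex.norm_I, one_pow, one_mul]
      exact this
    · have := h (Pi.single k m) (Pi.single j (n / 2 + 1)) (by rwa [mdeg_single]) (by rw [mdeg_single]) z
      rw [mderiv_single, mderiv_single] at this
      rw [dLine_const_mul_iter _ _ _ (dLine_iter_contDiff _ _ ha), norm_mul, norm_pow, Complex.norm_I,
        one_pow, one_mul]
      exact this

end final

/-- `L²`-boundedness of `Tu(x) = ∫∫ e^{i(x·ξ+φ(y,ξ))} a(x,ξ) u(y) dy dξ` when `∂_x^α ∂_ξ^β a ∈ L^∞` for `|α|, |β| ≤ ⌊n/2⌋+1`, with constant depending only on `n`, `C₀`, the phase constants and the bound `A`, independent of the compact set `K`. -/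
theorem statement5 (n : ℕ) (C₀ : ℝ) (hC₀ : 0 < C₀) (Cph : (Fin n → ℕ) → ℝ) (A : ℝ) :
    ∃ C : ℝ, 0 < C ∧
      ∀ (φ : EuclideanSpace ℝ (Fin n) × EuclideanSpace ℝ (Fin n) → ℝ)
        (a : EuclideanSpace ℝ (Fin n) × EuclideanSpace ℝ (Fin n) → ℂ)
        (K : Set (EuclideanSpace ℝ (Fin n))), IsCompact K →
        ContDiff ℝ (⊤ : ℕ∞) φ →
        -- nondegeneracy of the mixed Hessian `∂_y∂_ξ φ`:
        (∀ z, C₀ ≤ |Matrix.det (Matrix.of fun i j => mixedHessXY φ i j z)|) →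
        -- bounded derivatives of the entries of `∂_y∂_ξ φ`:
        (∀ i j : Fin n, ∀ α : Fin n → ℕ, mdeg α ≤ 2 * n + 1 →
          (∀ z, |mderiv dX α (mixedHessXY φ i j) z| ≤ Cph α) ∧
          (∀ z, |mderiv dY α (mixedHessXY φ i j) z| ≤ Cph α)) →
        -- `a` vanishes for `ξ` outside the compact set `K`:
        (∀ x ξ, ξ ∉ K → a (x, ξ) = 0) →
        ContDiff ℝ (⊤ : ℕ∞) a →
        -- derivatives of the amplitude of order `≤ ⌊n/2⌋+1` in each group are bounded by `A`:
        (∀ α β : Fin n → ℕ, mdeg α ≤ n / 2 + 1 → mdeg β ≤ n / 2 + 1 →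
          ∀ z, ‖mderiv dX α (mderiv dY β a) z‖ ≤ A) →
        ∀ u : 𝓢(EuclideanSpace ℝ (Fin n), ℂ),
          eLpNorm (fun x => ∫ ξ, ∫ y,
              Complex.exp (Complex.I * ((⟪x, ξ⟫ + φ (y, ξ) : ℝ) : ℂ)) * a (x, ξ) * u y)
              2 volume
            ≤ ENNReal.ofReal C * eLpNorm (⇑u) 2 volume := by
  set B : ℝ := ∑ l : Fin n, ∑ m ∈ Finset.range (2 * n + 2), |Cph (Pi.single l m)| with hB
  have hB0 : 0 ≤ B := by positivity
  obtain ⟨C1, hC1, hS⟩ := S_bound n B C₀ hC₀ hB0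
  obtain ⟨C2, hC2, hH⟩ := hwang n (n / 2 + 1) (by omega)
  have hpos : 0 ≤ C2 * |A| := by positivity
  refine ⟨C2 * |A| * C1 + 1, by positivity, ?_⟩
  intro φ a K hK hφ hdet hph haK ha hA u
  have hG : Good B C₀ φ := by
    refine ⟨hφ, hdet, fun i j l m hm z => ?_⟩
    have h1 := hph i j (Pi.single l m) (by rwa [mdeg_single])
    have h2 : Cph (Pi.single l m) ≤ B := by
      refine (le_abs_self _).trans ?_
      refine le_trans ?_ (Finset.single_le_sum (f := fun l => ∑ m ∈ Finset.range (2 * n + 2), |Cph (Pi.single l m)|)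
        (fun _ _ => by positivity) (Finset.mem_univ l))
      exact Finset.single_le_sum (f := fun m => |Cph (Pi.single l m)|)
        (fun _ _ => abs_nonneg _) (Finset.mem_range.2 (by omega))
    have h3 := h1.1 z
    have h4 := h1.2 z
    rw [mderiv_single] at h3 h4
    exact ⟨h3.trans h2, h4.trans h2⟩
  have hAB : AB (n / 2 + 1) |A| a :=
    AB_of ha fun α β h1 h2 z => (hA α β h1 h2 z).trans (le_abs_self A)
  have hu2 : MemLp (⇑u) 2 (volume : Measure (En n)) := u.memLp 2 volume
  have hu1 : Integrable (⇑u) (volume : Measure (En n)) := u.integrable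
  have hSu := hS φ hG u hu2 hu1
  have hSm : AEStronglyMeasurable (fun ξ => ∫ y, Complex.exp (I * ((φ (y, ξ) : ℝ) : ℂ)) * u y)
      (volume : Measure (En n)) := by
    have : AEStronglyMeasurable (fun p : En n × En n =>
        Complex.exp (I * ((φ (p.2, p.1) : ℝ) : ℂ)) * u p.2) (volume.prod volume) := by
      refine Continuous.aestronglyMeasurable ?_
      have := hφ.continuous
      have := u.continuous
      fun_prop
    exact this.integral_prod_right'
  have hSL : MemLp (fun ξ => ∫ y, Complex.exp (I * ((φ (y, ξ) : ℝ) : ℂ)) * u y) 2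
      (volume : Measure (En n)) :=
    ⟨hSm, hSu.trans_lt (ENNReal.mul_lt_top ENNReal.ofReal_lt_top hu2.2)⟩
  have hT := hH a |A| K (abs_nonneg A) hK ha haK hAB _ hSL
  have e : (fun x : En n => ∫ ξ, ∫ y,
      Complex.exp (Complex.I * ((⟪x, ξ⟫ + φ (y, ξ) : ℝ) : ℂ)) * a (x, ξ) * u y) =
      fun x => ∫ ξ, Complex.exp (I * ((⟪x, ξ⟫ : ℝ) : ℂ)) * a (x, ξ) *
        ∫ y, Complex.exp (I * ((φ (y, ξ) : ℝ) : ℂ)) * u y := by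
    funext x
    refine integral_congr_ae (Filter.Eventually.of_forall fun ξ => ?_)
    simp only []
    rw [← integral_const_mul]
    refine integral_congr_ae (Filter.Eventually.of_forall fun y => ?_)
    simp only []
    have : I * ((⟪x, ξ⟫ + φ (y, ξ) : ℝ) : ℂ) = I * ((⟪x, ξ⟫ : ℝ) : ℂ) + I * ((φ (y, ξ) : ℝ) : ℂ) := by
      push_cast; ring
    rw [this, Complex.exp_add]
    ring
  rw [e]
  refine hT.trans ((mul_le_mul_right hSu _).trans ?_)
  rw [← mul_assoc, ← ENNReal.ofReal_mul hpos]
  exact mul_le_mul_left (ENNReal.ofReal_le_ofReal (by linarith)) _
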